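/- Let X ⊂ ℝ^{n+1} be a convex surface, let x₀ ∈ X be fixed, and let (e,V) give a standard chart on X with associated convex function f. Then the function x ↦ dist_X(x + f(x)e, x₀) is locally DC on the open set {x ∈ V : x + f(x)e ≠ x₀}. -/

import Mathlib

open scoped NNReal

open Set

/-- `f` is DC on the convex set `C`: a difference of two continuous convex functions on `C`. -/
def IsDCOn {E : Type*} [NormedAddCommGroup E] [NormedSpace ℝ E]
    (C : Set E) (f : E → ℝ) : Prop :=
  ∃ g h : E → ℝ, ConvexOn ℝ C g ∧ ConvexOn ℝ C h ∧
    ContinuousOn g C ∧ ContinuousOn h C ∧ ∀ x ∈ C, f x = g x - h x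

/-- A mapping `F : C → F'` is DC if `ℓ ∘ F` is DC for every linear functional `ℓ`. -/
def IsDCMapOn {E F' : Type*} [NormedAddCommGroup E] [NormedSpace ℝ E]
    [NormedAddCommGroup F'] [NormedSpace ℝ F'] (C : Set E) (F : E → F') : Prop :=
  ∀ ℓ : F' →ₗ[ℝ] ℝ, IsDCOn C (fun x => ℓ (F x))

/-- `F` is locally DC on the open set `U`: every point of `U` has an open convex
neighborhood contained in `U` on which `F` is DC. -/
def LocallyDCMapOn {E F' : Type*} [NormedAddCommGroup E] [NormedSpace ℝ E]
    [NormedAddCommGroup F'] [NormedSpace ℝ F'] (U : Set E) (F : E → F') : Prop :=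
  ∀ x ∈ U, ∃ V : Set E, IsOpen V ∧ Convex ℝ V ∧ x ∈ V ∧ V ⊆ U ∧ IsDCMapOn V F

/-- `f` is locally DC on the open set `U`: every point of `U` has an open convex
neighborhood contained in `U` on which `f` is DC. -/
def LocallyDCOn {E : Type*} [NormedAddCommGroup E] [NormedSpace ℝ E]
    (U : Set E) (f : E → ℝ) : Prop :=
  ∀ x ∈ U, ∃ V : Set E, IsOpen V ∧ Convex ℝ V ∧ x ∈ V ∧ V ⊆ U ∧ IsDCOn V f

/-- A convex body: a compact convex set with nonempty interior. -/
def IsConvexBody {E : Type*} [NormedAddCommGroup E] [NormedSpace ℝ E] (C : Set E) : Prop :=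
  IsCompact C ∧ Convex ℝ C ∧ (interior C).Nonempty

/-- A convex surface: the boundary of a convex body. -/
def IsConvexSurface {E : Type*} [NormedAddCommGroup E] [NormedSpace ℝ E] (X : Set E) : Prop :=
  ∃ C : Set E, IsConvexBody C ∧ X = frontier C

/-- The intrinsic distance on `X ⊆ E`: the infimum of lengths (total variations) of
continuous curves `γ : [0,1] → E` joining `a` and `b` within `X`. -/
noncomputable def intrinsicDist {E : Type*} [NormedAddCommGroup E] [NormedSpace ℝ E]
    (X : Set E) (a b : E) : ℝ :=
  (⨅ γ : {γ : ℝ → E // ContinuousOn γ (Set.Icc 0 1) ∧ γ 0 = a ∧ γ 1 = b ∧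
      Set.MapsTo γ (Set.Icc 0 1) X},
    eVariationOn γ.1 (Set.Icc 0 1)).toReal

/-- An `(e,V)`-standard chart on `X`, given by a unit vector `e`, a convex open subset `V`
of the hyperplane `e^⊥`, and a Lipschitz convex function `f : V → ℝ` whose graph
`{x + f(x)e : x ∈ V}` is a relatively open subset of `X`. -/
def IsStandardChart {E : Type*} [NormedAddCommGroup E] [InnerProductSpace ℝ E]
    (X : Set E) (e : E) (V : Set ↥((Submodule.span ℝ {e})ᗮ))
    (f : ↥((Submodule.span ℝ {e})ᗮ) → ℝ) : Prop :=
  ‖e‖ = 1 ∧ IsOpen V ∧ Convex ℝ V ∧ ConvexOn ℝ V f ∧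
    (∃ K : ℝ≥0, LipschitzOnWith K f V) ∧
    ∃ O : Set E, IsOpen O ∧
      (fun x : ↥((Submodule.span ℝ {e})ᗮ) => (x : E) + f x • e) '' V = X ∩ O

section PathDistance

open scoped ENNReal

/-- The extended intrinsic distance: the infimum of the lengths of continuous curves in `X`
joining `a` to `b`. -/
noncomputable def pathEDist {E : Type*} [NormedAddCommGroup E] [NormedSpace ℝ E]
    (X : Set E) (a b : E) : ℝ≥0∞ :=
  ⨅ γ : {γ : ℝ → E // ContinuousOn γ (Set.Icc 0 1) ∧ γ 0 = a ∧ γ 1 = b ∧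
      Set.MapsTo γ (Set.Icc 0 1) X}, eVariationOn γ.1 (Set.Icc 0 1)

variable {E : Type*} [NormedAddCommGroup E] [NormedSpace ℝ E]
  {F : Type*} [NormedAddCommGroup F] [NormedSpace ℝ F]

lemma pathEDist_le {X : Set E} {a b : E} (γ : ℝ → E) (hγ : ContinuousOn γ (Icc 0 1))
    (h0 : γ 0 = a) (h1 : γ 1 = b) (hX : MapsTo γ (Icc 0 1) X) :
    pathEDist X a b ≤ eVariationOn γ (Icc 0 1) :=
  iInf_le_of_le ⟨γ, hγ, h0, h1, hX⟩ le_rfl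

lemma exists_curve_of_pathEDist_lt {X : Set E} {a b : E} {L : ℝ≥0∞} (h : pathEDist X a b < L) :
    ∃ γ : ℝ → E, ContinuousOn γ (Icc 0 1) ∧ γ 0 = a ∧ γ 1 = b ∧ MapsTo γ (Icc 0 1) X ∧
      eVariationOn γ (Icc 0 1) < L := by
  obtain ⟨⟨γ, h1, h2, h3, h4⟩, h⟩ := iInf_lt_iff.1 h
  exact ⟨γ, h1, h2, h3, h4, h⟩

lemma pathEDist_map_le {X : Set E} {Y : Set F} {T : E → F} {K : ℝ≥0}
    (hK : K ≠ 0) (hT : LipschitzOnWith K T X) (hXY : MapsTo T X Y) (a b : E) :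
    pathEDist Y (T a) (T b) ≤ K * pathEDist X a b := by
  rw [pathEDist, pathEDist, ENNReal.mul_iInf_of_ne (by simpa using hK) ENNReal.coe_ne_top]
  refine le_iInf ?_
  rintro ⟨γ, h1, h2, h3, h4⟩
  refine (pathEDist_le (T ∘ γ) (hT.continuousOn.comp h1 h4) (by simp [h2]) (by simp [h3])
    (hXY.comp h4)).trans ?_
  exact hT.comp_eVariationOn_le h4

lemma pathEDist_segment_le (a b : E) : pathEDist (segment ℝ a b) a b ≤ edist a b := by
  have hL : LipschitzOnWith (nndist a b) (AffineMap.lineMap a b : ℝ → E) univ :=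
    (lipschitzWith_lineMap a b).lipschitzOnWith
  refine (pathEDist_le (AffineMap.lineMap a b : ℝ → E) ?_ (by simp) (by simp) ?_).trans ?_
  · exact (AffineMap.lineMap_continuous).continuousOn
  · intro t ht
    rw [segment_eq_image_lineMap]
    exact mem_image_of_mem _ ht
  · have := hL.comp_eVariationOn_le (g := id) (s := Icc (0:ℝ) 1) (fun _ _ => mem_univ _)
    rw [eVariationOn_id_Icc] at this
    rw [Function.comp_id, sub_zero, ENNReal.ofReal_one, mul_one] at this
    rwa [edist_nndist]

lemma pathEDist_self {X : Set E} {a : E} (ha : a ∈ X) : pathEDist X a a = 0 := by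
  refine le_antisymm ((pathEDist_le (fun _ => a) continuousOn_const rfl rfl
    fun _ _ => ha).trans ?_) bot_le
  rw [eVariationOn.constant_on]
  exact fun _ ⟨_, _, h⟩ _ ⟨_, _, h'⟩ => h.symm.trans h'

lemma pathEDist_triangle (X : Set E) (a b c : E) :
    pathEDist X a c ≤ pathEDist X a b + pathEDist X b c := by
  refine ENNReal.le_of_forall_pos_le_add fun ε hε hfin => ?_
  have hab : pathEDist X a b < ⊤ := lt_of_le_of_lt le_self_add hfin
  have hbc : pathEDist X b c < ⊤ := lt_of_le_of_lt le_add_self hfin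
  have hε' : ((ε / 2 : ℝ≥0) : ℝ≥0∞) ≠ 0 := by
    simpa using hε.ne'
  obtain ⟨γ, h1, h2, h3, h4, h5⟩ :=
    exists_curve_of_pathEDist_lt (ENNReal.lt_add_right hab.ne hε')
  obtain ⟨η, g1, g2, g3, g4, g5⟩ :=
    exists_curve_of_pathEDist_lt (ENNReal.lt_add_right hbc.ne hε')
  let θ : ℝ → E := fun t => if t ≤ 1 / 2 then γ (2 * t) else η (2 * t - 1)
  have θ1 : EqOn θ (γ ∘ fun t => 2 * t) (Icc 0 (1 / 2)) := fun t ht => by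
    simp only [θ, if_pos ht.2, Function.comp]
  have θ2 : EqOn θ (η ∘ fun t => 2 * t - 1) (Icc (1 / 2) 1) := fun t ht => by
    rcases eq_or_lt_of_le ht.1 with h | h
    · subst h
      simp [θ, h3, g2]
    · simp only [θ, if_neg (not_le.2 h), Function.comp]
  have m1 : MapsTo (fun t : ℝ => 2 * t) (Icc 0 (1 / 2)) (Icc 0 1) := fun t ht =>
    ⟨by linarith [ht.1], by linarith [ht.2]⟩
  have m2 : MapsTo (fun t : ℝ => 2 * t - 1) (Icc (1 / 2) 1) (Icc 0 1) := fun t ht =>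
    ⟨by linarith [ht.1], by linarith [ht.2]⟩
  have hu : Icc (0:ℝ) 1 = Icc 0 (1 / 2) ∪ Icc (1 / 2) 1 :=
    (Icc_union_Icc_eq_Icc (by norm_num) (by norm_num)).symm
  have hθ : pathEDist X a c ≤ eVariationOn θ (Icc 0 1) := by
    refine pathEDist_le θ ?_ (by simp [θ, h2]) (by norm_num [θ, g3]) ?_
    · rw [hu]
      refine ContinuousOn.union_of_isClosed ?_ ?_ isClosed_Icc isClosed_Icc
      · exact (h1.comp (by fun_prop) m1).congr θ1
      · exact (g1.comp (by fun_prop) m2).congr θ2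
    · rw [hu]
      rintro t (ht | ht)
      · rw [θ1 ht]; exact h4 (m1 ht)
      · rw [θ2 ht]; exact g4 (m2 ht)
  have hv := eVariationOn.Icc_add_Icc θ (s := univ) (a := 0) (b := (1 / 2 : ℝ)) (c := 1)
    (by norm_num) (by norm_num) (mem_univ _)
  simp only [univ_inter] at hv
  have e1 : eVariationOn θ (Icc 0 (1 / 2)) ≤ eVariationOn γ (Icc 0 1) := by
    rw [eVariationOn.eq_of_eqOn θ1]
    exact eVariationOn.comp_le_of_monotoneOn _ _ (fun x _ y _ h => by linarith) m1
  have e2 : eVariationOn θ (Icc (1 / 2) 1) ≤ eVariationOn η (Icc 0 1) := by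
    rw [eVariationOn.eq_of_eqOn θ2]
    exact eVariationOn.comp_le_of_monotoneOn _ _ (fun x _ y _ h => by linarith) m2
  calc pathEDist X a c ≤ eVariationOn θ (Icc 0 1) := hθ
    _ ≤ (pathEDist X a b + (ε / 2 : ℝ≥0)) + (pathEDist X b c + (ε / 2 : ℝ≥0)) := by
        rw [← hv]; exact add_le_add (e1.trans h5.le) (e2.trans g5.le)
    _ = pathEDist X a b + pathEDist X b c + ((ε / 2 + ε / 2 : ℝ≥0) : ℝ≥0∞) := by
        push_cast; ring
    _ = _ := by rw [add_halves]

lemma pathEDist_le_sum (X : Set E) (a : ℕ → E) (N : ℕ) (d : ℕ → ℝ) (hd : ∀ i < N, 0 ≤ d i)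
    (h : ∀ i < N, pathEDist X (a i) (a (i + 1)) ≤ ENNReal.ofReal (d i))
    (h0 : pathEDist X (a 0) (a 0) = 0) :
    pathEDist X (a 0) (a N) ≤ ENNReal.ofReal (∑ i ∈ Finset.range N, d i) := by
  induction N with
  | zero => simp [h0]
  | succ N ih =>
    rw [Finset.sum_range_succ, ENNReal.ofReal_add
      (Finset.sum_nonneg fun i hi => hd i (by simp at hi; omega)) (hd N (by omega))]
    exact (pathEDist_triangle X _ (a N) _).trans (add_le_add
      (ih (fun i hi => hd i (by omega)) (fun i hi => h i (by omega))) (h N (by omega)))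

/-- A curve in `X` can be replaced by an inscribed chain of arbitrarily small mesh. -/
lemma exists_chain_of_pathEDist_lt {X : Set E} {a b : E} {L δ : ℝ} (hδ : 0 < δ)
    (h : pathEDist X a b < ENNReal.ofReal L) :
    ∃ (N : ℕ) (x : ℕ → E), x 0 = a ∧ x N = b ∧ (∀ i ≤ N, x i ∈ X) ∧
      (∀ i < N, ‖x (i + 1) - x i‖ ≤ δ) ∧
      ∑ i ∈ Finset.range N, ‖x (i + 1) - x i‖ ≤ L := by
  obtain ⟨γ, h1, h2, h3, h4, h5⟩ := exists_curve_of_pathEDist_lt h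
  have huc := isCompact_Icc.uniformContinuousOn_of_continuous h1
  rw [Metric.uniformContinuousOn_iff_le] at huc
  obtain ⟨r, hr, hu⟩ := huc δ hδ
  obtain ⟨N, hN⟩ := exists_nat_gt (1 / r)
  have hN0 : (0:ℝ) < N := lt_trans (by positivity) hN
  have hNr : 1 / (N:ℝ) ≤ r := by
    rw [div_le_iff₀ hN0]
    rw [div_lt_iff₀ hr] at hN
    linarith
  have hmem : ∀ i ≤ N, (i:ℝ) / N ∈ Icc (0:ℝ) 1 := fun i hi =>
    ⟨by positivity, (div_le_one hN0).2 (by exact_mod_cast hi)⟩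
  refine ⟨N, fun i => γ (i / N), by simp [h2], by simp [hN0.ne', h3], fun i hi => h4 (hmem i hi),
    fun i hi => ?_, ?_⟩
  · rw [← dist_eq_norm]
    refine hu _ (hmem _ hi) _ (hmem _ hi.le) ?_
    rw [Real.dist_eq, ← sub_div]
    push_cast
    rw [add_sub_cancel_left, abs_of_pos (by positivity)]
    exact hNr
  · have hs := eVariationOn.sum_le_of_monotoneOn_Icc (f := γ) (s := Icc (0:ℝ) 1) (m := 0) (n := N)
      (u := fun i : ℕ => (i:ℝ) / N) (fun i _ j _ hij => by
        dsimp; gcongr) (fun i hi => hmem i hi.2)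
    have := (hs.trans h5.le)
    rw [← Finset.range_eq_Ico] at this
    simp only [edist_dist, dist_eq_norm] at this
    rw [← ENNReal.ofReal_sum_of_nonneg (fun _ _ => norm_nonneg _)] at this
    have hL : 0 < L := by
      by_contra hL
      rw [ENNReal.ofReal_of_nonpos (not_lt.1 hL)] at h
      exact not_lt_bot h
    exact (ENNReal.ofReal_le_ofReal_iff hL.le).1 this

end PathDistance

section ConvexRetraction

variable {E : Type*} [NormedAddCommGroup E] [InnerProductSpace ℝ E]

/-- The nearest point retraction onto a closed convex set: it is `1`-Lipschitz, and it maps the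
complement of the interior to the boundary. -/
lemma exists_convex_retraction [CompleteSpace E] {C : Set E} (hC : IsClosed C)
    (hconv : Convex ℝ C) (hne : C.Nonempty) :
    ∃ π : E → E, LipschitzWith 1 π ∧ (∀ x ∈ C, π x = x) ∧
      (∀ x, x ∉ interior C → π x ∈ frontier C) ∧ (∀ x, ∀ y ∈ C, ‖x - π x‖ ≤ ‖x - y‖) ∧
      (∀ x, x ∉ interior C → ∀ z ∈ segment ℝ x (π x), z ∉ interior C) := by
  choose π hπC hmin using fun x => exists_norm_eq_iInf_of_complete_convex hne hC.isComplete hconv x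
  have hvar : ∀ x, ∀ w ∈ C, inner ℝ (x - π x) (w - π x) ≤ 0 := fun x =>
    (norm_eq_iInf_iff_real_inner_le_zero hconv (hπC x)).1 (hmin x)
  have hmin' : ∀ x, ∀ y ∈ C, ‖x - π x‖ ≤ ‖x - y‖ := fun x y hy => by
    rw [hmin x]
    exact ciInf_le (f := fun w : C => ‖x - w‖) ⟨0, by rintro _ ⟨w, rfl⟩; positivity⟩ ⟨y, hy⟩
  have hfix : ∀ x ∈ C, π x = x := fun x hx => by
    have := hmin' x x hx
    simp only [sub_self, norm_zero, norm_le_zero_iff] at this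
    exact (sub_eq_zero.1 this).symm
  have hfr : ∀ x, x ∉ interior C → π x ∈ frontier C := by
    intro x hx
    rw [hC.frontier_eq]
    refine ⟨hπC x, fun hi => hx ?_⟩
    suffices x = π x by rwa [this]
    have hcont : Filter.Tendsto (fun s : ℝ => π x + s • (x - π x)) (nhds 0) (nhds (π x)) := by
      have : Continuous (fun s : ℝ => π x + s • (x - π x)) := by fun_prop
      simpa using this.tendsto 0
    have hev := hcont.eventually (isOpen_interior.mem_nhds hi)
    obtain ⟨s, hs, hs0⟩ := ((hev.filter_mono nhdsWithin_le_nhds).and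
      (self_mem_nhdsWithin (a := (0:ℝ)) (s := Ioi 0))).exists
    have := hvar x _ (interior_subset hs)
    rw [add_sub_cancel_left, inner_smul_right, real_inner_self_eq_norm_sq] at this
    have h2 : ‖x - π x‖ ^ 2 ≤ 0 := by
      by_contra h
      have := mul_pos (show 0 < s from hs0) (not_le.1 h)
      linarith
    have h3 : ‖x - π x‖ = 0 := by nlinarith [norm_nonneg (x - π x)]
    exact sub_eq_zero.1 (norm_eq_zero.1 h3)
  refine ⟨π, ?_, hfix, hfr, hmin', ?_⟩
  · refine LipschitzWith.of_dist_le_mul fun x y => ?_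
    rw [dist_eq_norm, dist_eq_norm, NNReal.coe_one, one_mul]
    have h1 := hvar x _ (hπC y)
    have h2 := hvar y _ (hπC x)
    have h3 : ‖π x - π y‖ ^ 2 ≤ inner ℝ (x - y) (π x - π y) := by
      rw [← real_inner_self_eq_norm_sq]
      have e1 : inner ℝ (x - π x) (π y - π x) = - inner ℝ (x - π x) (π x - π y) := by
        rw [← inner_neg_right, neg_sub]
      have e2 : inner ℝ (x - y) (π x - π y) - inner ℝ (π x - π y) (π x - π y)
          = inner ℝ (x - π x) (π x - π y) - inner ℝ (y - π y) (π x - π y) := by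
        rw [← inner_sub_left, ← inner_sub_left]
        congr 1
        abel
      linarith
    have h4 := real_inner_le_norm (x - y) (π x - π y)
    rcases (norm_nonneg (π x - π y)).eq_or_lt with h | h
    · rw [← h]; positivity
    · nlinarith
  · rintro x hx z ⟨p, q, hp, hq, hpq, rfl⟩ hz
    have hpi := hfr x hx
    have := hvar x _ (interior_subset hz)
    have e : p • x + q • π x - π x = p • (x - π x) := by
      rw [show q = 1 - p by linarith]; module
    rw [e, inner_smul_right, real_inner_self_eq_norm_sq] at this
    have h0 : p * ‖x - π x‖ ^ 2 = 0 := le_antisymm this (by positivity)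
    have h1 : p • (x - π x) = 0 := by
      rcases mul_eq_zero.1 h0 with h | h
      · simp [h]
      · have : x - π x = 0 := by simpa using h
        simp [this]
    have h2 : p • x + q • π x = π x := sub_eq_zero.1 (e.trans h1)
    rw [h2] at hz
    exact hpi.2 hz

lemma pathEDist_frontier_segment_le {C : Set E} {π : E → E} (hπ : LipschitzWith 1 π)
    (hfr : ∀ x, x ∉ interior C → π x ∈ frontier C) {z w : E}
    (h : ∀ y ∈ segment ℝ z w, y ∉ interior C) :
    pathEDist (frontier C) (π z) (π w) ≤ edist z w := by
  refine (pathEDist_map_le one_ne_zero (hπ.lipschitzOnWith (s := segment ℝ z w))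
    (fun y hy => hfr y (h y hy)) z w).trans ?_
  simpa using pathEDist_segment_le z w

end ConvexRetraction

section ConvexSublevel

variable {E : Type*} [NormedAddCommGroup E] [InnerProductSpace ℝ E] {F : E → ℝ}

lemma ConvexOn.scale_ge (hF : ConvexOn ℝ univ F) {s : ℝ} (hs : 0 ≤ s) (z : E) :
    (1 + s) * F z - s * F 0 ≤ F ((1 + s) • z) := by
  have h1 : (0:ℝ) < 1 + s := by linarith
  have := hF.2 (mem_univ ((1 + s) • z)) (mem_univ 0) (show 0 ≤ 1 / (1 + s) by positivity)
    (show 0 ≤ s / (1 + s) by positivity) (by field_simp)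
  rw [smul_zero, add_zero, smul_smul, one_div_mul_cancel h1.ne', one_smul, smul_eq_mul,
    smul_eq_mul] at this
  have h2 := mul_le_mul_of_nonneg_left this h1.le
  have h3 : (1 + s) * (1 / (1 + s) * F ((1 + s) • z) + s / (1 + s) * F 0)
      = F ((1 + s) • z) + s * F 0 := by field_simp
  linarith

lemma notMem_interior_sublevel (hF : ConvexOn ℝ univ F) (h0 : F 0 < 0) {z : E} (hz : 0 ≤ F z) :
    z ∉ interior {x | F x ≤ 0} := by
  intro hi
  have hcont : Filter.Tendsto (fun s : ℝ => (1 + s) • z) (nhds 0) (nhds z) := by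
    have : Continuous (fun s : ℝ => (1 + s) • z) := by fun_prop
    simpa using this.tendsto 0
  have hev := hcont.eventually (isOpen_interior.mem_nhds hi)
  obtain ⟨s, hs, hs0⟩ := ((hev.filter_mono nhdsWithin_le_nhds).and
    (self_mem_nhdsWithin (a := (0:ℝ)) (s := Ioi 0))).exists
  have h1 : F ((1 + s) • z) ≤ 0 := interior_subset (s := {x | F x ≤ 0}) hs
  have hs0' : 0 < s := hs0
  have := hF.scale_ge hs0'.le z
  nlinarith

lemma frontier_sublevel_eq (hF : ConvexOn ℝ univ F) (hc : Continuous F) (h0 : F 0 < 0) :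
    frontier {x | F x ≤ 0} = {x | F x = 0} := by
  ext z
  constructor
  · intro hz
    exact frontier_le_subset_eq hc continuous_const hz
  · intro hz
    have hz' : F z = 0 := hz
    rw [(isClosed_le hc continuous_const).frontier_eq]
    exact ⟨hz'.le, notMem_interior_sublevel hF h0 hz'.ge⟩

/-- The intrinsic distance on the boundary of a convex sublevel set is controlled by the length of
chains that enter the sublevel set only slightly. -/
lemma pathEDist_sublevel_le [CompleteSpace E] (hF : ConvexOn ℝ univ F) (hc : Continuous F)
    {c ξ : ℝ} (hc0 : 0 < c) (h0 : F 0 ≤ -c) (hξ : 0 ≤ ξ) (hξc : 2 * ξ ≤ c) (N : ℕ) (a : ℕ → E)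
    (ha0 : F (a 0) = 0) (haN : F (a N) = 0)
    (hseg : ∀ i < N, ∀ z ∈ segment ℝ (a i) (a (i + 1)), -ξ ≤ F z) :
    pathEDist {x | F x = 0} (a 0) (a N) ≤
      ENNReal.ofReal ((1 + 2 * ξ / c) * ∑ i ∈ Finset.range N, ‖a (i + 1) - a i‖
        + 2 * ξ / c * (‖a 0‖ + ‖a N‖)) := by
  have h0' : F 0 < 0 := by linarith
  set t := 2 * ξ / c with ht
  have ht0 : 0 ≤ t := by positivity
  have htc : t * c = 2 * ξ := by rw [ht]; field_simp
  have ht1 : t ≤ 1 := by rw [ht, div_le_one hc0]; exact hξc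
  obtain ⟨π, hπ, hfix, hfr, -, -⟩ := exists_convex_retraction
    (C := {x | F x ≤ 0}) (isClosed_le hc continuous_const)
    (by simpa using hF.convex_le 0) ⟨0, h0'.le⟩
  have key : ∀ z w : E, (∀ y ∈ segment ℝ z w, 0 ≤ F y) →
      pathEDist {x | F x = 0} (π z) (π w) ≤ ENNReal.ofReal ‖w - z‖ := fun z w h => by
    have := pathEDist_frontier_segment_le hπ hfr (z := z) (w := w)
      (fun y hy => notMem_interior_sublevel hF h0' (h y hy))
    rwa [frontier_sublevel_eq hF hc h0', edist_dist, dist_eq_norm, norm_sub_rev] at this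
  have radial : ∀ z, F z = 0 → ∀ y ∈ segment ℝ z ((1 + t) • z), 0 ≤ F y := by
    rintro z hz y ⟨p, q, hp, hq, hpq, rfl⟩
    have e : p • z + q • (1 + t) • z = (1 + q * t) • z := by
      rw [show p = 1 - q by linarith]; module
    rw [e]
    have := hF.scale_ge (mul_nonneg hq ht0) z
    rw [hz] at this
    have h2 : 0 ≤ q * t := by positivity
    nlinarith
  have e0 : π (a 0) = a 0 := hfix _ ha0.le
  have eN : π (a N) = a N := hfix _ haN.le
  have hmid : pathEDist {x | F x = 0} (π ((1 + t) • a 0)) (π ((1 + t) • a N)) ≤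
      ENNReal.ofReal (∑ i ∈ Finset.range N, (1 + t) * ‖a (i + 1) - a i‖) := by
    refine pathEDist_le_sum {x | F x = 0} (fun i => π ((1 + t) • a i)) N
      (fun i => (1 + t) * ‖a (i + 1) - a i‖) (fun i _ => by positivity) (fun i hi => ?_) ?_
    · refine (key _ _ ?_).trans (le_of_eq ?_)
      · rintro y ⟨p, q, hp, hq, hpq, rfl⟩
        have e : p • (1 + t) • a i + q • (1 + t) • a (i + 1)
            = (1 + t) • (p • a i + q • a (i + 1)) := by module
        rw [e]
        have h1 := hF.scale_ge ht0 (p • a i + q • a (i + 1))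
        have h2 := hseg i hi _ ⟨p, q, hp, hq, hpq, rfl⟩
        nlinarith
      · rw [← smul_sub, norm_smul, Real.norm_of_nonneg (by positivity)]
    · refine pathEDist_self ?_
      have h1 := radial (a 0) ha0 ((1 + t) • a 0) (right_mem_segment _ _ _)
      have h2 := hfr _ (notMem_interior_sublevel hF h0' h1)
      rwa [frontier_sublevel_eq hF hc h0'] at h2
  have hfirst : pathEDist {x | F x = 0} (a 0) (π ((1 + t) • a 0)) ≤
      ENNReal.ofReal (t * ‖a 0‖) := by
    have := key (a 0) ((1 + t) • a 0) (radial _ ha0)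
    rw [e0, add_smul, one_smul, add_sub_cancel_left, norm_smul, Real.norm_of_nonneg ht0] at this
    rwa [add_smul, one_smul]
  have hlast : pathEDist {x | F x = 0} (π ((1 + t) • a N)) (a N) ≤
      ENNReal.ofReal (t * ‖a N‖) := by
    have := key ((1 + t) • a N) (a N) (by rw [segment_symm]; exact radial _ haN)
    rw [eN, add_smul, one_smul, sub_add_cancel_left, norm_neg, norm_smul,
      Real.norm_of_nonneg ht0] at this
    rwa [add_smul, one_smul]
  refine (pathEDist_triangle _ _ (π ((1 + t) • a 0)) _).trans ((add_le_add hfirst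
    ((pathEDist_triangle _ _ (π ((1 + t) • a N)) _).trans (add_le_add hmid hlast))).trans ?_)
  rw [← ENNReal.ofReal_add (by positivity) (by positivity),
    ← ENNReal.ofReal_add (by positivity) (by positivity), ← Finset.mul_sum]
  exact ENNReal.ofReal_le_ofReal (by linarith)

end ConvexSublevel

section SecondVariation

variable {E : Type*} [NormedAddCommGroup E] [InnerProductSpace ℝ E]

/-- Quantitative second order expansions, with uniform constants, of a convex function `F` with
gradient `g` and Hessian `H`, valid at the points of the ball of radius `R`. -/
structure SecondOrderData (F : E → ℝ) (g : E → E) (H : E → E → E → ℝ) (R ρ M : ℝ) : Prop where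
  one_le : 1 ≤ M
  pos : 0 < ρ
  le_one : ρ ≤ 1
  taylor : ∀ z w, ‖z‖ ≤ R → ‖w‖ ≤ ρ →
    |F (z + w) - F z - inner ℝ (g z) w - H z w w / 2| ≤ M * ‖w‖ ^ 3
  grad_taylor : ∀ z w u, ‖z‖ ≤ R → ‖w‖ ≤ ρ →
    |inner ℝ (g (z + w) - g z) u - H z w u| ≤ M * ‖w‖ ^ 2 * ‖u‖
  grad_lip : ∀ z w, ‖z‖ ≤ R → ‖w‖ ≤ ρ → ‖g (z + w) - g z‖ ≤ M * ‖w‖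
  hess_lip : ∀ z w u, ‖z‖ ≤ R → ‖w‖ ≤ ρ → |H (z + w) u u - H z u u| ≤ M * ‖w‖ * ‖u‖ ^ 2
  grad_le : ∀ z, ‖z‖ ≤ R → ‖g z‖ ≤ M
  hess_le : ∀ z u v, ‖z‖ ≤ R → |H z u v| ≤ M * ‖u‖ * ‖v‖
  hess_diff : ∀ z u v, ‖z‖ ≤ R → |H z u u - H z v v| ≤ M * ‖u - v‖ * (‖u‖ + ‖v‖)
  hess_nonneg : ∀ z u, 0 ≤ H z u u
  hess_smul : ∀ z u v, ∀ a : ℝ, H z (a • u) (a • v) = a ^ 2 * H z u v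
  cauchy_schwarz : ∀ z u v, (H z u v) ^ 2 ≤ H z u u * H z v v
  grad_ineq : ∀ z w, F z + inner ℝ (g z) (w - z) ≤ F w

/-- The second order displacement which brings `x ± w`, with `w` tangent to the level set through
`x`, back to this level set. -/
noncomputable def levelCorrection (g : E → E) (H : E → E → E → ℝ) (x w : E) : E :=
  (H x w w / ‖g x‖ ^ 2 / 2) • g x

/-- The tangential projection at `y` of a vector `u`. -/
noncomputable def tangentProj (g : E → E) (y u : E) : E :=
  u - (inner ℝ (g y) u / ‖g y‖ ^ 2) • g y

lemma inner_tangentProj (g : E → E) (y u : E) (h : g y ≠ 0) :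
    inner ℝ (g y) (tangentProj g y u) = 0 := by
  have : ‖g y‖ ≠ 0 := norm_ne_zero_iff.2 h
  rw [tangentProj, inner_sub_right, inner_smul_right, real_inner_self_eq_norm_sq]
  field_simp
  ring

lemma norm_sub_tangentProj (g : E → E) (y u : E) (h : g y ≠ 0) :
    ‖tangentProj g y u - u‖ = |inner ℝ (g y) u| / ‖g y‖ := by
  have : ‖g y‖ ≠ 0 := norm_ne_zero_iff.2 h
  rw [tangentProj, sub_sub_cancel_left, norm_neg, norm_smul, Real.norm_eq_abs, abs_div, abs_pow,
    abs_norm]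
  field_simp

lemma norm_tangentProj_le (g : E → E) (y u : E) (h : g y ≠ 0) : ‖tangentProj g y u‖ ≤ ‖u‖ := by
  have h1 : inner ℝ (tangentProj g y u) (u - tangentProj g y u) = 0 := by
    rw [show u - tangentProj g y u = (inner ℝ (g y) u / ‖g y‖ ^ 2) • g y by simp [tangentProj],
      inner_smul_right, real_inner_comm (g y), inner_tangentProj g y u h, mul_zero]
  have h2 := norm_add_sq_eq_norm_sq_add_norm_sq_real h1
  rw [add_sub_cancel] at h2
  nlinarith [norm_nonneg (u - tangentProj g y u), norm_nonneg u, norm_nonneg (tangentProj g y u)]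

lemma norm_add_add_norm_sub_le {P Q : E} {η s : ℝ} (hη : 0 ≤ η) (hs : 0 ≤ s)
    (h : ‖P‖ ^ 2 + ‖Q‖ ^ 2 ≤ η ^ 2 * (1 + s)) : ‖P + Q‖ + ‖P - Q‖ ≤ 2 * η + η * s := by
  have h1 := parallelogram_law_with_norm ℝ P Q
  have h2 : (‖P + Q‖ + ‖P - Q‖) ^ 2 ≤ (2 * η + η * s) ^ 2 := by
    nlinarith [sq_nonneg (‖P + Q‖ - ‖P - Q‖), sq_nonneg (η * s)]
  exact abs_le_of_sq_le_sq' h2 (by positivity) |>.2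

set_option maxHeartbeats 2000000 in
/-- The second variation estimate for one step of a chain in the level set `{F = 0}`: the variation
fields `± φ u` and `± ψ u'` produce two chains whose total length is controlled independently of
the curvature, up to terms of higher order. -/
lemma SecondOrderData.step {F : E → ℝ} {g : E → E} {H : E → E → E → ℝ} {R ρ M : ℝ}
    (D : SecondOrderData F g H R ρ M) {c Q : ℝ} (hc : 0 < c) (hQ : 0 ≤ Q) :
    ∃ K : ℝ, 0 ≤ K ∧ ∀ (x y u : E) (q φ ψ h : ℝ), ‖x‖ ≤ R → ‖y‖ ≤ R → F x = 0 → F y = 0 →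
      c ≤ ‖g x‖ → c ≤ ‖g y‖ → ‖y - x‖ ≤ ρ → inner ℝ (g x) u = 0 → ‖u‖ ≤ h → h ≤ 1 → 0 ≤ q →
      q ≤ Q → 0 ≤ φ → φ ≤ 1 → 0 ≤ ψ → ψ ≤ 1 → φ - ψ = q * ‖y - x‖ →
      ‖(y + ψ • tangentProj g y u - levelCorrection g H y (ψ • tangentProj g y u)) -
          (x + φ • u - levelCorrection g H x (φ • u))‖ +
        ‖(y - ψ • tangentProj g y u - levelCorrection g H y (ψ • tangentProj g y u)) -
          (x - φ • u - levelCorrection g H x (φ • u))‖ ≤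
      2 * ‖y - x‖ + ‖y - x‖ * (q ^ 2 * h ^ 2 + K * (h ^ 4 + ‖y - x‖ * h ^ 2)) := by
  have hM : 0 < M := lt_of_lt_of_le one_pos D.one_le
  obtain ⟨C1, hC1⟩ : ∃ r, r = Q + M / c := ⟨_, rfl⟩
  obtain ⟨C2, hC2⟩ : ∃ r, r = M + 2 * M * C1 := ⟨_, rfl⟩
  obtain ⟨C3, hC3⟩ : ∃ r, r = 2 * M ^ 2 / c ^ 4 := ⟨_, rfl⟩
  obtain ⟨C4, hC4⟩ : ∃ r, r = C2 / c ^ 2 + M * C3 := ⟨_, rfl⟩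
  obtain ⟨C5, hC5⟩ : ∃ r, r = (C4 * M + M / c ^ 2 * M) / 2 := ⟨_, rfl⟩
  obtain ⟨C6, hC6⟩ : ∃ r, r = 3 * (M / c ^ 2) * M + C4 * M / 2 := ⟨_, rfl⟩
  obtain ⟨C7, hC7⟩ : ∃ r, r = C6 + 2 * M ^ 2 / c ^ 2 + M ^ 2 * C3 := ⟨_, rfl⟩
  have hC1' : 0 ≤ C1 := by rw [hC1]; positivity
  have hC2' : 0 ≤ C2 := by rw [hC2]; positivity
  have hC3' : 0 ≤ C3 := by rw [hC3]; positivity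
  have hC4' : 0 ≤ C4 := by rw [hC4]; positivity
  have hC5' : 0 ≤ C5 := by rw [hC5]; positivity
  have hC6' : 0 ≤ C6 := by rw [hC6]; positivity
  have hC7' : 0 ≤ C7 := by rw [hC7]; positivity
  refine ⟨C5 ^ 2 + C7, by positivity, ?_⟩
  intro x y u q φ ψ h hx hy hFx hFy hgx hgy hη hu huh hh1 hq0 hqQ hφ0 hφ1 hψ0 hψ1 hφψ
  set η := ‖y - x‖ with hηdef
  have hη0 : 0 ≤ η := norm_nonneg _
  have hη1 : η ≤ 1 := hη.trans D.le_one
  have hh0 : 0 ≤ h := (norm_nonneg u).trans huh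
  have hgx0 : 0 < ‖g x‖ := hc.trans_le hgx
  have hgy0 : 0 < ‖g y‖ := hc.trans_le hgy
  have hgyne : g y ≠ 0 := norm_pos_iff.1 hgy0
  set u' := tangentProj g y u with hu'
  have hu'h : ‖u'‖ ≤ h := (norm_tangentProj_le g y u hgyne).trans huh
  have hyx : x + (y - x) = y := by abel
  have hxy : y + (x - y) = x := by abel
  have hnxy : ‖x - y‖ = η := norm_sub_rev _ _
  have hgl : ‖g y - g x‖ ≤ M * η := by
    have := D.grad_lip x (y - x) hx hη; rwa [hyx] at this
  set t := inner ℝ (g y) u with htdef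
  have ht' : t = inner ℝ (g y - g x) u := by rw [inner_sub_left, hu, sub_zero]
  have ht : |t| ≤ M * η * h := by
    rw [ht']
    exact (abs_real_inner_le_norm _ _).trans (by gcongr)
  have hdu : ‖u' - u‖ ≤ M / c * (η * h) := by
    rw [hu', norm_sub_tangentProj g y u hgyne, div_mul_eq_mul_div]
    refine (div_le_div_of_nonneg_left (abs_nonneg _) hc hgy).trans ?_
    gcongr
    linarith
  set w := φ • u with hw
  set w' := ψ • u' with hw'
  have hwn : ‖w‖ ≤ h := by
    rw [hw, norm_smul, Real.norm_of_nonneg hφ0]; exact (mul_le_of_le_one_left (norm_nonneg u) hφ1).trans huh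
  have hwn' : ‖w'‖ ≤ h := by
    rw [hw', norm_smul, Real.norm_of_nonneg hψ0]; exact (mul_le_of_le_one_left (norm_nonneg u') hψ1).trans hu'h
  have hdw_eq : w' - w = (ψ - φ) • u' + φ • (u' - u) := by rw [hw, hw']; module
  have hdw : ‖w' - w‖ ≤ C1 * (η * h) := by
    rw [hdw_eq]
    refine (norm_add_le _ _).trans ?_
    rw [norm_smul, norm_smul, Real.norm_of_nonneg hφ0, Real.norm_eq_abs, abs_sub_comm, hφψ,
      abs_of_nonneg (by positivity)]
    have h1 : q * η * ‖u'‖ ≤ Q * η * h := by gcongr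
    have h2 : φ * ‖u' - u‖ ≤ 1 * (M / c * (η * h)) := by gcongr
    rw [hC1]; linarith
  set κ := H x w w with hκ
  set κ' := H y w' w' with hκ'
  have hκ0 : 0 ≤ κ := D.hess_nonneg _ _
  have hκ'0 : 0 ≤ κ' := D.hess_nonneg _ _
  have hκh : κ ≤ M * h ^ 2 := by
    refine (le_abs_self _).trans ((D.hess_le x w w hx).trans ?_)
    rw [mul_assoc, pow_two]; gcongr
  have hκ'h : κ' ≤ M * h ^ 2 := by
    refine (le_abs_self _).trans ((D.hess_le y w' w' hy).trans ?_)
    rw [mul_assoc, pow_two]; gcongr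
  have hdκ : |κ' - κ| ≤ C2 * (η * h ^ 2) := by
    have h1 : |H y w' w' - H x w' w'| ≤ M * η * h ^ 2 := by
      have := D.hess_lip x (y - x) w' hx hη
      rw [hyx] at this
      exact this.trans (by gcongr)
    have h2 : |H x w' w' - H x w w| ≤ M * (C1 * (η * h)) * (h + h) :=
      (D.hess_diff x w' w hx).trans (by gcongr)
    have h3 := abs_sub_le κ' (H x w' w') κ
    have h4 : M * η * h ^ 2 + M * (C1 * (η * h)) * (h + h) = C2 * (η * h ^ 2) := by
      rw [hC2]; ring
    linarith
  have hinv : |1 / ‖g y‖ ^ 2 - 1 / ‖g x‖ ^ 2| ≤ C3 * η := by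
    have h1 : 1 / ‖g y‖ ^ 2 - 1 / ‖g x‖ ^ 2
        = (‖g x‖ - ‖g y‖) * (‖g x‖ + ‖g y‖) / (‖g y‖ ^ 2 * ‖g x‖ ^ 2) := by
      field_simp
      ring
    have h2 : |‖g x‖ - ‖g y‖| ≤ M * η := by
      rw [abs_sub_comm]; exact (abs_norm_sub_norm_le _ _).trans hgl
    have h3 : ‖g x‖ + ‖g y‖ ≤ M + M := add_le_add (D.grad_le x hx) (D.grad_le y hy)
    rw [h1, abs_div, abs_mul, abs_of_pos (show 0 < ‖g x‖ + ‖g y‖ by positivity),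
      abs_of_pos (show 0 < ‖g y‖ ^ 2 * ‖g x‖ ^ 2 by positivity)]
    have h4 : c ^ 4 ≤ ‖g y‖ ^ 2 * ‖g x‖ ^ 2 := by
      rw [show c ^ 4 = c ^ 2 * c ^ 2 by ring]; gcongr
    calc |‖g x‖ - ‖g y‖| * (‖g x‖ + ‖g y‖) / (‖g y‖ ^ 2 * ‖g x‖ ^ 2)
        ≤ (M * η) * (M + M) / c ^ 4 := by gcongr
      _ = C3 * η := by rw [hC3]; ring
  set α := κ / ‖g x‖ ^ 2 with hα
  set α' := κ' / ‖g y‖ ^ 2 with hα'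
  have hα0 : 0 ≤ α := by positivity
  have hα'0 : 0 ≤ α' := by positivity
  have hαh : α ≤ M / c ^ 2 * h ^ 2 := by
    rw [hα, div_mul_eq_mul_div]; gcongr
  have hα'h : α' ≤ M / c ^ 2 * h ^ 2 := by
    rw [hα', div_mul_eq_mul_div]; gcongr
  have hdα : |α' - α| ≤ C4 * (η * h ^ 2) := by
    have h1 : α' - α = (κ' - κ) / ‖g y‖ ^ 2 + κ * (1 / ‖g y‖ ^ 2 - 1 / ‖g x‖ ^ 2) := by
      rw [hα, hα']; ring
    rw [h1]
    refine (abs_add_le _ _).trans ?_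
    rw [abs_div, abs_mul, abs_of_nonneg hκ0, abs_of_pos (show 0 < ‖g y‖ ^ 2 by positivity)]
    calc |κ' - κ| / ‖g y‖ ^ 2 + κ * |1 / ‖g y‖ ^ 2 - 1 / ‖g x‖ ^ 2|
        ≤ C2 * (η * h ^ 2) / c ^ 2 + M * h ^ 2 * (C3 * η) := by gcongr
      _ = C4 * (η * h ^ 2) := by rw [hC4]; ring
  set δc := levelCorrection g H y w' - levelCorrection g H x w with hδc
  have hδc_eq : δc = (1 / 2 : ℝ) • ((α' - α) • g y + α • (g y - g x)) := by
    rw [hδc, levelCorrection, levelCorrection, ← hκ, ← hκ', ← hα, ← hα']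
    module
  have hδcn : ‖δc‖ ≤ C5 * (η * h ^ 2) := by
    rw [hδc_eq, norm_smul, Real.norm_of_nonneg (by norm_num)]
    have h1 : ‖(α' - α) • g y + α • (g y - g x)‖
        ≤ C4 * (η * h ^ 2) * M + M / c ^ 2 * h ^ 2 * (M * η) := by
      refine (norm_add_le _ _).trans ?_
      rw [norm_smul, norm_smul, Real.norm_eq_abs, Real.norm_of_nonneg hα0]
      have := D.grad_le y hy
      gcongr
    rw [hC5]
    linarith
  -- the first order terms along the chain
  set h₀ := H x (y - x) (y - x) with hh₀
  have hh₀0 : 0 ≤ h₀ := D.hess_nonneg _ _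
  have hh₀n : h₀ ≤ M * η ^ 2 := by
    refine (le_abs_self _).trans ((D.hess_le x _ _ hx).trans (le_of_eq ?_))
    rw [← hηdef]; ring
  have T1 : |inner ℝ (g x) (y - x) + h₀ / 2| ≤ M * η ^ 3 := by
    have := D.taylor x (y - x) hx hη
    rw [hyx, hFx, hFy] at this
    rw [← abs_neg]
    refine le_trans (le_of_eq ?_) this
    congr 1; ring
  have T2 : |inner ℝ (g y) (y - x) - h₀ / 2| ≤ 3 / 2 * M * η ^ 3 := by
    have := D.taylor y (x - y) hy (by rw [hnxy]; exact hη)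
    rw [hxy, hFx, hFy, hnxy] at this
    have hl := D.hess_lip x (y - x) (y - x) hx hη
    rw [hyx, ← hηdef, ← hh₀] at hl
    have hn : H y (x - y) (x - y) = H y (y - x) (y - x) := by
      have := D.hess_smul y (y - x) (y - x) (-1)
      simpa using this
    have hi : inner ℝ (g y) (x - y) = - inner ℝ (g y) (y - x) := by
      rw [← inner_neg_right, neg_sub]
    rw [hn, hi] at this
    rw [abs_le] at this hl ⊢
    constructor <;> linarith only [this.1, this.2, hl.1, hl.2]
  have cross : -2 * inner ℝ (y - x) δc ≤ -(α * h₀) + C6 * (η ^ 3 * h ^ 2) := by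
    have e : -2 * inner ℝ (y - x) δc
        = -(α' * inner ℝ (g y) (y - x)) + α * inner ℝ (g x) (y - x) := by
      rw [real_inner_comm, hδc_eq, real_inner_smul_left, inner_add_left, real_inner_smul_left,
        real_inner_smul_left, inner_sub_left]
      ring
    rw [e]
    rw [abs_le] at T1 T2 hdα
    have a1 : α * inner ℝ (g x) (y - x) ≤ α * (-(h₀ / 2)) + α * (M * η ^ 3) := by
      rw [← mul_add]; exact mul_le_mul_of_nonneg_left (by linarith) hα0
    have a2 : -(α' * inner ℝ (g y) (y - x)) ≤ α' * (-(h₀ / 2)) + α' * (3 / 2 * M * η ^ 3) := by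
      rw [← mul_add, ← mul_neg]; exact mul_le_mul_of_nonneg_left (by linarith) hα'0
    have a3 : α * (M * η ^ 3) ≤ M / c ^ 2 * h ^ 2 * (M * η ^ 3) := by gcongr
    have a4 : α' * (3 / 2 * M * η ^ 3) ≤ M / c ^ 2 * h ^ 2 * (3 / 2 * M * η ^ 3) := by gcongr
    have a5 : (α - α') * (h₀ / 2) ≤ C4 * (η * h ^ 2) * (M * η ^ 2 / 2) := by
      calc (α - α') * (h₀ / 2) ≤ C4 * (η * h ^ 2) * (h₀ / 2) := by
            gcongr; linarith
        _ ≤ _ := by gcongr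
    have a6 : 0 ≤ M / c ^ 2 * h ^ 2 * (1 / 2 * M * η ^ 3) := by positivity
    rw [hC6]
    linarith only [a1, a2, a3, a4, a5, a6]
  have tang : ‖w' - w‖ ^ 2 ≤ η ^ 2 * (q ^ 2 * h ^ 2) + α * h₀
      + (2 * M ^ 2 / c ^ 2 + M ^ 2 * C3) * (η ^ 3 * h ^ 2) := by
    have e1 : φ • (u' - u) = -(φ * (t / ‖g y‖ ^ 2)) • g y := by
      rw [hu', tangentProj, ← htdef]; module
    have hperp : inner ℝ ((ψ - φ) • u') (φ • (u' - u)) = 0 := by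
      rw [e1, inner_smul_right, real_inner_smul_left, real_inner_comm (g y) u',
        inner_tangentProj g y u hgyne]
      ring
    have e2 := norm_add_sq_eq_norm_sq_add_norm_sq_real hperp
    rw [← hdw_eq, ← pow_two, ← pow_two, ← pow_two] at e2
    rw [e2, norm_smul, norm_smul, hu', norm_sub_tangentProj g y u hgyne, ← hu', ← htdef,
      Real.norm_of_nonneg hφ0, Real.norm_eq_abs, abs_sub_comm, hφψ,
      abs_of_nonneg (show 0 ≤ q * η by positivity)]
    have b1 : (q * η * ‖u'‖) ^ 2 ≤ η ^ 2 * (q ^ 2 * h ^ 2) := by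
      rw [show η ^ 2 * (q ^ 2 * h ^ 2) = (q * η * h) ^ 2 by ring]
      gcongr
    have b2 : (φ * (|t| / ‖g y‖)) ^ 2 = φ ^ 2 * t ^ 2 * (1 / ‖g y‖ ^ 2) := by
      rw [mul_pow, div_pow, sq_abs]; ring
    have hφ2 : φ ^ 2 ≤ 1 := pow_le_one₀ hφ0 hφ1
    have b3 : t ^ 2 ≤ H x u u * h₀ + 2 * M ^ 2 * (η ^ 3 * h ^ 2) := by
      set k := H x (y - x) u with hk
      have c1 : |t - k| ≤ M * η ^ 2 * h := by
        have := D.grad_taylor x (y - x) u hx hη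
        rw [hyx, ← ht', ← hk] at this
        exact this.trans (by gcongr)
      have c2 : |k| ≤ M * η * h := (D.hess_le x (y - x) u hx).trans (by gcongr)
      have c3 : k ^ 2 ≤ h₀ * H x u u := D.cauchy_schwarz x (y - x) u
      have c4 : t ^ 2 - k ^ 2 ≤ (M * η ^ 2 * h) * (M * η * h + M * η * h) := by
        rw [sq_sub_sq, mul_comm]
        refine (le_abs_self _).trans ?_
        rw [abs_mul]
        have := (abs_add_le t k).trans (add_le_add ht c2)
        gcongr
      linarith only [c3, c4]
    have b4 : φ ^ 2 * t ^ 2 * (1 / ‖g y‖ ^ 2)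
        ≤ φ ^ 2 * t ^ 2 * (1 / ‖g x‖ ^ 2) + (M * η * h) ^ 2 * (C3 * η) := by
      have c1 : φ ^ 2 * t ^ 2 ≤ (M * η * h) ^ 2 := by
        have d2 : t ^ 2 ≤ (M * η * h) ^ 2 := by
          rw [← sq_abs]; gcongr
        exact (mul_le_of_le_one_left (sq_nonneg t) hφ2).trans d2
      have c2 : φ ^ 2 * t ^ 2 * (1 / ‖g y‖ ^ 2 - 1 / ‖g x‖ ^ 2) ≤ (M * η * h) ^ 2 * (C3 * η) := by
        refine (mul_le_mul_of_nonneg_left ((le_abs_self _).trans hinv) (by positivity)).trans ?_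
        gcongr
      linarith only [c2]
    have b5 : φ ^ 2 * t ^ 2 * (1 / ‖g x‖ ^ 2)
        ≤ α * h₀ + 2 * M ^ 2 / c ^ 2 * (η ^ 3 * h ^ 2) := by
      have c1 : κ = φ ^ 2 * H x u u := by rw [hκ, hw, D.hess_smul]
      have c2 : φ ^ 2 * t ^ 2 ≤ κ * h₀ + 2 * M ^ 2 * (η ^ 3 * h ^ 2) := by
        have d1 : φ ^ 2 * t ^ 2 ≤ φ ^ 2 * (H x u u * h₀ + 2 * M ^ 2 * (η ^ 3 * h ^ 2)) := by
          gcongr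
        have d2 : φ ^ 2 * (2 * M ^ 2 * (η ^ 3 * h ^ 2)) ≤ 1 * (2 * M ^ 2 * (η ^ 3 * h ^ 2)) := by
          gcongr
        rw [c1]; linarith only [d1, d2]
      have c3 : 2 * M ^ 2 * (η ^ 3 * h ^ 2) * (1 / ‖g x‖ ^ 2)
          ≤ 2 * M ^ 2 * (η ^ 3 * h ^ 2) * (1 / c ^ 2) := by gcongr
      have c4 : κ * h₀ * (1 / ‖g x‖ ^ 2) = α * h₀ := by rw [hα]; ring
      have c5 := mul_le_mul_of_nonneg_right c2 (show 0 ≤ 1 / ‖g x‖ ^ 2 by positivity)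
      have c6 : 2 * M ^ 2 * (η ^ 3 * h ^ 2) * (1 / c ^ 2)
          = 2 * M ^ 2 / c ^ 2 * (η ^ 3 * h ^ 2) := by ring
      linarith only [c3, c4, c5, c6]
    rw [b2]
    linarith only [b1, b4, b5]
  have key : ‖(y - x) - δc‖ ^ 2 + ‖w' - w‖ ^ 2
      ≤ η ^ 2 * (1 + (q ^ 2 * h ^ 2 + (C5 ^ 2 + C7) * (h ^ 4 + η * h ^ 2))) := by
    have e := norm_sub_sq_real (y - x) δc
    have d1 : ‖δc‖ ^ 2 ≤ (C5 * (η * h ^ 2)) ^ 2 := by gcongr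
    have p1 : 0 ≤ C7 * (η ^ 2 * h ^ 4) := by positivity
    have p2 : 0 ≤ C5 ^ 2 * (η ^ 3 * h ^ 2) := by positivity
    rw [e, ← hηdef]
    have hC7e : C7 * (η ^ 3 * h ^ 2) = C6 * (η ^ 3 * h ^ 2)
      + (2 * M ^ 2 / c ^ 2 + M ^ 2 * C3) * (η ^ 3 * h ^ 2) := by rw [hC7]; ring
    linarith only [d1, p1, p2, hC7e, cross, tang]
  have fin := norm_add_add_norm_sub_le hη0 (by positivity) key
  have e1 : y + w' - levelCorrection g H y w' - (x + w - levelCorrection g H x w)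
      = (y - x) - δc + (w' - w) := by rw [hδc]; abel
  have e2 : y - w' - levelCorrection g H y w' - (x - w - levelCorrection g H x w)
      = (y - x) - δc - (w' - w) := by rw [hδc]; abel
  rw [e1, e2]
  exact fin

end SecondVariation

section ExpSum

variable {E : Type*} [NormedAddCommGroup E] [InnerProductSpace ℝ E]

/-- A sum of exponentials of affine functions, used as a smooth convex defining function. -/
noncomputable def expSum (J : Finset E) (l : ℝ) (z : E) : ℝ :=
  ∑ k ∈ J, Real.exp (inner ℝ k z - l) - 1

/-- The gradient of `expSum`. -/
noncomputable def expSumGrad (J : Finset E) (l : ℝ) (z : E) : E :=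
  ∑ k ∈ J, Real.exp (inner ℝ k z - l) • k

/-- The Hessian of `expSum`. -/
noncomputable def expSumHess (J : Finset E) (l : ℝ) (z u v : E) : ℝ :=
  ∑ k ∈ J, Real.exp (inner ℝ k z - l) * (inner ℝ k u * inner ℝ k v)

lemma continuous_expSum (J : Finset E) (l : ℝ) : Continuous (expSum J l) := by
  unfold expSum
  fun_prop

lemma expSum_grad_ineq (J : Finset E) (l : ℝ) (z w : E) :
    expSum J l z + inner ℝ (expSumGrad J l z) (w - z) ≤ expSum J l w := by
  have h : inner ℝ (expSumGrad J l z) (w - z)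
      = ∑ k ∈ J, Real.exp (inner ℝ k z - l) * inner ℝ k (w - z) := by
    rw [expSumGrad, sum_inner]
    simp only [real_inner_smul_left]
  rw [h, expSum, expSum]
  have : ∑ k ∈ J, (Real.exp (inner ℝ k z - l) + Real.exp (inner ℝ k z - l) * inner ℝ k (w - z))
      ≤ ∑ k ∈ J, Real.exp (inner ℝ k w - l) := by
    refine Finset.sum_le_sum fun k _ => ?_
    have e : Real.exp (inner ℝ k w - l)
        = Real.exp (inner ℝ k z - l) * Real.exp (inner ℝ k (w - z)) := by
      rw [← Real.exp_add, inner_sub_right]; congr 1; ring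
    have := Real.add_one_le_exp (inner ℝ k (w - z))
    rw [e]
    nlinarith [Real.exp_pos (inner ℝ k z - l)]
  rw [Finset.sum_add_distrib] at this
  linarith

lemma convexOn_expSum (J : Finset E) (l : ℝ) : ConvexOn ℝ univ (expSum J l) := by
  refine ⟨convex_univ, fun x _ y _ a b ha hb hab => ?_⟩
  have h1 := expSum_grad_ineq J l (a • x + b • y) x
  have h2 := expSum_grad_ineq J l (a • x + b • y) y
  have h3 : a * inner ℝ (expSumGrad J l (a • x + b • y)) (x - (a • x + b • y))
      + b * inner ℝ (expSumGrad J l (a • x + b • y)) (y - (a • x + b • y)) = 0 := by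
    rw [← inner_smul_right, ← inner_smul_right, ← inner_add_right]
    have : a • (x - (a • x + b • y)) + b • (y - (a • x + b • y)) = 0 := by
      obtain rfl : b = 1 - a := by linarith
      module
    rw [this, inner_zero_right]
  have h4 := mul_le_mul_of_nonneg_left h1 ha
  have h5 := mul_le_mul_of_nonneg_left h2 hb
  rw [smul_eq_mul, smul_eq_mul]
  have h6 : (a + b) * expSum J l (a • x + b • y) = expSum J l (a • x + b • y) := by
    rw [hab, one_mul]
  linarith

lemma abs_exp_sub_quadratic_le {a : ℝ} (ha : |a| ≤ 1) :
    |Real.exp a - 1 - a - a ^ 2 / 2| ≤ |a| ^ 3 := by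
  have h := Real.exp_bound ha (n := 3) (by norm_num)
  simp [Finset.sum_range_succ, Nat.factorial] at h
  have e : Real.exp a - 1 - a - a ^ 2 / 2 = Real.exp a - (1 + a + a ^ 2 / 2) := by ring
  rw [e]
  nlinarith [pow_nonneg (abs_nonneg a) 3]

lemma expSum_secondOrderData (J : Finset E) (l R : ℝ) :
    ∃ ρ M, SecondOrderData (expSum J l) (expSumGrad J l) (expSumHess J l) R ρ M := by
  set S := ∑ k ∈ J, Real.exp (‖k‖ * R - l) with hS
  set B := 1 + ∑ k ∈ J, ‖k‖ with hB
  have hB1 : 1 ≤ B := by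
    have : 0 ≤ ∑ k ∈ J, ‖k‖ := Finset.sum_nonneg fun _ _ => norm_nonneg _
    linarith
  have hB0 : 0 < B := by linarith
  have hkB : ∀ k ∈ J, ‖k‖ ≤ B := fun k hk => by
    have := Finset.single_le_sum (f := fun k : E => ‖k‖) (fun _ _ => norm_nonneg _) hk
    linarith
  have hS0 : 0 ≤ S := Finset.sum_nonneg fun _ _ => (Real.exp_pos _).le
  have hE : ∀ z : E, ‖z‖ ≤ R → ∀ k ∈ J,
      Real.exp (inner ℝ k z - l) ≤ Real.exp (‖k‖ * R - l) := fun z hz k _ => by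
    have := real_inner_le_norm k z
    have h2 : ‖k‖ * ‖z‖ ≤ ‖k‖ * R := by gcongr
    exact Real.exp_le_exp.2 (by linarith)
  have hin : ∀ k ∈ J, ∀ w : E, |inner ℝ k w| ≤ B * ‖w‖ := fun k hk w =>
    (abs_real_inner_le_norm k w).trans (by gcongr; exact hkB k hk)
  have hone : ∀ k ∈ J, ∀ w : E, ‖w‖ ≤ 1 / B → |inner ℝ k w| ≤ 1 := fun k hk w hw =>
    (hin k hk w).trans (by
      calc B * ‖w‖ ≤ B * (1 / B) := by gcongr
        _ = 1 := by field_simp)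
  have hsum : ∀ (z : E), ‖z‖ ≤ R → ∀ (t : E → ℝ) (Y : ℝ), (∀ k ∈ J, |t k| ≤ Y) →
      |∑ k ∈ J, Real.exp (inner ℝ k z - l) * t k| ≤ S * Y := fun z hz t Y ht => by
    refine (Finset.abs_sum_le_sum_abs _ _).trans ?_
    rw [hS, Finset.sum_mul]
    refine Finset.sum_le_sum fun k hk => ?_
    rw [abs_mul, abs_of_pos (Real.exp_pos _)]
    have := hE z hz k hk
    have := ht k hk
    gcongr
  have hadd : ∀ (z w k : E), Real.exp (inner ℝ k (z + w) - l)
      = Real.exp (inner ℝ k z - l) * Real.exp (inner ℝ k w) := fun z w k => by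
    rw [← Real.exp_add, inner_add_right]; congr 1; ring
  have hBB : B ≤ B ^ 3 := by nlinarith [sq_nonneg (B - 1), sq_nonneg B]
  have hBB2 : B ^ 2 ≤ B ^ 3 := by nlinarith [sq_nonneg B]
  have hfin : ∀ {Y y : ℝ}, 0 ≤ y → Y ≤ 2 * B ^ 3 * y → S * Y ≤ (1 + 2 * S * B ^ 3) * y :=
    fun {Y y} hy hY => by
      have := mul_le_mul_of_nonneg_left hY hS0
      linarith
  have hexp1 : ∀ {a : ℝ}, |a| ≤ 1 → |Real.exp a - 1| ≤ 2 * |a| := fun {a} ha =>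
    Real.abs_exp_sub_one_le ha
  refine ⟨1 / B, 1 + 2 * S * B ^ 3, ?_⟩
  constructor
  · have : 0 ≤ 2 * S * B ^ 3 := by positivity
    linarith
  · positivity
  · rw [div_le_one hB0]; exact hB1
  · intro z w hz hw
    have e : expSum J l (z + w) - expSum J l z - inner ℝ (expSumGrad J l z) w
        - expSumHess J l z w w / 2 = ∑ k ∈ J, Real.exp (inner ℝ k z - l) *
          (Real.exp (inner ℝ k w) - 1 - inner ℝ k w - (inner ℝ k w) ^ 2 / 2) := by
      rw [expSum, expSum, expSumGrad, expSumHess, sum_inner, Finset.sum_div,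
        sub_sub_sub_cancel_right, ← Finset.sum_sub_distrib, ← Finset.sum_sub_distrib,
        ← Finset.sum_sub_distrib]
      refine Finset.sum_congr rfl fun k _ => ?_
      rw [hadd, real_inner_smul_left]; ring
    rw [e]
    refine (hsum z hz _ ((B * ‖w‖) ^ 3) fun k hk => ?_).trans (hfin (by positivity) ?_)
    · refine (abs_exp_sub_quadratic_le (hone k hk w hw)).trans ?_
      have := hin k hk w
      gcongr
    · rw [mul_pow]
      have : 0 ≤ B ^ 3 * ‖w‖ ^ 3 := by positivity
      linarith
  · intro z w u hz hw
    have e : inner ℝ (expSumGrad J l (z + w) - expSumGrad J l z) u - expSumHess J l z w u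
        = ∑ k ∈ J, Real.exp (inner ℝ k z - l) *
          ((Real.exp (inner ℝ k w) - 1 - inner ℝ k w) * inner ℝ k u) := by
      rw [expSumGrad, expSumGrad, expSumHess, inner_sub_left, sum_inner, sum_inner,
        ← Finset.sum_sub_distrib, ← Finset.sum_sub_distrib]
      refine Finset.sum_congr rfl fun k _ => ?_
      rw [hadd, real_inner_smul_left, real_inner_smul_left]; ring
    rw [e, mul_assoc]
    refine (hsum z hz _ ((B * ‖w‖) ^ 2 * (B * ‖u‖)) fun k hk => ?_).trans
      (hfin (by positivity) ?_)
    · rw [abs_mul]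
      have h1 := Real.abs_exp_sub_one_sub_id_le (hone k hk w hw)
      have h2 := hin k hk w
      have h3 := hin k hk u
      have h4 : (inner ℝ k w) ^ 2 ≤ (B * ‖w‖) ^ 2 := by rw [← sq_abs]; gcongr
      have h5 := h1.trans h4
      gcongr
    · have : 0 ≤ B ^ 3 * (‖w‖ ^ 2 * ‖u‖) := by positivity
      linarith
  · intro z w hz hw
    have e : expSumGrad J l (z + w) - expSumGrad J l z
        = ∑ k ∈ J, (Real.exp (inner ℝ k z - l) * (Real.exp (inner ℝ k w) - 1)) • k := by
      rw [expSumGrad, expSumGrad, ← Finset.sum_sub_distrib]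
      refine Finset.sum_congr rfl fun k _ => ?_
      rw [hadd, ← sub_smul]; congr 1; ring
    rw [e]
    have h : ∑ k ∈ J, ‖(Real.exp (inner ℝ k z - l) * (Real.exp (inner ℝ k w) - 1)) • k‖
        ≤ S * (2 * (B * ‖w‖) * B) := by
      rw [hS, Finset.sum_mul]
      refine Finset.sum_le_sum fun k hk => ?_
      rw [norm_smul, norm_mul, Real.norm_of_nonneg (Real.exp_pos _).le, Real.norm_eq_abs,
        mul_assoc]
      have h1 := hE z hz k hk
      have h2 := hexp1 (hone k hk w hw)
      have h3 := hin k hk w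
      have h4 := hkB k hk
      have h5 : |Real.exp (inner ℝ k w) - 1| ≤ 2 * (B * ‖w‖) := by linarith
      gcongr
    refine (norm_sum_le _ _).trans (h.trans (hfin (by positivity) ?_))
    have : B ^ 2 * ‖w‖ ≤ B ^ 3 * ‖w‖ := by gcongr
    linarith
  · intro z w u hz hw
    have e : expSumHess J l (z + w) u u - expSumHess J l z u u
        = ∑ k ∈ J, Real.exp (inner ℝ k z - l) *
          ((Real.exp (inner ℝ k w) - 1) * (inner ℝ k u) ^ 2) := by
      rw [expSumHess, expSumHess, ← Finset.sum_sub_distrib]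
      refine Finset.sum_congr rfl fun k _ => ?_
      rw [hadd]; ring
    rw [e, mul_assoc]
    refine (hsum z hz _ (2 * (B * ‖w‖) * (B * ‖u‖) ^ 2) fun k hk => ?_).trans
      (hfin (by positivity) (le_of_eq (by ring)))
    rw [abs_mul, abs_pow]
    have h2 := hexp1 (hone k hk w hw)
    have h3 := hin k hk w
    have h4 := hin k hk u
    have h5 : |Real.exp (inner ℝ k w) - 1| ≤ 2 * (B * ‖w‖) := by linarith
    gcongr
  · intro z hz
    have h : ∑ k ∈ J, ‖Real.exp (inner ℝ k z - l) • k‖ ≤ S * B := by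
      rw [hS, Finset.sum_mul]
      refine Finset.sum_le_sum fun k hk => ?_
      rw [norm_smul, Real.norm_of_nonneg (Real.exp_pos _).le]
      have h1 := hE z hz k hk
      have h4 := hkB k hk
      gcongr
    refine (norm_sum_le _ _).trans (h.trans ?_)
    rw [← mul_one (1 + _)]
    exact hfin zero_le_one (by linarith)
  · intro z u v hz
    rw [mul_assoc]
    refine (hsum z hz _ ((B * ‖u‖) * (B * ‖v‖)) fun k hk => ?_).trans (hfin (by positivity) ?_)
    · rw [abs_mul]
      have h3 := hin k hk u
      have h4 := hin k hk v
      gcongr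
    · have : B ^ 2 * (‖u‖ * ‖v‖) ≤ B ^ 3 * (‖u‖ * ‖v‖) := by gcongr
      have : 0 ≤ B ^ 3 * (‖u‖ * ‖v‖) := by positivity
      linarith
  · intro z u v hz
    have e : expSumHess J l z u u - expSumHess J l z v v
        = ∑ k ∈ J, Real.exp (inner ℝ k z - l) *
          (inner ℝ k (u - v) * (inner ℝ k u + inner ℝ k v)) := by
      rw [expSumHess, expSumHess, ← Finset.sum_sub_distrib]
      refine Finset.sum_congr rfl fun k _ => ?_
      rw [inner_sub_right]; ring
    rw [e, mul_assoc]
    refine (hsum z hz _ ((B * ‖u - v‖) * (B * ‖u‖ + B * ‖v‖)) fun k hk => ?_).trans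
      (hfin (by positivity) ?_)
    · rw [abs_mul]
      have h2 := hin k hk (u - v)
      have h5 := (abs_add_le _ _).trans (add_le_add (hin k hk u) (hin k hk v))
      gcongr
    · have : B ^ 2 * (‖u - v‖ * (‖u‖ + ‖v‖)) ≤ B ^ 3 * (‖u - v‖ * (‖u‖ + ‖v‖)) := by gcongr
      have : 0 ≤ B ^ 3 * (‖u - v‖ * (‖u‖ + ‖v‖)) := by positivity
      linarith
  · intro z u
    exact Finset.sum_nonneg fun k _ => mul_nonneg (Real.exp_pos _).le (mul_self_nonneg _)
  · intro z u v a
    rw [expSumHess, expSumHess, Finset.mul_sum]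
    refine Finset.sum_congr rfl fun k _ => ?_
    rw [inner_smul_right, inner_smul_right]; ring
  · intro z u v
    refine Finset.sum_sq_le_sum_mul_sum_of_sq_le_mul J
      (fun k _ => mul_nonneg (Real.exp_pos _).le (mul_self_nonneg _))
      (fun k _ => mul_nonneg (Real.exp_pos _).le (mul_self_nonneg _)) (fun k _ => le_of_eq ?_)
    ring
  · exact fun z w => expSum_grad_ineq J l z w

end ExpSum

section SecondVariationChain

variable {E : Type*} [NormedAddCommGroup E] [InnerProductSpace ℝ E]
variable {F : E → ℝ} {g : E → E} {H : E → E → E → ℝ} {R ρ M : ℝ}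

namespace SecondOrderData

lemma levelCorrection_neg (D : SecondOrderData F g H R ρ M) (x w : E) :
    levelCorrection g H x (-w) = levelCorrection g H x w := by
  have := D.hess_smul x w w (-1)
  simp only [neg_smul, one_smul, even_two, Even.neg_pow, one_pow, one_mul] at this
  rw [levelCorrection, levelCorrection, this]

lemma levelCorrection_zero (D : SecondOrderData F g H R ρ M) (x w : E) :
    levelCorrection g H x ((0 : ℝ) • w) = 0 := by
  rw [levelCorrection, D.hess_smul]
  simp

lemma norm_levelCorrection_le (D : SecondOrderData F g H R ρ M) {c : ℝ} (hc : 0 < c) {x w : E}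
    {h : ℝ} (hx : ‖x‖ ≤ R) (hg : c ≤ ‖g x‖) (hw : ‖w‖ ≤ h) :
    ‖levelCorrection g H x w‖ ≤ M / c * h ^ 2 := by
  have hM : 0 < M := lt_of_lt_of_le one_pos D.one_le
  have hg0 : 0 < ‖g x‖ := hc.trans_le hg
  have h1 : H x w w ≤ M * h ^ 2 := by
    refine (le_abs_self _).trans ((D.hess_le x w w hx).trans ?_)
    rw [mul_assoc, pow_two]
    have : 0 ≤ h := (norm_nonneg _).trans hw
    gcongr
  have h0 := D.hess_nonneg x w
  rw [levelCorrection, norm_smul, Real.norm_of_nonneg (by positivity)]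
  calc H x w w / ‖g x‖ ^ 2 / 2 * ‖g x‖ = H x w w / 2 / ‖g x‖ := by field_simp
    _ ≤ (M * h ^ 2) / c := by gcongr; linarith
    _ = M / c * h ^ 2 := by ring

lemma neg_le_corrected (D : SecondOrderData F g H R ρ M) {c : ℝ} (hc : 0 < c) {x w : E} {h : ℝ}
    (hx : ‖x‖ ≤ R) (hFx : F x = 0) (hg : c ≤ ‖g x‖) (hw : ‖w‖ ≤ h) (hgw : inner ℝ (g x) w = 0)
    (hhρ : 2 * h ≤ ρ) (hhc : M / c * h ≤ 1) :
    -((8 * M + 2 * M * (M / c)) * h ^ 3) ≤ F (x + w - levelCorrection g H x w) := by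
  have hM : 0 < M := lt_of_lt_of_le one_pos D.one_le
  have hg0 : 0 < ‖g x‖ := hc.trans_le hg
  have hh : 0 ≤ h := (norm_nonneg _).trans hw
  have hs := D.norm_levelCorrection_le hc hx hg hw
  have hgs : inner ℝ (g x) (levelCorrection g H x w) = H x w w / 2 := by
    rw [levelCorrection, inner_smul_right, real_inner_self_eq_norm_sq]
    field_simp
  set s := levelCorrection g H x w
  have hsh : ‖s‖ ≤ h := hs.trans (by nlinarith)
  have hws : ‖w - s‖ ≤ 2 * h := (norm_sub_le _ _).trans (by linarith)
  have h1 := D.taylor x (w - s) hx (hws.trans hhρ)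
  have h2 := D.hess_diff x (w - s) w hx
  rw [hFx, inner_sub_right, hgw, hgs, abs_le] at h1
  rw [sub_sub_cancel_left, norm_neg, abs_le] at h2
  have h3 : M * ‖w - s‖ ^ 3 ≤ M * (2 * h) ^ 3 := by gcongr
  have h4 : M * ‖s‖ * (‖w - s‖ + ‖w‖) ≤ M * (M / c * h ^ 2) * (2 * h + h) := by gcongr
  have e : x + (w - s) = x + w - s := by abel
  rw [e] at h1
  have h5 : 0 ≤ M * (M / c) * h ^ 3 := by positivity
  linarith [h1.1, h2.1]

lemma neg_le_segment (D : SecondOrderData F g H R ρ M) {a b : E} {ξ r : ℝ} (ha : ‖a‖ ≤ R)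
    (hab : ‖b - a‖ ≤ r) (hr : r ≤ ρ) (hFa : -ξ ≤ F a) (hFb : -ξ ≤ F b) :
    ∀ z ∈ segment ℝ a b, -(ξ + M * r ^ 2) ≤ F z := by
  rintro z ⟨s, t, hs, ht, hst, rfl⟩
  have hM : 0 < M := lt_of_lt_of_le one_pos D.one_le
  have hr0 : 0 ≤ r := (norm_nonneg _).trans hab
  obtain rfl : s = 1 - t := by linarith
  set z := (1 - t) • a + t • b with hz
  have h1 := D.grad_ineq a z
  have h2 := D.grad_ineq b z
  have e1 : z - a = t • (b - a) := by rw [hz]; module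
  have e2 : z - b = -((1 - t) • (b - a)) := by rw [hz]; module
  rw [e1, inner_smul_right] at h1
  rw [e2, inner_neg_right, inner_smul_right] at h2
  have h3 := D.grad_lip a (b - a) ha (hab.trans hr)
  rw [add_sub_cancel] at h3
  have h4 : inner ℝ (g b) (b - a) - inner ℝ (g a) (b - a) ≤ M * r ^ 2 := by
    rw [← inner_sub_left]
    refine (real_inner_le_norm _ _).trans ?_
    calc ‖g b - g a‖ * ‖b - a‖ ≤ (M * ‖b - a‖) * ‖b - a‖ := by gcongr
      _ ≤ (M * r) * r := by gcongr
      _ = M * r ^ 2 := by ring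
  have h5 : (1 - t) * t * (inner ℝ (g b) (b - a) - inner ℝ (g a) (b - a)) ≤ M * r ^ 2 := by
    have h6 : (1 - t) * t ≤ 1 := by nlinarith
    have h7 : 0 ≤ (1 - t) * t := by positivity
    refine (mul_le_mul_of_nonneg_left h4 h7).trans ?_
    nlinarith [mul_nonneg hM.le (sq_nonneg r)]
  have h6 := mul_le_mul_of_nonneg_left h1 hs
  have h7 := mul_le_mul_of_nonneg_left h2 ht
  have h8 := mul_le_mul_of_nonneg_left hFa hs
  have h9 := mul_le_mul_of_nonneg_left hFb ht
  linarith

set_option maxHeartbeats 1000000 in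
/-- The second variation estimate for the intrinsic distance to a point `p`, at the point `m`. -/
lemma second_variation [CompleteSpace E] (D : SecondOrderData F g H R ρ M)
    (hF : ConvexOn ℝ univ F) (hFc : Continuous F) {c₀ c d₀ Δ : ℝ} (hc₀ : 0 < c₀) (h0 : F 0 ≤ -c₀)
    (hc : 0 < c) (hR : ∀ x, F x = 0 → ‖x‖ + 1 ≤ R) (hg : ∀ x, F x = 0 → c ≤ ‖g x‖) {m p : E}
    (hm : F m = 0) (hd₀ : 0 < d₀) (hmp : d₀ ≤ ‖m - p‖)
    (hΔ : 0 ≤ Δ) (hfin : pathEDist {x | F x = 0} m p ≠ ⊤) :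
    ∃ C h₀ : ℝ, 0 ≤ C ∧ 0 < h₀ ∧ ∀ (h : ℝ) (u A B : E), 0 < h → h ≤ h₀ → F A = 0 → F B = 0 →
      inner ℝ (g m) u = 0 → ‖u‖ ≤ h →
      ‖m + u - levelCorrection g H m u - A‖ ≤ Δ * h ^ 2 →
      ‖m - u - levelCorrection g H m u - B‖ ≤ Δ * h ^ 2 →
      (pathEDist {x | F x = 0} A p).toReal + (pathEDist {x | F x = 0} B p).toReal ≤
        2 * (pathEDist {x | F x = 0} m p).toReal + h ^ 2 / d₀
          + ‖m + u - levelCorrection g H m u - A‖ + ‖m - u - levelCorrection g H m u - B‖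
          + C * h ^ 3 := by
  have hM : 0 < M := lt_of_lt_of_le one_pos D.one_le
  have hM1 := D.one_le
  have hρ := D.pos
  have hρ1 := D.le_one
  obtain ⟨K, hK, hstep⟩ := D.step hc (Q := 1 / d₀) (by positivity)
  obtain ⟨d, hd⟩ : ∃ d, d = (pathEDist {x | F x = 0} m p).toReal := ⟨_, rfl⟩
  have hd0 : 0 ≤ d := hd ▸ ENNReal.toReal_nonneg
  -- a bound for the sides of the polygons, and for their depth
  obtain ⟨S, hS⟩ : ∃ S, S = 2 + ((1 / d₀) ^ 2 + 2 * K) + Δ := ⟨_, rfl⟩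
  obtain ⟨X, hX⟩ : ∃ X, X = 8 * M + 2 * M * (M / c) + M * S ^ 2 := ⟨_, rfl⟩
  have hS2 : 2 ≤ S := by rw [hS]; have : 0 ≤ (1 / d₀) ^ 2 + 2 * K + Δ := by positivity
                         linarith
  have hX0 : 0 < X := by rw [hX]; positivity
  have hR0 : 0 ≤ R := by linarith [hR m hm, norm_nonneg m]
  obtain ⟨T, hT⟩ : ∃ T, T = Δ + (d + 1) * S + 2 * R := ⟨_, rfl⟩
  have hT0 : 0 ≤ T := by rw [hT]; positivity
  obtain ⟨h₀, hh₀, hh1, hh2, hh3, hh4, hh5⟩ : ∃ h₀ : ℝ, 0 < h₀ ∧ h₀ ≤ 1 ∧ 2 * h₀ ≤ ρ ∧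
      M / c * h₀ ≤ 1 ∧ S * h₀ ≤ ρ ∧ 2 * (X * h₀) ≤ c₀ := by
    refine ⟨min (min 1 (ρ / S)) (min (c / M) (c₀ / (2 * X))), by positivity, ?_, ?_, ?_, ?_, ?_⟩
    · exact (min_le_left _ _).trans (min_le_left _ _)
    · have h1 : min (min 1 (ρ / S)) (min (c / M) (c₀ / (2 * X))) ≤ ρ / S :=
        (min_le_left _ _).trans (min_le_right _ _)
      rw [le_div_iff₀ (by linarith)] at h1
      refine le_trans ?_ h1
      rw [mul_comm]; gcongr
    · have h1 : min (min 1 (ρ / S)) (min (c / M) (c₀ / (2 * X))) ≤ c / M :=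
        (min_le_right _ _).trans (min_le_left _ _)
      calc _ ≤ M / c * (c / M) := by gcongr
        _ = 1 := by field_simp
    · have h1 : min (min 1 (ρ / S)) (min (c / M) (c₀ / (2 * X))) ≤ ρ / S :=
        (min_le_left _ _).trans (min_le_right _ _)
      rw [le_div_iff₀ (by linarith)] at h1
      rwa [mul_comm]
    · have h1 : min (min 1 (ρ / S)) (min (c / M) (c₀ / (2 * X))) ≤ c₀ / (2 * X) :=
        (min_le_right _ _).trans (min_le_right _ _)
      rw [le_div_iff₀ (by linarith)] at h1
      linarith
  refine ⟨2 + 2 * K * (d + 1) + 2 * (2 * X / c₀ * T), h₀, by positivity, hh₀, ?_⟩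
  intro h u A B hpos hle hFA hFB hgu hu hA hB
  have hh0 : 0 ≤ h := hpos.le
  have hle1 : h ≤ 1 := hle.trans hh1
  have hp2 : h ^ 2 ≤ h := by nlinarith
  have hp3 : h ^ 3 ≤ h := by nlinarith [sq_nonneg h]
  have hp31 : h ^ 3 ≤ 1 := hp3.trans hle1
  have hp43 : h ^ 4 ≤ h ^ 3 := by
    have : 0 ≤ h ^ 3 := by positivity
    nlinarith
  obtain ⟨N, x, hx0, hxN, hxX, hmesh, hlen⟩ := exists_chain_of_pathEDist_lt (δ := h ^ 2)
    (by positivity) (show pathEDist {x | F x = 0} m p < ENNReal.ofReal (d + h ^ 3) by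
      rw [← ENNReal.ofReal_toReal hfin, ← hd, ENNReal.ofReal_lt_ofReal_iff (by positivity)]
      have : 0 < h ^ 3 := by positivity
      linarith)
  obtain ⟨Λ, hΛ⟩ : ∃ Λ, Λ = ∑ i ∈ Finset.range N, ‖x (i + 1) - x i‖ := ⟨_, rfl⟩
  rw [← hΛ] at hlen
  have hΛd : d₀ ≤ Λ := by
    rw [hΛ]
    refine hmp.trans ?_
    have := dist_le_range_sum_dist x N
    rw [hx0, hxN, dist_eq_norm] at this
    refine this.trans (le_of_eq (Finset.sum_congr rfl fun i _ => ?_))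
    rw [dist_comm, dist_eq_norm]
  have hΛ0 : 0 < Λ := hd₀.trans_le hΛd
  have hΛd1 : Λ ≤ d + 1 := by linarith
  set φ : ℕ → ℝ := fun i => 1 - (∑ j ∈ Finset.range i, ‖x (j + 1) - x j‖) / Λ with hφ
  have hφ0 : φ 0 = 1 := by simp [hφ]
  have hφN : φ N = 0 := by simp only [hφ]; rw [← hΛ, div_self hΛ0.ne', sub_self]
  have hφs : ∀ i, φ i - φ (i + 1) = 1 / Λ * ‖x (i + 1) - x i‖ := fun i => by
    simp only [hφ, Finset.sum_range_succ]; ring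
  have hφ1 : ∀ i, φ i ≤ 1 := fun i => by
    simp only [hφ]
    have : 0 ≤ (∑ j ∈ Finset.range i, ‖x (j + 1) - x j‖) / Λ :=
      div_nonneg (Finset.sum_nonneg fun _ _ => norm_nonneg _) hΛ0.le
    linarith
  have hφnn : ∀ i ≤ N, 0 ≤ φ i := fun i hi => by
    simp only [hφ]
    rw [sub_nonneg, div_le_one hΛ0, hΛ]
    exact Finset.sum_le_sum_of_subset_of_nonneg (Finset.range_mono hi) fun _ _ _ => norm_nonneg _
  set U : ℕ → E := fun i => Nat.rec u (fun j v => tangentProj g (x (j + 1)) v) i with hU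
  have hU0 : U 0 = u := rfl
  have hUs : ∀ i, U (i + 1) = tangentProj g (x (i + 1)) (U i) := fun i => rfl
  have hxF : ∀ i ≤ N, F (x i) = 0 := fun i hi => hxX i hi
  have hxR : ∀ i ≤ N, ‖x i‖ ≤ R := fun i hi => by linarith [hR _ (hxF i hi)]
  have hxg : ∀ i ≤ N, c ≤ ‖g (x i)‖ := fun i hi => hg _ (hxF i hi)
  have hxg0 : ∀ i ≤ N, g (x i) ≠ 0 := fun i hi => norm_pos_iff.1 (hc.trans_le (hxg i hi))
  have hUtan : ∀ i ≤ N, inner ℝ (g (x i)) (U i) = 0 := fun i hi => by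
    cases i with
    | zero => rw [hU0, hx0, hgu]
    | succ j => rw [hUs]; exact inner_tangentProj _ _ _ (hxg0 _ hi)
  have hUle : ∀ i ≤ N, ‖U i‖ ≤ h := fun i => by
    induction i with
    | zero => intro _; rw [hU0]; exact hu
    | succ j ih =>
      intro hj
      rw [hUs]
      exact (norm_tangentProj_le _ _ _ (hxg0 _ hj)).trans (ih (by omega))
  clear_value U φ
  obtain ⟨a, ha⟩ : ∃ a : ℕ → E, ∀ i,
    a i = x i + φ i • U i - levelCorrection g H (x i) (φ i • U i) := ⟨_, fun _ => rfl⟩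
  obtain ⟨b, hb⟩ : ∃ b : ℕ → E, ∀ i,
    b i = x i - φ i • U i - levelCorrection g H (x i) (φ i • U i) := ⟨_, fun _ => rfl⟩
  have hwle : ∀ i ≤ N, ‖φ i • U i‖ ≤ h := fun i hi => by
    rw [norm_smul, Real.norm_of_nonneg (hφnn i hi)]
    exact (mul_le_of_le_one_left (norm_nonneg _) (hφ1 i)).trans (hUle i hi)
  have hwtan : ∀ i ≤ N, inner ℝ (g (x i)) (φ i • U i) = 0 := fun i hi => by
    rw [inner_smul_right, hUtan i hi, mul_zero]
  have h2ρ : 2 * h ≤ ρ := by linarith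
  have hMc : M / c * h ≤ 1 := le_trans (by gcongr) hh3
  have hstepi : ∀ i < N, ‖a (i + 1) - a i‖ + ‖b (i + 1) - b i‖ ≤
      2 * ‖x (i + 1) - x i‖ + ‖x (i + 1) - x i‖ *
        ((1 / Λ) ^ 2 * h ^ 2 + K * (h ^ 4 + ‖x (i + 1) - x i‖ * h ^ 2)) := fun i hi => by
    rw [ha, ha, hb, hb, hUs]
    refine hstep (x i) (x (i + 1)) (U i) (1 / Λ) (φ i) (φ (i + 1)) h (hxR _ hi.le) (hxR _ hi)
      (hxF _ hi.le) (hxF _ hi) (hxg _ hi.le) (hxg _ hi) ?_ (hUtan _ hi.le) (hUle _ hi.le) hle1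
      (by positivity) (by gcongr) (hφnn _ hi.le) (hφ1 _) (hφnn _ hi) (hφ1 _) (hφs i)
    exact (hmesh i hi).trans (by linarith)
  have hΛq : (1 / Λ) ^ 2 ≤ (1 / d₀) ^ 2 := by gcongr
  have hside : ∀ i < N, ‖a (i + 1) - a i‖ + ‖b (i + 1) - b i‖ ≤ S * ‖x (i + 1) - x i‖ :=
    fun i hi => by
    refine (hstepi i hi).trans ?_
    have h1 : ‖x (i + 1) - x i‖ ≤ 1 := (hmesh i hi).trans (hp2.trans hle1)
    have h2 : (1 / Λ) ^ 2 * h ^ 2 ≤ (1 / d₀) ^ 2 * 1 :=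
      mul_le_mul hΛq (hp2.trans hle1) (by positivity) (by positivity)
    have h3 : h ^ 4 + ‖x (i + 1) - x i‖ * h ^ 2 ≤ 2 := by
      have : ‖x (i + 1) - x i‖ * h ^ 2 ≤ 1 * 1 :=
        mul_le_mul h1 (hp2.trans hle1) (by positivity) (by positivity)
      linarith
    have h4 : (1 / Λ) ^ 2 * h ^ 2 + K * (h ^ 4 + ‖x (i + 1) - x i‖ * h ^ 2)
        ≤ S - 2 := by
      have := mul_le_mul_of_nonneg_left h3 hK
      rw [hS]; linarith
    have := mul_le_mul_of_nonneg_left h4 (norm_nonneg (x (i + 1) - x i))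
    linarith
  have hr : S * h ^ 2 ≤ ρ := by
    refine le_trans ?_ hh4
    have : h ^ 2 ≤ h₀ := hp2.trans hle
    gcongr
  have hMr : (8 * M + 2 * M * (M / c)) * h ^ 3 + M * (S * h ^ 2) ^ 2 ≤ X * h ^ 3 := by
    have : M * S ^ 2 * h ^ 4 ≤ M * S ^ 2 * h ^ 3 := by gcongr
    rw [hX]
    linarith
  have hmain : ∀ (Y : E) (y : ℕ → E), F Y = 0 → ‖y 0 - Y‖ ≤ Δ * h ^ 2 → y N = p →
      (∀ i ≤ N, ‖y i‖ ≤ R) → (∀ i ≤ N, -((8 * M + 2 * M * (M / c)) * h ^ 3) ≤ F (y i)) →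
      (∀ i < N, ‖y (i + 1) - y i‖ ≤ S * ‖x (i + 1) - x i‖) →
      (pathEDist {x | F x = 0} Y p).toReal ≤ ‖y 0 - Y‖ + ∑ i ∈ Finset.range N, ‖y (i + 1) - y i‖
        + 2 * X / c₀ * T * h ^ 3 := by
    intro Y y hFY hYy hyN hyR hyF hy
    obtain ⟨P, hP0, hPs⟩ : ∃ P : ℕ → E, P 0 = Y ∧ ∀ i, P (i + 1) = y i :=
      ⟨fun i => Nat.casesOn i Y y, rfl, fun _ => rfl⟩
    have hξ : (8 * M + 2 * M * (M / c)) * h ^ 3 + M * (S * h ^ 2) ^ 2 ≤ X * h ^ 3 := hMr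
    have hYR : ‖Y‖ ≤ R := by linarith [hR Y hFY]
    have hp : F p = 0 := hxN ▸ hxF N le_rfl
    have hpR : ‖p‖ ≤ R := by linarith [hR p hp]
    have hnn : 0 ≤ (8 * M + 2 * M * (M / c)) * h ^ 3 := by positivity
    have hseg : ∀ i < N + 1, ∀ z ∈ segment ℝ (P i) (P (i + 1)), -(X * h ^ 3) ≤ F z := by
      intro i hi z hz
      refine (neg_le_neg hξ).trans ?_
      cases i with
      | zero =>
        rw [hPs, hP0] at hz
        refine D.neg_le_segment hYR (hYy.trans ?_) hr (by rw [hFY]; linarith)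
          (hyF 0 (Nat.zero_le _)) z hz
        have : Δ ≤ S := by
          rw [hS]
          have : 0 ≤ (1 / d₀) ^ 2 + 2 * K := by positivity
          linarith
        gcongr
      | succ j =>
        rw [hPs, hPs] at hz
        refine D.neg_le_segment (hyR j (by omega)) ((hy j (by omega)).trans ?_) hr
          (hyF j (by omega)) (hyF (j + 1) (by omega)) z hz
        have := hmesh j (by omega)
        gcongr
    have h1 := pathEDist_sublevel_le hF hFc hc₀ h0 (show 0 ≤ X * h ^ 3 by positivity)
      (by nlinarith) (N + 1) P (by rw [hP0, hFY]) (by rw [hPs, hyN, hp]) hseg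
    rw [hP0, hPs, hyN] at h1
    have h2 := ENNReal.toReal_mono ENNReal.ofReal_ne_top h1
    have hsum : ∑ i ∈ Finset.range (N + 1), ‖P (i + 1) - P i‖
        = ‖y 0 - Y‖ + ∑ i ∈ Finset.range N, ‖y (i + 1) - y i‖ := by
      rw [Finset.sum_range_succ', hPs, hP0, add_comm]
      simp only [hPs]
    rw [hsum, ENNReal.toReal_ofReal (by positivity)] at h2
    refine h2.trans ?_
    have h3 : ∑ i ∈ Finset.range N, ‖y (i + 1) - y i‖ ≤ (d + 1) * S := by
      calc ∑ i ∈ Finset.range N, ‖y (i + 1) - y i‖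
          ≤ ∑ i ∈ Finset.range N, S * ‖x (i + 1) - x i‖ :=
            Finset.sum_le_sum fun i hi => hy i (Finset.mem_range.1 hi)
        _ = S * Λ := by rw [← Finset.mul_sum, hΛ]
        _ ≤ S * (d + 1) := by gcongr
        _ = (d + 1) * S := mul_comm _ _
    have h4 : ‖y 0 - Y‖ ≤ Δ := hYy.trans (by nlinarith)
    have h5 : ‖y 0 - Y‖ + ∑ i ∈ Finset.range N, ‖y (i + 1) - y i‖ + (‖Y‖ + ‖p‖) ≤ T := by
      rw [hT]; linarith
    have h6 : 2 * (X * h ^ 3) / c₀ * (‖y 0 - Y‖ + ∑ i ∈ Finset.range N, ‖y (i + 1) - y i‖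
        + (‖Y‖ + ‖p‖)) ≤ 2 * (X * h ^ 3) / c₀ * T := by gcongr
    have e : 2 * (X * h ^ 3) / c₀ * T = 2 * X / c₀ * T * h ^ 3 := by ring
    linarith
  have hcorr : ∀ i ≤ N, ‖φ i • U i‖ + ‖levelCorrection g H (x i) (φ i • U i)‖ ≤ 1 := fun i hi => by
    have h1 := D.norm_levelCorrection_le hc (hxR i hi) (hxg i hi) (hwle i hi)
    have h2 := hwle i hi
    have h3 : M / c * h ^ 2 ≤ 1 * h := by rw [pow_two, ← mul_assoc]; gcongr
    linarith
  have haN : a N = p := by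
    rw [ha, hφN, D.levelCorrection_zero, zero_smul, add_zero, sub_zero, hxN]
  have hbN : b N = p := by
    rw [hb, hφN, D.levelCorrection_zero, zero_smul, sub_zero, sub_zero, hxN]
  have ha0 : a 0 = m + u - levelCorrection g H m u := by rw [ha, hφ0, one_smul, hU0, hx0]
  have hb0 : b 0 = m - u - levelCorrection g H m u := by rw [hb, hφ0, one_smul, hU0, hx0]
  have hAd := hmain A a hFA (by rw [ha0]; exact hA) haN
    (fun i hi => by
      rw [ha]
      linarith [norm_sub_le (x i + φ i • U i) (levelCorrection g H (x i) (φ i • U i)),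
        norm_add_le (x i) (φ i • U i), hcorr i hi, hR _ (hxF i hi)])
    (fun i hi => by
      rw [ha]
      exact D.neg_le_corrected hc (hxR i hi) (hxF i hi) (hxg i hi) (hwle i hi) (hwtan i hi) h2ρ hMc)
    (fun i hi => by linarith [hside i hi, norm_nonneg (b (i + 1) - b i)])
  have hBd := hmain B b hFB (by rw [hb0]; exact hB) hbN
    (fun i hi => by
      rw [hb]
      linarith [norm_sub_le (x i - φ i • U i) (levelCorrection g H (x i) (φ i • U i)),
        norm_sub_le (x i) (φ i • U i), hcorr i hi, hR _ (hxF i hi)])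
    (fun i hi => by
      have := D.neg_le_corrected hc (hxR i hi) (hxF i hi) (hxg i hi) (w := -(φ i • U i))
        (by rw [norm_neg]; exact hwle i hi) (by rw [inner_neg_right, hwtan i hi, neg_zero]) h2ρ hMc
      rw [D.levelCorrection_neg, ← sub_eq_add_neg] at this
      rwa [hb])
    (fun i hi => by linarith [hside i hi, norm_nonneg (a (i + 1) - a i)])
  have htot : ∑ i ∈ Finset.range N, ‖a (i + 1) - a i‖ + ∑ i ∈ Finset.range N, ‖b (i + 1) - b i‖
      ≤ 2 * Λ + h ^ 2 / d₀ + 2 * K * (d + 1) * h ^ 3 := by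
    rw [← Finset.sum_add_distrib]
    have h1 : ∀ i ∈ Finset.range N, ‖a (i + 1) - a i‖ + ‖b (i + 1) - b i‖ ≤
        ‖x (i + 1) - x i‖ * (2 + (1 / Λ) ^ 2 * h ^ 2 + 2 * K * h ^ 3) := fun i hi => by
      have hi := Finset.mem_range.1 hi
      refine (hstepi i hi).trans ?_
      have h2 : ‖x (i + 1) - x i‖ * h ^ 2 ≤ h ^ 2 * h ^ 2 :=
        mul_le_mul_of_nonneg_right (hmesh i hi) (by positivity)
      have h3 : K * (h ^ 4 + ‖x (i + 1) - x i‖ * h ^ 2) ≤ K * (2 * h ^ 3) :=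
        mul_le_mul_of_nonneg_left (by linarith) hK
      have := mul_le_mul_of_nonneg_left h3 (norm_nonneg (x (i + 1) - x i))
      linarith
    refine (Finset.sum_le_sum h1).trans ?_
    rw [← Finset.sum_mul, ← hΛ]
    have e : Λ * (2 + (1 / Λ) ^ 2 * h ^ 2 + 2 * K * h ^ 3)
        = 2 * Λ + h ^ 2 / Λ + 2 * K * Λ * h ^ 3 := by
      field_simp
    rw [e]
    gcongr
  rw [ha0] at hAd
  rw [hb0] at hBd
  rw [← hd]
  linarith

end SecondOrderData

end SecondVariationChain

section SecondDifference

variable {E : Type*} [NormedAddCommGroup E] [InnerProductSpace ℝ E]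
variable {F : E → ℝ} {g : E → E} {H : E → E → E → ℝ} {R ρ M : ℝ}

lemma ConvexOn.le_of_neg_on_ray (hF : ConvexOn ℝ univ F) {m e : E} {τ β t : ℝ} (hm : F m = 0)
    (hτ : 0 < τ) (hβ : F (m + τ • e) = -β) (ht0 : 0 ≤ t) (ht : t ≤ τ) :
    F (m + t • e) ≤ -(β / τ * t) := by
  have h := hF.2 (mem_univ m) (mem_univ (m + τ • e)) (show 0 ≤ 1 - t / τ by
    rw [sub_nonneg, div_le_one hτ]; exact ht) (show 0 ≤ t / τ by positivity) (by ring)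
  have e1 : (1 - t / τ) • m + (t / τ) • (m + τ • e) = m + t • e := by
    rw [smul_add, smul_smul, div_mul_cancel₀ _ hτ.ne']; module
  rw [e1, hm, hβ, smul_eq_mul, smul_eq_mul] at h
  refine h.trans (le_of_eq ?_)
  ring

set_option maxHeartbeats 1000000 in
/-- The second order comparison of the two chord ends `m ± û + (γ / 2) e` in the level set with the
corrected tangential displacements of `m`. -/
lemma SecondOrderData.chord_ends (D : SecondOrderData F g H R ρ M) (hF : ConvexOn ℝ univ F)
    {c σ τ β : ℝ} (hc : 0 < c) (hσ : 0 < σ) (hτ : 0 < τ) (hβ : 0 < β) {m e : E} (he : ‖e‖ = 1)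
    (hm : F m = 0) (hmR : ‖m‖ + 1 ≤ R) (hgm : c ≤ ‖g m‖) (hme : F (m + τ • e) = -β) :
    ∃ C h₀ : ℝ, 0 ≤ C ∧ 0 < h₀ ∧ h₀ ≤ 1 ∧ ∀ (h γ : ℝ) (û : E), 0 < h → h ≤ h₀ → 0 ≤ γ →
      γ ≤ 2 * σ * h → ‖û‖ ≤ σ * h →
      F (m + û + (γ / 2) • e) = 0 → F (m - û + (γ / 2) • e) = 0 →
      γ ≤ C * h ^ 2 ∧
      ‖m + tangentProj g m û - levelCorrection g H m (tangentProj g m û)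
        - (m + û + (γ / 2) • e)‖ ≤ γ / 2 + C * h ^ 3 ∧
      ‖m - tangentProj g m û - levelCorrection g H m (tangentProj g m û)
        - (m - û + (γ / 2) • e)‖ ≤ γ / 2 + C * h ^ 3 := by
  have hM : 0 < M := lt_of_lt_of_le one_pos D.one_le
  have hρ := D.pos
  have hρ1 := D.le_one
  obtain ⟨c₁, hc₁⟩ : ∃ c₁, c₁ = β / τ := ⟨_, rfl⟩
  have hc₁0 : 0 < c₁ := by rw [hc₁]; positivity
  obtain ⟨Δ, hΔ⟩ : ∃ Δ, Δ = 4 * M * σ ^ 2 / c₁ := ⟨_, rfl⟩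
  have hΔ0 : 0 < Δ := by rw [hΔ]; positivity
  obtain ⟨s, hs⟩ : ∃ s, s = σ + Δ + 1 := ⟨_, rfl⟩
  have hs1 : 1 ≤ s := by rw [hs]; linarith
  obtain ⟨T, hT⟩ : ∃ T, T = 8 * M * s ^ 3 + M * s ^ 2 := ⟨_, rfl⟩
  have hT0 : 0 < T := by rw [hT]; positivity
  obtain ⟨C, hC⟩ : ∃ C, C = T / c + (T + M * T * s / c) / c := ⟨_, rfl⟩
  have hC0 : 0 < C := by rw [hC]; positivity
  obtain ⟨h₀, hh₀, hh1, hh2, hh3⟩ : ∃ h₀ : ℝ, 0 < h₀ ∧ h₀ ≤ 1 ∧ σ * h₀ ≤ τ ∧ 2 * s * h₀ ≤ ρ := by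
    refine ⟨min 1 (min (τ / σ) (ρ / (2 * s))), by positivity, min_le_left _ _, ?_, ?_⟩
    · have h1 : min 1 (min (τ / σ) (ρ / (2 * s))) ≤ τ / σ :=
        (min_le_right _ _).trans (min_le_left _ _)
      rw [le_div_iff₀ hσ] at h1
      linarith
    · have h1 : min 1 (min (τ / σ) (ρ / (2 * s))) ≤ ρ / (2 * s) :=
        (min_le_right _ _).trans (min_le_right _ _)
      rw [le_div_iff₀ (by positivity)] at h1
      linarith
  refine ⟨Δ + C, h₀, by positivity, hh₀, hh1, ?_⟩
  intro h γ û hpos hle hγ0 hγ hû hA hB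
  have hle1 : h ≤ 1 := hle.trans hh1
  have hg0 : 0 < ‖g m‖ := hc.trans_le hgm
  have hgne : g m ≠ 0 := norm_pos_iff.1 hg0
  have hmR' : ‖m‖ ≤ R := by linarith
  have hσs : σ ≤ s := by rw [hs]; linarith
  have hsρ : 2 * s * h ≤ ρ := le_trans (by gcongr) hh3
  have hσh : σ * h ≤ s * h := by gcongr
  have hûs : ‖û‖ ≤ s * h := hû.trans hσh
  have hsh : 0 ≤ s * h := by positivity
  have hnγ : ‖(γ / 2) • e‖ = γ / 2 := by
    rw [norm_smul, he, mul_one, Real.norm_of_nonneg (by positivity)]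
  have hγ2 : γ / 2 ≤ s * h := by linarith
  -- the midpoint of the two ends is not deep inside the sublevel set
  have hγb : γ ≤ Δ * h ^ 2 := by
    have hR' : ‖m + (γ / 2) • e‖ ≤ R := by
      refine (norm_add_le _ _).trans ?_
      rw [hnγ]; linarith
    have ha := D.taylor (m + (γ / 2) • e) û hR' (by linarith)
    have hb := D.taylor (m + (γ / 2) • e) (-û) hR' (by rw [norm_neg]; linarith)
    have e1 : m + (γ / 2) • e + û = m + û + (γ / 2) • e := by abel
    have e2 : m + (γ / 2) • e + -û = m - û + (γ / 2) • e := by abel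
    have e3 : H (m + (γ / 2) • e) (-û) (-û) = H (m + (γ / 2) • e) û û := by
      simpa using D.hess_smul (m + (γ / 2) • e) û û (-1)
    rw [e1, hA, abs_le] at ha
    rw [e2, hB, e3, inner_neg_right, norm_neg, abs_le] at hb
    have h1 := (le_abs_self _).trans (D.hess_le (m + (γ / 2) • e) û û hR')
    have h2 := hF.le_of_neg_on_ray hm hτ hme (show 0 ≤ γ / 2 by positivity)
      (show γ / 2 ≤ τ by
        have : σ * h ≤ σ * h₀ := by gcongr
        linarith)
    rw [← hc₁] at h2
    have h3 : ‖û‖ ^ 3 ≤ ‖û‖ ^ 2 := by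
      have : ‖û‖ ≤ 1 := by linarith
      nlinarith [sq_nonneg ‖û‖]
    have h4 : ‖û‖ ^ 2 ≤ (σ * h) ^ 2 := by gcongr
    have h5 : c₁ * γ ≤ 4 * M * (σ * h) ^ 2 := by
      have := mul_le_mul_of_nonneg_left h3 hM.le
      have := mul_le_mul_of_nonneg_left h4 hM.le
      have := mul_nonneg hM.le (sq_nonneg (σ * h))
      linarith [ha.1, hb.1]
    rw [hΔ, div_mul_eq_mul_div, le_div_iff₀ hc₁0]
    linarith
  have hγs : γ ≤ s * h ^ 2 := hγb.trans (by rw [hs]; gcongr; linarith)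
  have hTay : ∀ w : E, ‖w‖ = ‖û‖ → H m w w = H m û û → F (m + w + (γ / 2) • e) = 0 →
      |inner ℝ (g m) w + γ / 2 * inner ℝ (g m) e + H m û û / 2| ≤ T * h ^ 3 := by
    intro w hw hHw hFw
    have hwn : ‖w + (γ / 2) • e‖ ≤ 2 * s * h := by
      refine (norm_add_le _ _).trans ?_
      rw [hw, hnγ]; linarith
    have h1 := D.taylor m (w + (γ / 2) • e) hmR' (hwn.trans hsρ)
    rw [← add_assoc, hFw, hm, inner_add_right, inner_smul_right] at h1
    have h2 := D.hess_diff m (w + (γ / 2) • e) w hmR'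
    rw [add_sub_cancel_left, hnγ, hHw, hw] at h2
    have h3 : M * ‖w + (γ / 2) • e‖ ^ 3 ≤ M * (2 * s * h) ^ 3 := by gcongr
    have h4 : M * (γ / 2) * (‖w + (γ / 2) • e‖ + ‖û‖) ≤ M * (s * h ^ 2 / 2) * (2 * s * h + s * h) := by
      gcongr
    rw [hT]
    have h5 : 0 ≤ M * s ^ 2 * h ^ 3 := by positivity
    rw [abs_le] at h1 h2 ⊢
    constructor <;> linarith [h1.1, h1.2, h2.1, h2.2]
  have hp := hTay û rfl rfl hA
  have hn := hTay (-û) (norm_neg û) (by simpa using D.hess_smul m û û (-1))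
    (by rwa [← sub_eq_add_neg])
  rw [inner_neg_right] at hn
  have hgu : |inner ℝ (g m) û| ≤ T * h ^ 3 := by
    rw [abs_le] at hp hn ⊢
    constructor <;> linarith [hp.1, hp.2, hn.1, hn.2]
  have hge : |γ / 2 * inner ℝ (g m) e + H m û û / 2| ≤ T * h ^ 3 := by
    rw [abs_le] at hp hn ⊢
    constructor <;> linarith [hp.1, hp.2, hn.1, hn.2]
  have hdu : ‖tangentProj g m û - û‖ ≤ T / c * h ^ 3 := by
    rw [norm_sub_tangentProj g m û hgne, div_mul_eq_mul_div]
    gcongr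
  set u := tangentProj g m û with hu
  have hun : ‖u‖ ≤ s * h := (norm_tangentProj_le g m û hgne).trans hûs
  have hHu : |H m u u - H m û û| ≤ 2 * (M * T * s / c) * h ^ 3 := by
    refine (D.hess_diff m u û hmR').trans ?_
    calc M * ‖u - û‖ * (‖u‖ + ‖û‖) ≤ M * (T / c * h ^ 3) * (s * h + s * h) := by gcongr
      _ = 2 * (M * T * s / c) * h ^ 3 * h := by ring
      _ ≤ 2 * (M * T * s / c) * h ^ 3 * 1 := by gcongr
      _ = _ := by ring
  have hco : |γ / 2 * inner ℝ (g m) e + H m u u / 2| ≤ (T + M * T * s / c) * h ^ 3 := by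
    rw [abs_le] at hge hHu ⊢
    constructor <;> linarith [hge.1, hge.2, hHu.1, hHu.2]
  have hte : ‖(γ / 2) • tangentProj g m e‖ ≤ γ / 2 := by
    rw [norm_smul, Real.norm_of_nonneg (by positivity)]
    have := norm_tangentProj_le g m e hgne
    rw [he] at this
    exact mul_le_of_le_one_right (by positivity) this
  have hco' : ‖((γ / 2 * inner ℝ (g m) e + H m u u / 2) / ‖g m‖ ^ 2) • g m‖
      ≤ (T + M * T * s / c) / c * h ^ 3 := by
    rw [norm_smul, Real.norm_eq_abs, abs_div, abs_pow, abs_norm]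
    calc |γ / 2 * inner ℝ (g m) e + H m u u / 2| / ‖g m‖ ^ 2 * ‖g m‖
        = |γ / 2 * inner ℝ (g m) e + H m u u / 2| / ‖g m‖ := by field_simp
      _ ≤ (T + M * T * s / c) * h ^ 3 / c := by gcongr
      _ = _ := by ring
  have hfin : ∀ w : E, ‖w‖ ≤ T / c * h ^ 3 → ‖w - (γ / 2) • tangentProj g m e
      - ((γ / 2 * inner ℝ (g m) e + H m u u / 2) / ‖g m‖ ^ 2) • g m‖
      ≤ γ / 2 + (Δ + C) * h ^ 3 := by
    intro w hw
    refine (norm_sub_le _ _).trans ((add_le_add_left (norm_sub_le _ _) _).trans ?_)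
    have : 0 ≤ Δ * h ^ 3 := by positivity
    rw [hC]
    linarith
  refine ⟨hγb.trans (by gcongr; linarith), ?_, ?_⟩
  · refine le_trans (le_of_eq ?_) (hfin (u - û) hdu)
    congr 1
    rw [levelCorrection, tangentProj]
    module
  · refine le_trans (le_of_eq ?_) (hfin (û - u) (by rwa [norm_sub_rev]))
    congr 1
    rw [levelCorrection, tangentProj]
    module

/-- The upper bound for second differences of the intrinsic distance along a chart. -/
lemma SecondOrderData.second_difference [CompleteSpace E] (D : SecondOrderData F g H R ρ M)
    (hF : ConvexOn ℝ univ F) (hFc : Continuous F) {c₀ c d₀ : ℝ} (hc₀ : 0 < c₀) (h0 : F 0 ≤ -c₀)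
    (hc : 0 < c) (hR : ∀ x, F x = 0 → ‖x‖ + 1 ≤ R) (hg : ∀ x, F x = 0 → c ≤ ‖g x‖)
    {m p e : E} {σ τ : ℝ} (hm : F m = 0) (hd₀ : 0 < d₀) (hmp : d₀ ≤ ‖m - p‖) (he : ‖e‖ = 1)
    (hσ : 0 < σ) (hτ : 0 < τ) (hme : F (m + τ • e) < 0)
    (hfin : pathEDist {x | F x = 0} m p ≠ ⊤) :
    ∃ C h₀ : ℝ, 0 < h₀ ∧ ∀ (h γ : ℝ) (û : E), 0 < h → h ≤ h₀ → 0 ≤ γ →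
      γ ≤ 2 * σ * h → ‖û‖ ≤ σ * h →
      F (m + û + (γ / 2) • e) = 0 → F (m - û + (γ / 2) • e) = 0 →
      (pathEDist {x | F x = 0} (m + û + (γ / 2) • e) p).toReal
          + (pathEDist {x | F x = 0} (m - û + (γ / 2) • e) p).toReal ≤
        2 * (pathEDist {x | F x = 0} m p).toReal + σ ^ 2 * h ^ 2 / d₀ + γ + C * h ^ 3 := by
  obtain ⟨C, h₁, hC, hh₁, hh₁1, hends⟩ := D.chord_ends hF hc hσ hτ (β := -F (m + τ • e))
    (by linarith) he hm (hR m hm) (hg m hm) (by ring)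
  obtain ⟨C', h₂, hC', hh₂, hvar⟩ := D.second_variation hF hFc hc₀ h0 hc hR hg hm hd₀ hmp
    (Δ := 2 * C / σ ^ 2) (by positivity) hfin
  refine ⟨2 * C + C' * σ ^ 3, min h₁ (h₂ / σ), by positivity, ?_⟩
  intro h γ û hpos hle hγ0 hγ hû hA hB
  obtain ⟨h1, h2, h3⟩ := hends h γ û hpos (hle.trans (min_le_left _ _)) hγ0 hγ hû hA hB
  have hgne : g m ≠ 0 := norm_pos_iff.1 (hc.trans_le (hg m hm))
  have hle2 : σ * h ≤ h₂ := by
    have := hle.trans (min_le_right _ _)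
    rw [le_div_iff₀ hσ] at this
    linarith
  have hh1 : h ≤ 1 := (hle.trans (min_le_left _ _)).trans hh₁1
  have hb : γ / 2 + C * h ^ 3 ≤ 2 * C / σ ^ 2 * (σ * h) ^ 2 := by
    have e1 : 2 * C / σ ^ 2 * (σ * h) ^ 2 = 2 * C * h ^ 2 := by field_simp
    have : C * h ^ 3 ≤ C * h ^ 2 := by
      have : h ^ 3 ≤ h ^ 2 := by nlinarith [sq_nonneg h]
      gcongr
    rw [e1]
    linarith
  have h4 := hvar (σ * h) (tangentProj g m û) _ _ (by positivity) hle2 hA hB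
    (inner_tangentProj g m û hgne) ((norm_tangentProj_le g m û hgne).trans hû)
    (h2.trans hb) (h3.trans hb)
  have e2 : (σ * h) ^ 2 / d₀ = σ ^ 2 * h ^ 2 / d₀ := by rw [mul_pow]
  have e3 : C' * (σ * h) ^ 3 = C' * σ ^ 3 * h ^ 3 := by ring
  linarith

end SecondDifference

section Concavity

lemma nonneg_of_second_difference_le {q : ℝ → ℝ} (hq : ContinuousOn q (Icc 0 1)) (h0 : q 0 = 0)
    (h1 : q 1 = 0) (hs : ∀ t ∈ Ioo (0 : ℝ) 1, ∃ C h₀ : ℝ, 0 < h₀ ∧ ∀ h, 0 < h → h ≤ h₀ →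
      q (t + h) + q (t - h) - 2 * q t ≤ C * h ^ 3) :
    ∀ t ∈ Icc (0 : ℝ) 1, 0 ≤ q t := by
  by_contra! hcon
  obtain ⟨t, ht, hneg⟩ := hcon
  set δ := -q t with hδ
  have hδ0 : 0 < δ := by linarith
  have hψ : ContinuousOn (fun s : ℝ => q s + δ * (s * (1 - s))) (Icc 0 1) :=
    hq.add (by fun_prop)
  obtain ⟨z, hz, hmin⟩ := isCompact_Icc.exists_isMinOn ⟨t, ht⟩ hψ
  rw [isMinOn_iff] at hmin
  have hzt := hmin t ht
  have ht4 : t * (1 - t) ≤ 1 / 4 := by nlinarith [sq_nonneg (t - 1 / 2)]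
  have hzneg : q z + δ * (z * (1 - z)) < 0 := by nlinarith
  have hz0 : z ≠ 0 := by rintro rfl; simp [h0] at hzneg
  have hz1 : z ≠ 1 := by rintro rfl; simp [h1] at hzneg
  have hzI : z ∈ Ioo (0 : ℝ) 1 := ⟨lt_of_le_of_ne hz.1 hz0.symm, lt_of_le_of_ne hz.2 hz1⟩
  obtain ⟨C, h₀, hh₀, hC⟩ := hs z hzI
  set h := min (min h₀ (δ / (|C| + 1))) (min z (1 - z)) with hh
  have hC1 : 0 < |C| + 1 := by positivity
  have hpos : 0 < h := by
    have := hzI.1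
    have := hzI.2
    refine lt_min (lt_min hh₀ (by positivity)) (lt_min hzI.1 (by linarith))
  have hle1 : h ≤ h₀ := (min_le_left _ _).trans (min_le_left _ _)
  have hle2 : h ≤ δ / (|C| + 1) := (min_le_left _ _).trans (min_le_right _ _)
  have hle3 : h ≤ z := (min_le_right _ _).trans (min_le_left _ _)
  have hle4 : h ≤ 1 - z := (min_le_right _ _).trans (min_le_right _ _)
  have e1 := hC h hpos hle1
  have e2 := hmin (z + h) ⟨by linarith, by linarith⟩
  have e3 := hmin (z - h) ⟨by linarith, by linarith⟩
  rw [le_div_iff₀ hC1] at hle2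
  have e4 : C * h ≤ δ := by nlinarith [le_abs_self C]
  have e5 : C * h ^ 3 ≤ δ * h ^ 2 := by
    have := mul_le_mul_of_nonneg_right e4 (sq_nonneg h)
    linarith
  have : 0 < δ * h ^ 2 := by positivity
  linarith

lemma concaveOn_of_second_difference_le {E : Type*} [NormedAddCommGroup E] [NormedSpace ℝ E]
    {W : Set E} {P : E → ℝ} (hW : Convex ℝ W) (hP : ContinuousOn P W)
    (hs : ∀ z ∈ W, ∀ v : E, ∃ C h₀ : ℝ, 0 < h₀ ∧ ∀ h, 0 < h → h ≤ h₀ →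
      P (z + h • v) + P (z - h • v) - 2 * P z ≤ C * h ^ 3) :
    ConcaveOn ℝ W P := by
  refine ⟨hW, fun x hx y hy a b ha hb hab => ?_⟩
  obtain rfl : a = 1 - b := by linarith
  have hmaps : MapsTo (fun t : ℝ => x + t • (y - x)) (Icc 0 1) W := fun t ht =>
    hW.add_smul_sub_mem hx hy ht
  have key := nonneg_of_second_difference_le
    (q := fun t => P (x + t • (y - x)) - (1 - t) * P x - t * P y) ?_ (by simp) (by simp) ?_
    b ⟨hb, by linarith⟩
  · rw [show (1 - b) • x + b • y = x + b • (y - x) by module, smul_eq_mul, smul_eq_mul]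
    linarith
  · refine ((hP.comp (by fun_prop) hmaps).sub (by fun_prop)).sub (by fun_prop)
  · intro t ht
    obtain ⟨C, h₀, hh₀, hC⟩ := hs _ (hmaps (Ioo_subset_Icc_self ht)) (y - x)
    refine ⟨C, h₀, hh₀, fun h hpos hle => ?_⟩
    have := hC h hpos hle
    rw [show x + t • (y - x) + h • (y - x) = x + (t + h) • (y - x) by module,
      show x + t • (y - x) - h • (y - x) = x + (t - h) • (y - x) by module] at this
    linarith

end Concavity

section ChartConcavity

variable {E : Type*} [NormedAddCommGroup E] [InnerProductSpace ℝ E]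

/-- A Lipschitz parametrization of a part of `X` bounds the intrinsic distance. -/
lemma pathEDist_chart_le {V : Type*} [NormedAddCommGroup V] [NormedSpace ℝ V] {X : Set E}
    {W : Set V} {G : V → E} {K : ℝ≥0} (hK : K ≠ 0) (hW : Convex ℝ W)
    (hG : LipschitzOnWith K G W) (hGX : MapsTo G W X) {x y : V} (hx : x ∈ W) (hy : y ∈ W) :
    pathEDist X (G x) (G y) ≤ K * edist x y := by
  have hs : segment ℝ x y ⊆ W := hW.segment_subset hx hy
  refine (pathEDist_map_le hK (hG.mono hs) (hGX.mono_left hs) x y).trans ?_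
  gcongr
  exact pathEDist_segment_le x y

lemma continuousOn_pathEDist_chart {V : Type*} [NormedAddCommGroup V] [NormedSpace ℝ V]
    {X : Set E} {W : Set V} {G : V → E} {K : ℝ≥0} (hK : K ≠ 0) (hW : Convex ℝ W)
    (hG : LipschitzOnWith K G W) (hGX : MapsTo G W X) {p : E}
    (hfin : ∀ x ∈ W, pathEDist X (G x) p ≠ ⊤) :
    ContinuousOn (fun x => (pathEDist X (G x) p).toReal) W := by
  have h : LipschitzOnWith K (fun x => (pathEDist X (G x) p).toReal) W := by
    refine LipschitzOnWith.of_le_add_mul K fun x hx y hy => ?_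
    have h1 := (pathEDist_triangle X (G x) (G y) p).trans
      (add_le_add_left (pathEDist_chart_le hK hW hG hGX hx hy) _)
    have h2 := ENNReal.toReal_mono (by
      refine ENNReal.add_ne_top.2 ⟨ENNReal.mul_ne_top ENNReal.coe_ne_top (edist_ne_top _ _),
        hfin y hy⟩) h1
    rw [ENNReal.toReal_add (ENNReal.mul_ne_top ENNReal.coe_ne_top (edist_ne_top _ _)) (hfin y hy),
      ENNReal.toReal_mul, edist_dist, ENNReal.toReal_ofReal dist_nonneg] at h2
    simpa [add_comm] using h2
  exact h.continuousOn

lemma lipschitzOnWith_graph {S : Submodule ℝ E} {e b : E} (he : ‖e‖ = 1) {W : Set S} {φ : S → ℝ}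
    {κ : ℝ≥0} (hφ : LipschitzOnWith κ φ W) :
    LipschitzOnWith (1 + κ) (fun x : S => b + (x : E) + φ x • e) W := by
  refine LipschitzOnWith.of_dist_le_mul fun x hx y hy => ?_
  have h := hφ.dist_le_mul x hx y hy
  have e1 : b + (x : E) + φ x • e - (b + (y : E) + φ y • e)
      = ((x - y : S) : E) + (φ x - φ y) • e := by
    push_cast; module
  rw [dist_eq_norm, e1]
  refine (norm_add_le _ _).trans ?_
  rw [norm_smul, he, mul_one, ← dist_eq_norm, ← Submodule.coe_norm, ← dist_eq_norm]
  push_cast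
  linarith

/-- For a smooth convex surface, the distance from a point becomes concave in a chart after
subtracting an explicit convex function. -/
lemma concaveOn_distance_sub [CompleteSpace E] {F : E → ℝ} {g : E → E} {H : E → E → E → ℝ}
    (D : ∀ R, ∃ ρ M, SecondOrderData F g H R ρ M) (hF : ConvexOn ℝ univ F) (hFc : Continuous F)
    (h0 : F 0 < 0) {R₀ : ℝ} (hR₀ : ∀ x, F x = 0 → ‖x‖ ≤ R₀) {S : Submodule ℝ E} {e b p : E}
    (he : ‖e‖ = 1) {W : Set S} (hWo : IsOpen W) {φ : S → ℝ} (hφ : ConvexOn ℝ W φ) {κ : ℝ≥0}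
    (hφL : LipschitzOnWith κ φ W) (hX : ∀ x ∈ W, F (b + (x : E) + φ x • e) = 0)
    (htr : ∀ x ∈ W, ∃ τ : ℝ, 0 < τ ∧ F (b + (x : E) + φ x • e + τ • e) < 0)
    {d₀ : ℝ} (hd₀ : 0 < d₀) (hd : ∀ x ∈ W, d₀ ≤ ‖b + (x : E) + φ x • e - p‖)
    (hfin : ∀ x ∈ W, pathEDist {x | F x = 0} (b + (x : E) + φ x • e) p ≠ ⊤) :
    ConcaveOn ℝ W (fun x : S => (pathEDist {x | F x = 0} (b + (x : E) + φ x • e) p).toReal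
      - (1 + κ) ^ 2 / (2 * d₀) * ‖x‖ ^ 2 - φ x) := by
  have hW := hφ.1
  have hcont := continuousOn_pathEDist_chart (K := 1 + κ) (by positivity) hW
    (lipschitzOnWith_graph (b := b) he hφL) (X := {x | F x = 0}) hX hfin
  refine concaveOn_of_second_difference_le hW
    ((hcont.sub (by fun_prop)).sub hφL.continuousOn) fun z hz v => ?_
  rcases eq_or_ne v 0 with rfl | hv
  · refine ⟨0, 1, one_pos, fun h _ _ => ?_⟩
    simp only [smul_zero, add_zero, sub_zero]
    linarith
  obtain ⟨R, hR⟩ : ∃ R, R = |R₀| + 1 := ⟨_, rfl⟩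
  have hRpos : 0 < R := by rw [hR]; positivity
  have hRb : ∀ x, F x = 0 → ‖x‖ + 1 ≤ R := fun x hx => by
    rw [hR]; linarith [hR₀ x hx, le_abs_self R₀]
  obtain ⟨ρ, M, DD⟩ := D R
  have hg : ∀ x, F x = 0 → -F 0 / R ≤ ‖g x‖ := fun x hx => by
    have h1 := DD.grad_ineq x 0
    rw [hx, zero_sub, inner_neg_right] at h1
    have h2 := real_inner_le_norm (g x) x
    have h3 : ‖g x‖ * ‖x‖ ≤ ‖g x‖ * R := by
      gcongr; linarith [hRb x hx]
    rw [div_le_iff₀ hRpos]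
    linarith
  obtain ⟨τ, hτ, hme⟩ := htr z hz
  have hv0 : 0 < ‖v‖ := norm_pos_iff.2 hv
  obtain ⟨C, h₁, hh₁, hC⟩ := DD.second_difference hF hFc (c₀ := -F 0) (by linarith) (by linarith)
    (div_pos (by linarith) hRpos) hRb hg (hX z hz) hd₀ (hd z hz) he
    (σ := (1 + κ) * ‖v‖) (by positivity) hτ hme (hfin z hz)
  obtain ⟨h₂, hh₂, hball⟩ : ∃ h₂ : ℝ, 0 < h₂ ∧ ∀ h : ℝ, |h| < h₂ → z + h • v ∈ W := by
    have hc : Continuous (fun h : ℝ => z + h • v) := by fun_prop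
    have := hc.continuousAt.preimage_mem_nhds (x := (0 : ℝ)) (t := W)
      (by simpa using hWo.mem_nhds hz)
    obtain ⟨r, hr, hb⟩ := Metric.mem_nhds_iff.1 this
    exact ⟨r, hr, fun h hh => hb (by simpa using hh)⟩
  refine ⟨C, min h₁ (h₂ / 2), by positivity, fun h hpos hle => ?_⟩
  have hle2 := hle.trans (min_le_right _ _)
  have hp : z + h • v ∈ W := hball h (by rw [abs_of_pos hpos]; linarith)
  have hn : z - h • v ∈ W := by
    have := hball (-h) (by rw [abs_neg, abs_of_pos hpos]; linarith)
    rwa [neg_smul, ← sub_eq_add_neg] at this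
  obtain ⟨s, hs⟩ : ∃ s, s = φ (z + h • v) - φ z := ⟨_, rfl⟩
  obtain ⟨t, ht⟩ : ∃ t, t = φ (z - h • v) - φ z := ⟨_, rfl⟩
  have hsb : |s| ≤ κ * (h * ‖v‖) := by
    have := hφL.dist_le_mul _ hp _ hz
    rwa [Real.dist_eq, ← hs, dist_eq_norm, add_sub_cancel_left, norm_smul,
      Real.norm_of_nonneg hpos.le] at this
  have htb : |t| ≤ κ * (h * ‖v‖) := by
    have := hφL.dist_le_mul _ hn _ hz
    rwa [Real.dist_eq, ← ht, dist_eq_norm, sub_sub_cancel_left, norm_neg, norm_smul,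
      Real.norm_of_nonneg hpos.le] at this
  have hgap : 0 ≤ s + t := by
    have := hφ.2 hp hn (show (0 : ℝ) ≤ 1 / 2 by norm_num) (show (0 : ℝ) ≤ 1 / 2 by norm_num)
      (by norm_num)
    rw [show (1 / 2 : ℝ) • (z + h • v) + (1 / 2 : ℝ) • (z - h • v) = z by module, smul_eq_mul,
      smul_eq_mul] at this
    rw [hs, ht]; linarith
  have hhv : 0 ≤ h * ‖v‖ := by positivity
  rw [abs_le] at hsb htb
  have hst : |s - t| ≤ 2 * (κ * (h * ‖v‖)) := by
    rw [abs_le]; constructor <;> linarith [hsb.1, hsb.2, htb.1, htb.2]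
  have e1 : b + ((z + h • v : S) : E) + φ (z + h • v) • e
      = b + (z : E) + φ z • e + (h • (v : E) + ((s - t) / 2) • e) + ((s + t) / 2) • e := by
    rw [show φ (z + h • v) = φ z + s by rw [hs]; ring]
    push_cast; module
  have e2 : b + ((z - h • v : S) : E) + φ (z - h • v) • e
      = b + (z : E) + φ z • e - (h • (v : E) + ((s - t) / 2) • e) + ((s + t) / 2) • e := by
    rw [show φ (z - h • v) = φ z + t by rw [ht]; ring]
    push_cast; module
  have key := hC h (s + t) (h • (v : E) + ((s - t) / 2) • e) hpos (hle.trans (min_le_left _ _))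
    hgap (by linarith [hsb.2, htb.2]) (by
      refine (norm_add_le _ _).trans ?_
      rw [norm_smul, norm_smul, he, mul_one, Real.norm_of_nonneg hpos.le, Real.norm_eq_abs,
        abs_div, abs_two, ← Submodule.coe_norm]
      linarith) (by rw [← e1]; exact hX _ hp) (by rw [← e2]; exact hX _ hn)
  rw [← e1, ← e2] at key
  have hpar := parallelogram_law_with_norm ℝ z (h • v)
  rw [norm_smul, Real.norm_of_nonneg hpos.le] at hpar
  have e3 : (1 + (κ : ℝ)) ^ 2 / (2 * d₀) * (‖z + h • v‖ ^ 2 + ‖z - h • v‖ ^ 2 - 2 * ‖z‖ ^ 2)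
      = ((1 + κ) * ‖v‖) ^ 2 * h ^ 2 / d₀ := by
    rw [show ‖z + h • v‖ ^ 2 + ‖z - h • v‖ ^ 2 - 2 * ‖z‖ ^ 2 = 2 * (h * ‖v‖) ^ 2 by linarith]
    field_simp
  linarith

end ChartConcavity

section SmoothApproximation

lemma IsPreconnected.subset_interior {α : Type*} [TopologicalSpace α] {s C : Set α}
    (hs : IsPreconnected s) (hC : (s ∩ C).Nonempty) (h : ∀ x ∈ s, x ∉ frontier C) :
    s ⊆ interior C := by
  have hcl : ∀ x ∈ s, x ∈ closure C → x ∈ interior C := fun x hx hxC => by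
    by_contra hxi
    exact h x hx ⟨hxC, hxi⟩
  refine hs.subset_left_of_subset_union isOpen_interior isClosed_closure.isOpen_compl
    (disjoint_compl_right.mono_left (interior_subset.trans subset_closure)) (fun x hx => ?_) ?_
  · by_cases hxC : x ∈ closure C
    exacts [Or.inl (hcl x hx hxC), Or.inr hxC]
  · obtain ⟨x, hx, hxC⟩ := hC
    exact ⟨x, hx, hcl x hx (subset_closure hxC)⟩

variable {E : Type*} [NormedAddCommGroup E] [InnerProductSpace ℝ E]

lemma smul_mem_interior_of_mem {C : Set E} (hconv : Convex ℝ C) (h0 : 0 ∈ interior C) {z : E}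
    (hz : z ∈ C) {t : ℝ} (ht0 : 0 ≤ t) (ht1 : t < 1) : t • z ∈ interior C := by
  have := hconv.combo_interior_self_mem_interior h0 hz (a := 1 - t) (b := t) (by linarith) ht0
    (by ring)
  simpa using this

/-- A finite family of linear functionals approximating a compact convex set. -/
lemma exists_finset_separating [FiniteDimensional ℝ E] {C : Set E} (hC : IsCompact C)
    (hconv : Convex ℝ C) (h0 : 0 ∈ interior C) {s : ℝ} (hs : 1 < s) :
    ∃ J : Finset E, (∀ k ∈ J, ∀ z ∈ C, inner ℝ k z ≤ 1) ∧
      ∀ z ∉ C, ∃ k ∈ J, s⁻¹ < inner ℝ k z := by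
  have hs0 : 0 < s := by linarith
  have hsinv : s⁻¹ < 1 := inv_lt_one_of_one_lt₀ hs
  have h0C : (0 : E) ∈ C := interior_subset h0
  have hsep : ∀ y ∈ frontier C, ∃ k : E, (∀ z ∈ C, inner ℝ k z ≤ 1) ∧ s⁻¹ < inner ℝ k y := by
    intro y hy
    have hyC : s • y ∉ C := fun h => by
      have := smul_mem_interior_of_mem hconv h0 h (t := s⁻¹) (by positivity) hsinv
      rw [inv_smul_smul₀ hs0.ne'] at this
      exact hy.2 this
    obtain ⟨f, u, h1, h2⟩ := geometric_hahn_banach_closed_point hconv hC.isClosed hyC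
    have hu : 0 < u := by simpa using h1 0 h0C
    refine ⟨u⁻¹ • (InnerProductSpace.toDual ℝ E).symm f, fun z hz => ?_, ?_⟩
    · rw [real_inner_smul_left, InnerProductSpace.toDual_symm_apply, inv_mul_le_iff₀ hu]
      linarith [h1 z hz]
    · rw [real_inner_smul_left, InnerProductSpace.toDual_symm_apply, lt_inv_mul_iff₀ hu,
        mul_inv_lt_iff₀ hs0]
      simpa [mul_comm] using h2
  choose! k hk1 hk2 using hsep
  obtain ⟨t, ht, hcov⟩ := (hC.isClosed.frontier_subset |> hC.of_isClosed_subset isClosed_frontier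
    : IsCompact (frontier C)).elim_nhds_subcover (fun y => {z | s⁻¹ < inner ℝ (k y) z})
    fun y hy => (isOpen_lt continuous_const (by fun_prop)).mem_nhds (hk2 y hy)
  classical
  refine ⟨t.image k, fun q hq z hz => ?_, fun z hz => ?_⟩
  · obtain ⟨y, hy, rfl⟩ := Finset.mem_image.1 hq
    exact hk1 y (ht y hy) z hz
  · obtain ⟨w, hw, hwf⟩ : ∃ w ∈ segment ℝ 0 z, w ∈ frontier C := by
      by_contra! h
      exact hz (interior_subset ((convex_segment (0 : E) z).isPreconnected.subset_interior
        ⟨0, left_mem_segment ℝ _ _, h0C⟩ h (right_mem_segment ℝ _ _)))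
    rw [segment_eq_image'] at hw
    obtain ⟨r, ⟨hr0, hr1⟩, rfl⟩ := hw
    obtain ⟨y, hy, hyw⟩ := mem_iUnion₂.1 (hcov hwf)
    refine ⟨k y, Finset.mem_image_of_mem _ hy, ?_⟩
    simp only [sub_zero, zero_add, mem_ofPred_eq, real_inner_smul_right] at hyw
    have hsp : 0 < s⁻¹ := by positivity
    nlinarith

/-- A convex body with `0` in its interior is approximated from inside by sublevel sets of sums of
exponentials. -/
lemma exists_expSum_approx [FiniteDimensional ℝ E] {C : Set E} (hC : IsCompact C)
    (hconv : Convex ℝ C) (h0 : 0 ∈ interior C) {r : ℝ} (hr : 1 < r) :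
    ∃ (J : Finset E) (l : ℝ), expSum J l 0 < 0 ∧ (∀ z, expSum J l z ≤ 0 → z ∈ C) ∧
      ∀ z ∈ C, expSum J l (r⁻¹ • z) ≤ 0 := by
  obtain ⟨s, hs, rfl⟩ : ∃ s : ℝ, 1 < s ∧ s ^ 2 = r :=
    ⟨√r, Real.lt_sqrt_of_sq_lt (by linarith), Real.sq_sqrt (by linarith)⟩
  obtain ⟨J₀, hJ1, hJ2⟩ := exists_finset_separating hC hconv h0 hs
  have hs0 : 0 < s := by linarith
  have hgap : 0 < s⁻¹ - (s ^ 2)⁻¹ := by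
    have : (s ^ 2)⁻¹ < s⁻¹ := inv_strictAnti₀ hs0 (by nlinarith)
    linarith
  obtain ⟨N, hN⟩ : ∃ N : ℝ, N = J₀.card + 1 := ⟨_, rfl⟩
  have hN1 : 1 ≤ N := by rw [hN]; simp
  have hlog : 0 ≤ Real.log N := Real.log_nonneg hN1
  obtain ⟨L, hL0, hL⟩ : ∃ L : ℝ, 0 < L ∧ Real.log N ≤ L * (s⁻¹ - (s ^ 2)⁻¹) :=
    ⟨Real.log N / (s⁻¹ - (s ^ 2)⁻¹) + 1, by positivity, by
      rw [add_mul, div_mul_cancel₀ _ hgap.ne']; linarith⟩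
  classical
  have hbound : ∀ z : E, (∀ k ∈ J₀, inner ℝ k z ≤ (s ^ 2)⁻¹) →
      expSum (J₀.image (L • ·)) (L * (s ^ 2)⁻¹ + Real.log N) z < 0 := by
    intro z hz
    have h1 : ∀ k ∈ J₀.image (L • ·),
        Real.exp (inner ℝ k z - (L * (s ^ 2)⁻¹ + Real.log N)) ≤ N⁻¹ := by
      intro k hk
      obtain ⟨q, hq, rfl⟩ := Finset.mem_image.1 hk
      rw [← Real.exp_log (show 0 < N⁻¹ by positivity), Real.log_inv]
      refine Real.exp_le_exp.2 ?_
      rw [real_inner_smul_left]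
      have := mul_le_mul_of_nonneg_left (hz q hq) hL0.le
      linarith
    have h2 := Finset.sum_le_card_nsmul _ _ _ h1
    have h3 : (((J₀.image (L • ·)).card : ℕ) : ℝ) ≤ J₀.card := by
      exact_mod_cast Finset.card_image_le
    rw [nsmul_eq_mul] at h2
    have h4 : (((J₀.image (L • ·)).card : ℕ) : ℝ) * N⁻¹ < 1 := by
      rw [← div_eq_mul_inv, div_lt_one (by positivity)]; linarith
    rw [expSum]
    linarith
  refine ⟨J₀.image (L • ·), L * (s ^ 2)⁻¹ + Real.log N, hbound 0 fun k _ => ?_, fun z hz => ?_,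
    fun z hz => (hbound _ fun k hk => ?_).le⟩
  · rw [inner_zero_right]; positivity
  · by_contra hzC
    obtain ⟨k, hk, hkz⟩ := hJ2 z hzC
    have h1 : 1 < Real.exp (inner ℝ (L • k) z - (L * (s ^ 2)⁻¹ + Real.log N)) := by
      rw [Real.one_lt_exp_iff, real_inner_smul_left]
      have := mul_lt_mul_of_pos_left hkz hL0
      linarith
    have h2 := Finset.single_le_sum (s := J₀.image (L • ·))
      (f := fun k => Real.exp (inner ℝ k z - (L * (s ^ 2)⁻¹ + Real.log N)))
      (fun _ _ => (Real.exp_pos _).le) (Finset.mem_image_of_mem _ hk)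
    rw [expSum] at hz
    linarith
  · rw [real_inner_smul_right]
    have := mul_le_mul_of_nonneg_left (hJ1 k hk z hz) (show 0 ≤ (s ^ 2)⁻¹ by positivity)
    linarith

end SmoothApproximation

section Comparison

variable {E : Type*} [NormedAddCommGroup E] [InnerProductSpace ℝ E] {F : E → ℝ}

lemma pathEDist_sublevel_le_frontier (hF : ConvexOn ℝ univ F) (hc : Continuous F) (h0 : F 0 < 0)
    {C : Set E} (hFC : ∀ z, F z ≤ 0 → z ∈ C) {π : E → E} (hπ : LipschitzWith 1 π)
    (hfix : ∀ z, F z ≤ 0 → π z = z)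
    (hfr : ∀ z, z ∉ interior {x | F x ≤ 0} → π z ∈ frontier {x | F x ≤ 0})
    {q q' p : E} (hq' : F q' = 0) (hseg : ∀ z ∈ segment ℝ q q', 0 ≤ F z) :
    pathEDist {x | F x = 0} q' (π p) ≤ edist q' q + pathEDist (frontier C) q p := by
  have hint : interior {x | F x ≤ 0} ⊆ interior C := interior_mono hFC
  have h1 := pathEDist_frontier_segment_le hπ hfr (z := q') (w := q) fun y hy =>
    notMem_interior_sublevel hF h0 (hseg y (by rwa [segment_symm]))
  have h2 := pathEDist_map_le one_ne_zero (hπ.lipschitzOnWith (s := frontier C))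
    (fun y hy => hfr y fun h => hy.2 (hint h)) q p
  rw [frontier_sublevel_eq hF hc h0] at h1 h2
  rw [hfix q' hq'.le] at h1
  rw [ENNReal.coe_one, one_mul] at h2
  exact (pathEDist_triangle _ _ _ _).trans (add_le_add h1 h2)

lemma pathEDist_frontier_le_sublevel [CompleteSpace E] (hF : ConvexOn ℝ univ F) (h0 : F 0 < 0)
    {C : Set E} (hC : IsClosed C) (hconv : Convex ℝ C) (h0C : 0 ∈ interior C) {r : ℝ≥0}
    (hr : 1 ≤ r) (hCF : ∀ z ∈ C, F ((r : ℝ)⁻¹ • z) ≤ 0)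
    {q q' p p' : E} (hq : q ∈ frontier C) (hp : p ∈ frontier C)
    (hqs : ∀ z ∈ segment ℝ q q', 0 ≤ F z) (hps : ∀ z ∈ segment ℝ p' p, 0 ≤ F z) :
    pathEDist (frontier C) q p ≤ edist q ((r : ℝ) • q) + (r * edist q q' +
      (r * pathEDist {x | F x = 0} q' p' + (r * edist p' p + edist ((r : ℝ) • p) p))) := by
  have hr0 : (0 : ℝ) < r := lt_of_lt_of_le one_pos (by exact_mod_cast hr)
  have hr1 : (1 : ℝ) ≤ r := by exact_mod_cast hr
  have hrne : r ≠ 0 := (lt_of_lt_of_le one_pos hr).ne'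
  obtain ⟨π, hπ, hfix, hfr, -, -⟩ := exists_convex_retraction hC hconv ⟨0, interior_subset h0C⟩
  have hout : ∀ z, 0 ≤ F z → (r : ℝ) • z ∉ interior C := fun z hz h => by
    refine notMem_interior_sublevel hF h0 hz (mem_interior_iff_mem_nhds.2 ?_)
    have hcont : Continuous fun y : E => (r : ℝ) • y := continuous_const_smul _
    filter_upwards [hcont.continuousAt.preimage_mem_nhds (isOpen_interior.mem_nhds h)] with y hy
    have := hCF _ (interior_subset hy)
    rwa [inv_smul_smul₀ hr0.ne'] at this
  have hfixf : ∀ z ∈ frontier C, π z = z := fun z hz => hfix z (hC.frontier_subset hz)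
  have hrad : ∀ z ∈ frontier C, ∀ y ∈ segment ℝ z ((r : ℝ) • z), y ∉ interior C := by
    rintro z hz y ⟨a, c, ha, hc, hac, rfl⟩ h
    have e : a • z + c • (r : ℝ) • z = (1 + c * (r - 1)) • z := by
      rw [show a = 1 - c by linarith]; module
    rw [e] at h
    have h1 : 1 ≤ 1 + c * ((r : ℝ) - 1) := by nlinarith
    rcases h1.eq_or_lt with h2 | h2
    · rw [← h2, one_smul] at h; exact hz.2 h
    · have := smul_mem_interior_of_mem hconv h0C (interior_subset h)
        (t := (1 + c * ((r : ℝ) - 1))⁻¹) (by positivity) (inv_lt_one_of_one_lt₀ h2)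
      rw [inv_smul_smul₀ (by positivity)] at this
      exact hz.2 this
  have hL : LipschitzWith r (fun z : E => π ((r : ℝ) • z)) := by
    have := hπ.comp (lipschitzWith_smul (r : ℝ) : LipschitzWith _ fun z : E => (r : ℝ) • z)
    simpa [Function.comp_def] using this
  have hmap : ∀ A : Set E, (∀ z ∈ A, 0 ≤ F z) → ∀ z w,
      pathEDist (frontier C) (π ((r : ℝ) • z)) (π ((r : ℝ) • w)) ≤ r * pathEDist A z w :=
    fun A hA z w => pathEDist_map_le hrne (hL.lipschitzOnWith (s := A))
      (fun y hy => hfr _ (hout y (hA y hy))) z w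
  have s1 := pathEDist_frontier_segment_le hπ hfr (hrad q hq)
  have s2 := (hmap _ hqs q q').trans (mul_le_mul_right (pathEDist_segment_le q q') _)
  have s3 := hmap {x | F x = 0} (fun z hz => (show F z = 0 from hz).ge) q' p'
  have s4 := (hmap _ hps p' p).trans (mul_le_mul_right (pathEDist_segment_le p' p) _)
  have s5 := pathEDist_frontier_segment_le hπ hfr (z := (r : ℝ) • p) (w := p)
    fun y hy => hrad p hp y (by rwa [segment_symm])
  rw [hfixf q hq] at s1
  rw [hfixf p hp] at s5
  exact (pathEDist_triangle _ _ _ _).trans (add_le_add s1 ((pathEDist_triangle _ _ _ _).trans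
    (add_le_add s2 ((pathEDist_triangle _ _ _ _).trans (add_le_add s3
    ((pathEDist_triangle _ _ _ _).trans (add_le_add s4 s5)))))))

end Comparison

section SublevelChart

variable {E : Type*} [NormedAddCommGroup E] [InnerProductSpace ℝ E] {F : E → ℝ}

/-- The lower boundary of a convex sublevel set, as a graph over a ball on which the height `t₀`
lies inside. -/
lemma exists_sublevel_chart (hF : ConvexOn ℝ univ F) (hc : Continuous F) {R₀ : ℝ}
    (hR₀ : ∀ z, F z ≤ 0 → ‖z‖ ≤ R₀) {S : Submodule ℝ E} {e b : E} (he : ‖e‖ = 1) {x₁ : S}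
    {ρ t₀ : ℝ} (hρ : 0 < ρ)
    (ht₀ : ∀ x ∈ Metric.ball x₁ (2 * ρ), F (b + (x : E) + t₀ • e) < 0) :
    ∃ φ : S → ℝ, ConvexOn ℝ (Metric.ball x₁ ρ) φ ∧
      LipschitzOnWith (Real.toNNReal (2 * (R₀ + ‖b‖ + ‖x₁‖ + 2 * ρ) / ρ)) φ (Metric.ball x₁ ρ) ∧
      ∀ x ∈ Metric.ball x₁ (2 * ρ), F (b + (x : E) + φ x • e) = 0 ∧ φ x < t₀ ∧
        ∀ t, F (b + (x : E) + t • e) ≤ 0 → φ x ≤ t := by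
  have habs : ∀ x ∈ Metric.ball x₁ (2 * ρ), ∀ t, F (b + (x : E) + t • e) ≤ 0 →
      |t| ≤ R₀ + ‖b‖ + ‖x₁‖ + 2 * ρ := by
    intro x hx t ht
    have h1 := hR₀ _ ht
    have h2 : ‖t • e‖ ≤ ‖b + (x : E) + t • e‖ + (‖b‖ + ‖(x : E)‖) := by
      calc ‖t • e‖ = ‖(b + (x : E) + t • e) - (b + (x : E))‖ := by congr 1; module
        _ ≤ _ := (norm_sub_le _ _).trans (by gcongr; exact norm_add_le _ _)
    rw [norm_smul, he, mul_one, Real.norm_eq_abs] at h2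
    have h3 : ‖x‖ ≤ ‖x₁‖ + 2 * ρ := by
      have := norm_le_norm_add_norm_sub' x x₁
      have := mem_ball_iff_norm.1 hx
      linarith
    rw [← Submodule.coe_norm] at h2
    linarith
  have hlow : ∀ x ∈ Metric.ball x₁ (2 * ρ), BddBelow {t : ℝ | F (b + (x : E) + t • e) ≤ 0} :=
    fun x hx => ⟨_, fun t ht => (abs_le.1 (habs x hx t ht)).1⟩
  obtain ⟨φ, hφ⟩ : ∃ φ : S → ℝ, ∀ x, φ x = sInf {t : ℝ | F (b + (x : E) + t • e) ≤ 0} :=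
    ⟨_, fun _ => rfl⟩
  have hmin : ∀ x ∈ Metric.ball x₁ (2 * ρ), ∀ t, F (b + (x : E) + t • e) ≤ 0 → φ x ≤ t :=
    fun x hx t ht => by rw [hφ]; exact csInf_le (hlow x hx) ht
  have hmem : ∀ x ∈ Metric.ball x₁ (2 * ρ), F (b + (x : E) + φ x • e) ≤ 0 := fun x hx => by
    have hcl : IsClosed {t : ℝ | F (b + (x : E) + t • e) ≤ 0} :=
      isClosed_le (by fun_prop) continuous_const
    rw [hφ]
    exact hcl.csInf_mem ⟨t₀, (ht₀ x hx).le⟩ (hlow x hx)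
  have hzero : ∀ x ∈ Metric.ball x₁ (2 * ρ), F (b + (x : E) + φ x • e) = 0 := fun x hx => by
    refine le_antisymm (hmem x hx) (not_lt.1 fun hlt => ?_)
    have hcont : Continuous fun t : ℝ => F (b + (x : E) + t • e) := by fun_prop
    obtain ⟨δ, hδ, hb⟩ := Metric.isOpen_iff.1 (isOpen_lt hcont continuous_const) (φ x) hlt
    have h1 : φ x - δ / 2 ∈ Metric.ball (φ x) δ := by
      rw [mem_ball_iff_norm, sub_sub_cancel_left, norm_neg, Real.norm_of_nonneg (by positivity)]
      linarith
    have := hmin x hx _ (le_of_lt (hb h1))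
    linarith
  have hlt : ∀ x ∈ Metric.ball x₁ (2 * ρ), φ x < t₀ := fun x hx =>
    lt_of_le_of_ne (hmin x hx _ (ht₀ x hx).le) fun h => by
      have h1 := hzero x hx
      rw [h] at h1
      exact (ht₀ x hx).ne h1
  have hconv : ConvexOn ℝ (Metric.ball x₁ (2 * ρ)) φ := by
    refine ⟨convex_ball _ _, fun x hx y hy a c ha hc' hac => hmin _
      (convex_ball _ _ hx hy ha hc' hac) _ ?_⟩
    have h1 := hF.2 (mem_univ (b + (x : E) + φ x • e)) (mem_univ (b + (y : E) + φ y • e)) ha hc' hac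
    rw [hzero x hx, hzero y hy, smul_zero, smul_zero, add_zero] at h1
    have e1 : b + ((a • x + c • y : S) : E) + (a • φ x + c • φ y) • e
        = a • (b + (x : E) + φ x • e) + c • (b + (y : E) + φ y • e) := by
      rw [show a = 1 - c by linarith]
      push_cast
      module
    rwa [e1]
  have hsub : Metric.ball x₁ ρ ⊆ Metric.ball x₁ (2 * ρ) := Metric.ball_subset_ball (by linarith)
  refine ⟨φ, hconv.subset hsub (convex_ball _ _), ?_,
    fun x hx => ⟨hzero x hx, hlt x hx, hmin x hx⟩⟩
  have := hconv.lipschitzOnWith_of_abs_le (ε := ρ) hρ fun x hx => habs x hx _ (hmem x hx)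
  rwa [show 2 * ρ - ρ = ρ by ring] at this

end SublevelChart

section FrontierConcavity

variable {E : Type*} [NormedAddCommGroup E] [InnerProductSpace ℝ E] [FiniteDimensional ℝ E]

/-- Approximation of the distance from a point of a convex surface, in a chart, by the distances
on smooth convex surfaces. -/
lemma exists_concave_approx {C : Set E} (hC : IsCompact C) (hconv : Convex ℝ C)
    (h0C : 0 ∈ interior C) {R₀ : ℝ} (hR₀ : ∀ z ∈ C, ‖z‖ ≤ R₀) {S : Submodule ℝ E} {e b p : E}
    (he : ‖e‖ = 1) {x₁ : S} {ρ t₀ d₀ : ℝ} (hρ : 0 < ρ) (hd₀ : 0 < d₀) {f : S → ℝ}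
    (hf : ∀ x ∈ Metric.ball x₁ ρ, b + (x : E) + f x • e ∈ frontier C)
    (hft : ∀ x ∈ Metric.ball x₁ ρ, f x < t₀ ∧ t₀ - f x ≤ d₀)
    (hball : Metric.ball (b + (x₁ : E) + t₀ • e) (4 * ρ) ⊆ C) (hp : p ∈ frontier C)
    (hfar : ∀ x ∈ Metric.ball x₁ ρ, 3 * d₀ ≤ ‖b + (x : E) + f x • e - p‖)
    (hfin : ∀ x ∈ Metric.ball x₁ ρ, pathEDist (frontier C) (b + (x : E) + f x • e) p ≠ ⊤)
    {r : ℝ} (hr : 1 < r) (hrp : (r - 1) * ‖p‖ ≤ d₀)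
    (hrb : (r - 1) * (‖b + (x₁ : E) + t₀ • e‖ + 2 * ρ) ≤ 2 * ρ) :
    ∃ φ D : S → ℝ,
      ConcaveOn ℝ (Metric.ball x₁ ρ) (fun x => D x
        - (1 + (Real.toNNReal (2 * (R₀ + ‖b‖ + ‖x₁‖ + 2 * ρ) / ρ) : ℝ)) ^ 2 / (2 * d₀) * ‖x‖ ^ 2
        - φ x) ∧
      ∀ x ∈ Metric.ball x₁ ρ, f x ≤ φ x ∧ (∀ t, r • (b + (x : E) + t • e) ∈ C → φ x ≤ t) ∧
        D x ≤ (pathEDist (frontier C) (b + (x : E) + f x • e) p).toReal + (φ x - f x) ∧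
        (pathEDist (frontier C) (b + (x : E) + f x • e) p).toReal ≤
          (r - 1) * ‖b + (x : E) + f x • e‖ + (r * (φ x - f x) + (r * D x +
            (r * ((r - 1) * ‖p‖) + (r - 1) * ‖p‖))) := by
  have hr0 : 0 < r := by linarith
  obtain ⟨J, l, h0, hFC, hCF⟩ := exists_expSum_approx hC hconv h0C hr
  have hF := convexOn_expSum J l
  have hFc := continuous_expSum J l
  have hlt_int : ∀ z, expSum J l z < 0 → z ∈ interior {x | expSum J l x ≤ 0} := fun z hz =>
    interior_maximal (fun y (hy : expSum J l y < 0) => hy.le) (isOpen_lt hFc continuous_const) hz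
  have hint : interior {x | expSum J l x ≤ 0} ⊆ interior C := interior_mono hFC
  have hsub : Metric.ball x₁ ρ ⊆ Metric.ball x₁ (2 * ρ) := Metric.ball_subset_ball (by linarith)
  have hinner : ∀ x ∈ Metric.ball x₁ (2 * ρ), b + (x : E) + t₀ • e ∈
      Metric.ball (b + (x₁ : E) + t₀ • e) (2 * ρ) := fun x hx => by
    rw [mem_ball_iff_norm] at hx ⊢
    rw [show b + (x : E) + t₀ • e - (b + (x₁ : E) + t₀ • e) = ((x - x₁ : S) : E) by
      push_cast; module]
    exact hx
  have hneg : ∀ x ∈ Metric.ball x₁ (2 * ρ), expSum J l (b + (x : E) + t₀ • e) < 0 := by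
    intro x hx
    refine not_le.1 fun h => notMem_interior_sublevel hF h0 h
      (interior_maximal (fun z hz => ?_) Metric.isOpen_ball (hinner x hx))
    have := hCF (r • z) (hball ?_)
    · rwa [inv_smul_smul₀ hr0.ne'] at this
    · rw [mem_ball_iff_norm] at hz ⊢
      have h1 : ‖r • z - (b + (x₁ : E) + t₀ • e)‖ ≤
          (r - 1) * ‖z‖ + ‖z - (b + (x₁ : E) + t₀ • e)‖ := by
        rw [show r • z - (b + (x₁ : E) + t₀ • e) = (r - 1) • z + (z - (b + (x₁ : E) + t₀ • e)) by
          module]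
        refine (norm_add_le _ _).trans (add_le_add_left ?_ _)
        rw [norm_smul, Real.norm_of_nonneg (by linarith)]
      have h2 := norm_le_norm_add_norm_sub' z (b + (x₁ : E) + t₀ • e)
      have h3 : (r - 1) * ‖z‖ ≤ (r - 1) * (‖b + (x₁ : E) + t₀ • e‖ + 2 * ρ) :=
        mul_le_mul_of_nonneg_left (by linarith) (by linarith)
      linarith
  obtain ⟨φ, hφconv, hφL, hφ⟩ := exists_sublevel_chart hF hFc (R₀ := R₀)
    (fun z hz => hR₀ z (hFC z hz)) he hρ hneg
  obtain ⟨π, hπ, hfix, hfr, hnear, hπseg⟩ := exists_convex_retraction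
    (C := {x | expSum J l x ≤ 0}) (isClosed_le hFc continuous_const)
    (by simpa using hF.convex_le 0) ⟨0, h0.le⟩
  have hpint : p ∉ interior {x | expSum J l x ≤ 0} := fun h => hp.2 (hint h)
  have hpp : ‖p - π p‖ ≤ (r - 1) * ‖p‖ := by
    refine (hnear p _ (hCF p (hC.isClosed.frontier_subset hp))).trans ?_
    rw [show p - r⁻¹ • p = (1 - r⁻¹) • p by module, norm_smul, Real.norm_of_nonneg
      (sub_nonneg.2 (inv_le_one_of_one_le₀ hr.le))]
    rw [show 1 - r⁻¹ = (r - 1) / r by field_simp]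
    exact mul_le_mul_of_nonneg_right (div_le_self (by linarith) hr.le) (norm_nonneg _)
  have hps : ∀ z ∈ segment ℝ (π p) p, 0 ≤ expSum J l z := fun z hz =>
    not_lt.1 fun h => hπseg p hpint z (by rwa [segment_symm]) (hlt_int z h)
  have hfφ : ∀ x ∈ Metric.ball x₁ ρ, f x ≤ φ x := fun x hx => by
    obtain ⟨hz, hlt, -⟩ := hφ x (hsub hx)
    refine not_lt.1 fun hlt' => (hf x hx).2 ?_
    have h1 := hconv.openSegment_self_interior_subset_interior (hFC _ hz.le)
      (hint (hlt_int _ (hneg x (hsub hx))))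
    refine h1 ⟨(t₀ - f x) / (t₀ - φ x), (f x - φ x) / (t₀ - φ x), ?_, ?_, ?_, ?_⟩
    · have := (hft x hx).1
      exact div_pos (by linarith) (by linarith)
    · exact div_pos (by linarith) (by linarith)
    · rw [← add_div, div_eq_one_iff_eq (by linarith)]; ring
    · obtain ⟨θ, hθ⟩ : ∃ θ, θ = (f x - φ x) / (t₀ - φ x) := ⟨_, rfl⟩
      have h2 : (t₀ - f x) / (t₀ - φ x) = 1 - θ := by
        rw [hθ]; field_simp [show t₀ - φ x ≠ 0 by linarith]; ring
      have h3 : f x = φ x + θ * (t₀ - φ x) := by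
        rw [hθ]; field_simp [show t₀ - φ x ≠ 0 by linarith]; ring
      rw [h2, ← hθ, h3]
      module
  have hdiff : ∀ x : S, b + (x : E) + φ x • e - (b + (x : E) + f x • e) = (φ x - f x) • e :=
    fun x => by module
  have hqs : ∀ x ∈ Metric.ball x₁ ρ, ∀ z ∈ segment ℝ (b + (x : E) + f x • e)
      (b + (x : E) + φ x • e), 0 ≤ expSum J l z := by
    intro x hx z hz
    rw [segment_eq_image'] at hz
    obtain ⟨θ, ⟨hθ0, hθ1⟩, rfl⟩ := hz
    simp only
    obtain ⟨hz, -, hmin⟩ := hφ x (hsub hx)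
    have e1 : b + (x : E) + f x • e + θ • (b + (x : E) + φ x • e - (b + (x : E) + f x • e))
        = b + (x : E) + (f x + θ * (φ x - f x)) • e := by module
    rw [e1]
    by_contra! hlt
    have h1 := hmin _ hlt.le
    have h2 : φ x = f x + θ * (φ x - f x) := le_antisymm h1 (by nlinarith [hfφ x hx])
    rw [← h2] at hlt
    linarith
  have hed : ∀ x ∈ Metric.ball x₁ ρ, edist (b + (x : E) + φ x • e) (b + (x : E) + f x • e)
      = ENNReal.ofReal (φ x - f x) := fun x hx => by
    rw [edist_dist, dist_eq_norm, hdiff, norm_smul, he, mul_one,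
      Real.norm_of_nonneg (by linarith [hfφ x hx])]
  have hle1 : ∀ x ∈ Metric.ball x₁ ρ, pathEDist {x | expSum J l x = 0} (b + (x : E) + φ x • e) (π p)
      ≤ ENNReal.ofReal (φ x - f x) + pathEDist (frontier C) (b + (x : E) + f x • e) p :=
    fun x hx => by
      rw [← hed x hx]
      exact pathEDist_sublevel_le_frontier hF hFc h0 hFC hπ hfix hfr (hφ x (hsub hx)).1 (hqs x hx)
  have hfin' : ∀ x ∈ Metric.ball x₁ ρ,
      pathEDist {x | expSum J l x = 0} (b + (x : E) + φ x • e) (π p) ≠ ⊤ := fun x hx =>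
    ne_top_of_le_ne_top (ENNReal.add_ne_top.2 ⟨ENNReal.ofReal_ne_top, hfin x hx⟩) (hle1 x hx)
  refine ⟨φ, fun x => (pathEDist {x | expSum J l x = 0} (b + (x : E) + φ x • e) (π p)).toReal,
    concaveOn_distance_sub (fun R => expSum_secondOrderData J l R) hF hFc h0
      (fun x hx => hR₀ x (hFC x (show expSum J l x = 0 from hx).le)) he Metric.isOpen_ball hφconv
      hφL (fun x hx => (hφ x (hsub hx)).1) (fun x hx => ⟨t₀ - φ x, ?_, ?_⟩) hd₀ (fun x hx => ?_)
      hfin', fun x hx => ⟨hfφ x hx, fun t ht => (hφ x (hsub hx)).2.2 t ?_, ?_, ?_⟩⟩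
  · linarith [(hφ x (hsub hx)).2.1]
  · rw [show b + (x : E) + φ x • e + (t₀ - φ x) • e = b + (x : E) + t₀ • e by module]
    exact hneg x (hsub hx)
  · have h1 : ‖b + (x : E) + f x • e - p‖ ≤ ‖(b + (x : E) + φ x • e) - π p‖
        + ‖(φ x - f x) • e‖ + ‖p - π p‖ := by
      rw [← hdiff]
      calc _ = ‖((b + (x : E) + φ x • e) - π p)
            - (b + (x : E) + φ x • e - (b + (x : E) + f x • e)) - (p - π p)‖ := by congr 1; module
        _ ≤ _ := (norm_sub_le _ _).trans (add_le_add_left (norm_sub_le _ _) _)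
    rw [norm_smul, he, mul_one, Real.norm_of_nonneg (by linarith [hfφ x hx])] at h1
    linarith [hfar x hx, (hft x hx).2, (hφ x (hsub hx)).2.1]
  · have := hCF _ ht
    rwa [inv_smul_smul₀ hr0.ne'] at this
  · have := ENNReal.toReal_mono (ENNReal.add_ne_top.2 ⟨ENNReal.ofReal_ne_top, hfin x hx⟩)
      (hle1 x hx)
    rw [ENNReal.toReal_add ENNReal.ofReal_ne_top (hfin x hx),
      ENNReal.toReal_ofReal (by linarith [hfφ x hx])] at this
    linarith
  · lift r to ℝ≥0 using hr0.le
    have h1 := pathEDist_frontier_le_sublevel hF h0 hC.isClosed hconv h0C (r := r)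
      (by exact_mod_cast hr.le) hCF (hf x hx) hp (hqs x hx) hps
    rw [edist_comm (b + (x : E) + f x • e) (b + (x : E) + φ x • e), hed x hx] at h1
    have t1 : ∀ z : E, edist z ((r : ℝ) • z) = ENNReal.ofReal ((r - 1) * ‖z‖) := fun z => by
      rw [edist_dist, dist_eq_norm, norm_sub_rev, show (r : ℝ) • z - z = ((r : ℝ) - 1) • z by
        module, norm_smul, Real.norm_of_nonneg (by linarith)]
    have t2 : edist (π p) p ≤ ENNReal.ofReal ((r - 1) * ‖p‖) := by
      rw [edist_comm, edist_dist, dist_eq_norm]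
      exact ENNReal.ofReal_le_ofReal hpp
    rw [edist_comm ((r : ℝ) • p) p, t1, t1] at h1
    have t3 : pathEDist {x | expSum J l x = 0} (b + (x : E) + φ x • e) (π p) = ENNReal.ofReal
        (pathEDist {x | expSum J l x = 0} (b + (x : E) + φ x • e) (π p)).toReal :=
      (ENNReal.ofReal_toReal (hfin' x hx)).symm
    have hr1 : 0 ≤ (r : ℝ) - 1 := by linarith
    have hφ0 : 0 ≤ φ x - f x := by linarith [hfφ x hx]
    have t4 := h1.trans (by gcongr : _ ≤ _ + (_ + (_ + (r * ENNReal.ofReal ((r - 1) * ‖p‖) + _))))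
    rw [t3, ← ENNReal.ofReal_coe_nnreal, ← ENNReal.ofReal_mul r.coe_nonneg, ← ENNReal.ofReal_mul r.coe_nonneg,
      ← ENNReal.ofReal_mul r.coe_nonneg, ← ENNReal.ofReal_add (by positivity) (by positivity),
      ← ENNReal.ofReal_add (by positivity) (by positivity),
      ← ENNReal.ofReal_add (by positivity) (by positivity),
      ← ENNReal.ofReal_add (by positivity) (by positivity)] at t4
    exact ENNReal.toReal_le_of_le_ofReal (by positivity) t4

end FrontierConcavity

section FrontierDistance

open Filter Topology

variable {E : Type*} [NormedAddCommGroup E] [InnerProductSpace ℝ E] [FiniteDimensional ℝ E]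

lemma concaveOn_frontier_distance {C : Set E} (hC : IsCompact C) (hconv : Convex ℝ C)
    (h0C : 0 ∈ interior C) {R₀ : ℝ} (hR₀ : ∀ z ∈ C, ‖z‖ ≤ R₀) {S : Submodule ℝ E} {e b p : E}
    (he : ‖e‖ = 1) {x₁ : S} {ρ t₀ d₀ : ℝ} (hρ : 0 < ρ) (hd₀ : 0 < d₀) {f : S → ℝ}
    (hf : ∀ x ∈ Metric.ball x₁ ρ, b + (x : E) + f x • e ∈ frontier C)
    (hft : ∀ x ∈ Metric.ball x₁ ρ, f x < t₀ ∧ t₀ - f x ≤ d₀)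
    (hball : Metric.ball (b + (x₁ : E) + t₀ • e) (4 * ρ) ⊆ C) (hp : p ∈ frontier C)
    (hfar : ∀ x ∈ Metric.ball x₁ ρ, 3 * d₀ ≤ ‖b + (x : E) + f x • e - p‖)
    (hfin : ∀ x ∈ Metric.ball x₁ ρ, pathEDist (frontier C) (b + (x : E) + f x • e) p ≠ ⊤) :
    ConcaveOn ℝ (Metric.ball x₁ ρ)
      (fun x => (pathEDist (frontier C) (b + (x : E) + f x • e) p).toReal
        - (1 + (Real.toNNReal (2 * (R₀ + ‖b‖ + ‖x₁‖ + 2 * ρ) / ρ) : ℝ)) ^ 2 / (2 * d₀) * ‖x‖ ^ 2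
        - f x) := by
  have hid : Tendsto (fun r : ℝ => r) (𝓝[>] 1) (𝓝 1) := tendsto_id.mono_left nhdsWithin_le_nhds
  have hid1 : Tendsto (fun r : ℝ => r - 1) (𝓝[>] 1) (𝓝 0) := by
    simpa using hid.sub_const 1
  have hev1 : ∀ᶠ r : ℝ in 𝓝[>] 1, (r - 1) * ‖p‖ ≤ d₀ := by
    have : Tendsto (fun r : ℝ => (r - 1) * ‖p‖) (𝓝[>] 1) (𝓝 0) := by
      simpa using hid1.mul_const ‖p‖
    exact (this.eventually_lt_const hd₀).mono fun _ h => h.le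
  have hev2 : ∀ᶠ r : ℝ in 𝓝[>] 1, (r - 1) * (‖b + (x₁ : E) + t₀ • e‖ + 2 * ρ) ≤ 2 * ρ := by
    have : Tendsto (fun r : ℝ => (r - 1) * (‖b + (x₁ : E) + t₀ • e‖ + 2 * ρ)) (𝓝[>] 1) (𝓝 0) := by
      simpa using hid1.mul_const (‖b + (x₁ : E) + t₀ • e‖ + 2 * ρ)
    exact (this.eventually_lt_const (by positivity : 0 < 2 * ρ)).mono fun _ h => h.le
  have hex := (hev1.and (hev2.and self_mem_nhdsWithin)).mono fun r h =>
    exists_concave_approx hC hconv h0C hR₀ he hρ hd₀ hf hft hball hp hfar hfin h.2.2 h.1 h.2.1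
  obtain ⟨φ, hex⟩ := hex.choice
  obtain ⟨D, hφD⟩ := hex.choice
  have hφlim : ∀ x ∈ Metric.ball x₁ ρ, Tendsto (fun r => φ r x) (𝓝[>] 1) (𝓝 (f x)) := by
    intro x hx
    refine tendsto_order.2 ⟨fun a ha => hφD.mono fun r h => ha.trans_le (h.2 x hx).1, fun a ha => ?_⟩
    obtain ⟨t, ht, hta⟩ := exists_between (lt_min ha (hft x hx).1)
    have hyint : b + (x : E) + t₀ • e ∈ interior C := by
      refine interior_maximal hball Metric.isOpen_ball ?_
      rw [mem_ball_iff_norm] at hx ⊢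
      rw [show b + (x : E) + t₀ • e - (b + (x₁ : E) + t₀ • e) = ((x - x₁ : S) : E) by
        push_cast; module, ← Submodule.coe_norm]
      linarith
    have htint : b + (x : E) + t • e ∈ interior C := by
      have h1 : t < t₀ := hta.trans_le (min_le_right _ _)
      have h2 : 0 < t₀ - f x := by linarith
      have := hconv.combo_self_interior_mem_interior
        (hC.isClosed.frontier_subset (hf x hx)) hyint (a := 1 - (t - f x) / (t₀ - f x))
        (b := (t - f x) / (t₀ - f x))
        (sub_nonneg.2 ((div_le_one h2).2 (by linarith))) (div_pos (by linarith) h2) (by ring)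
      obtain ⟨θ, hθ⟩ : ∃ θ, θ = (t - f x) / (t₀ - f x) := ⟨_, rfl⟩
      have h3 : t = f x + θ * (t₀ - f x) := by rw [hθ]; field_simp; ring
      rw [← hθ] at this
      rw [h3]
      convert this using 1
      module
    have hsm : Tendsto (fun r : ℝ => r • (b + (x : E) + t • e)) (𝓝[>] 1)
        (𝓝 (b + (x : E) + t • e)) := by
      simpa using hid.smul_const (b + (x : E) + t • e)
    filter_upwards [hφD, hsm (isOpen_interior.mem_nhds htint)] with r h hr
    exact ((h.2 x hx).2.1 t (interior_subset hr)).trans_lt (hta.trans_le (min_le_left _ _))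
  have hDlim : ∀ x ∈ Metric.ball x₁ ρ, Tendsto (fun r => D r x) (𝓝[>] 1)
      (𝓝 (pathEDist (frontier C) (b + (x : E) + f x • e) p).toReal) := by
    intro x hx
    obtain ⟨d, hd⟩ : ∃ d, d = (pathEDist (frontier C) (b + (x : E) + f x • e) p).toReal := ⟨_, rfl⟩
    have hgap : Tendsto (fun r => φ r x - f x) (𝓝[>] 1) (𝓝 0) := by
      simpa using (hφlim x hx).sub_const (f x)
    have hup : Tendsto (fun r => d + (φ r x - f x)) (𝓝[>] 1) (𝓝 d) := by
      simpa using hgap.const_add d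
    have hlow : Tendsto (fun r : ℝ => (d - (r - 1) * ‖b + (x : E) + f x • e‖ - r * (φ r x - f x)
        - r * ((r - 1) * ‖p‖) - (r - 1) * ‖p‖) / r) (𝓝[>] 1) (𝓝 d) := by
      have := (((((hid1.mul_const ‖b + (x : E) + f x • e‖).const_sub d).sub (hid.mul hgap)).sub
        (hid.mul (hid1.mul_const ‖p‖))).sub (hid1.mul_const ‖p‖)).div hid one_ne_zero
      simp only [zero_mul, mul_zero, sub_zero, div_one] at this
      exact this
    rw [← hd]
    refine tendsto_of_tendsto_of_tendsto_of_le_of_le' hlow hup ?_ ?_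
    · filter_upwards [hφD, self_mem_nhdsWithin] with r h hr
      have := (h.2 x hx).2.2.2
      rw [← hd] at this
      rw [div_le_iff₀ (one_pos.trans hr)]
      linarith
    · filter_upwards [hφD] with r h
      have := (h.2 x hx).2.2.1
      rwa [← hd] at this
  refine ⟨convex_ball _ _, fun x hx y hy α β hα hβ hαβ => ?_⟩
  have hz := convex_ball x₁ ρ hx hy hα hβ hαβ
  refine le_of_tendsto_of_tendsto
    (((((hDlim x hx).sub tendsto_const_nhds).sub (hφlim x hx)).const_smul α).add
      ((((hDlim y hy).sub tendsto_const_nhds).sub (hφlim y hy)).const_smul β))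
    (((hDlim _ hz).sub tendsto_const_nhds).sub (hφlim _ hz)) ?_
  filter_upwards [hφD] with r h
  exact h.1.2 hx hy hα hβ hαβ

/-- The distance from a point of a convex surface is DC in a chart near a point whose chart lies
below the interior. -/
lemma isDCOn_frontier_distance {C : Set E} (hC : IsCompact C) (hconv : Convex ℝ C)
    (h0C : 0 ∈ interior C) {S : Submodule ℝ E} {e b p : E}
    (he : ‖e‖ = 1) {x₁ : S} {ρ t₀ d₀ : ℝ} (hρ : 0 < ρ) (hd₀ : 0 < d₀) {f : S → ℝ}
    (hfconv : ConvexOn ℝ (Metric.ball x₁ ρ) f)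
    (hf : ∀ x ∈ Metric.ball x₁ ρ, b + (x : E) + f x • e ∈ frontier C)
    (hft : ∀ x ∈ Metric.ball x₁ ρ, f x < t₀ ∧ t₀ - f x ≤ d₀)
    (hball : Metric.ball (b + (x₁ : E) + t₀ • e) (4 * ρ) ⊆ C) (hp : p ∈ frontier C)
    (hfar : ∀ x ∈ Metric.ball x₁ ρ, 3 * d₀ ≤ ‖b + (x : E) + f x • e - p‖)
    (hfin : ∀ x ∈ Metric.ball x₁ ρ, pathEDist (frontier C) (b + (x : E) + f x • e) p ≠ ⊤) :
    IsDCOn (Metric.ball x₁ ρ)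
      (fun x => (pathEDist (frontier C) (b + (x : E) + f x • e) p).toReal) := by
  obtain ⟨R₀, hR₀⟩ := hC.isBounded.exists_norm_le
  obtain ⟨K, hK⟩ : ∃ K, K =
    (1 + (Real.toNNReal (2 * (R₀ + ‖b‖ + ‖x₁‖ + 2 * ρ) / ρ) : ℝ)) ^ 2 / (2 * d₀) := ⟨_, rfl⟩
  have hconc := concaveOn_frontier_distance hC hconv h0C hR₀ he hρ hd₀ hf hft hball hp hfar hfin
  rw [← hK] at hconc
  have hK0 : 0 ≤ K := by rw [hK]; positivity
  have hsq : ConvexOn ℝ (Metric.ball x₁ ρ) fun x : S => K * ‖x‖ ^ 2 :=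
    (((convexOn_norm (convex_ball x₁ ρ)).pow (fun _ _ => norm_nonneg _) 2).smul hK0)
  have h1 := hsq.add hfconv
  have h2 := hconc.neg
  refine ⟨_, _, h1, h2, h1.continuousOn Metric.isOpen_ball, h2.continuousOn Metric.isOpen_ball,
    fun x _ => ?_⟩
  simp only [Pi.add_apply, Pi.neg_apply]
  ring

end FrontierDistance

section LocalChart

open Filter Topology

variable {E : Type*} [NormedAddCommGroup E] [InnerProductSpace ℝ E]

lemma pathEDist_frontier_translate (C : Set E) (q a p : E) :
    pathEDist (frontier ((q + ·) ⁻¹' C)) (-q + a) (-q + p) = pathEDist (frontier C) a p := by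
  have hfr : frontier ((q + ·) ⁻¹' C) = (q + ·) ⁻¹' frontier C :=
    ((Homeomorph.addLeft q).preimage_frontier C).symm
  have hiso : ∀ v : E, LipschitzWith 1 (v + ·) := fun v => (isometry_add_left v).lipschitz
  refine le_antisymm ?_ ?_
  · have := pathEDist_map_le (X := frontier C) (Y := frontier ((q + ·) ⁻¹' C)) one_ne_zero
      (hiso (-q)).lipschitzOnWith (fun x hx => by rw [hfr]; simpa using hx) a p
    simpa using this
  · have := pathEDist_map_le (X := frontier ((q + ·) ⁻¹' C)) (Y := frontier C) one_ne_zero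
      (hiso q).lipschitzOnWith (fun x hx => by rw [hfr] at hx; exact hx) (-q + a) (-q + p)
    simpa using this

lemma line_mem_interior {C : Set E} (hconv : Convex ℝ C) {z e : E} {s t θ : ℝ}
    (hs : z + s • e ∈ C) (ht : z + t • e ∈ interior C) (hθ0 : 0 < θ) (hθ1 : θ ≤ 1) :
    z + (s + θ * (t - s)) • e ∈ interior C := by
  have := hconv.combo_self_interior_mem_interior hs ht (a := 1 - θ) (b := θ) (by linarith) hθ0
    (by ring)
  convert this using 1
  module

/-- Near a chart point below the interior, the intrinsic distance is DC. -/
lemma exists_ball_isDCOn [FiniteDimensional ℝ E] {C : Set E} (hC : IsCompact C)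
    (hconv : Convex ℝ C) {S : Submodule ℝ E} {e p : E} (he : ‖e‖ = 1) {x₁ : S} {δ : ℝ}
    (hδ : 0 < δ) {f : S → ℝ} {κ : ℝ≥0} (hfconv : ConvexOn ℝ (Metric.ball x₁ δ) f)
    (hfL : LipschitzOnWith κ f (Metric.ball x₁ δ))
    (hf : ∀ x ∈ Metric.ball x₁ δ, (x : E) + f x • e ∈ frontier C) {τ₁ : ℝ} (hτ₁ : 0 < τ₁)
    (hτ : (x₁ : E) + (f x₁ + τ₁) • e ∈ interior C) (hp : p ∈ frontier C)
    (hne : (x₁ : E) + f x₁ • e ≠ p) :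
    ∃ ρ, 0 < ρ ∧ ρ ≤ δ ∧ (∀ x ∈ Metric.ball x₁ ρ, (x : E) + f x • e ≠ p) ∧
      IsDCOn (Metric.ball x₁ ρ)
        (fun x => (pathEDist (frontier C) ((x : E) + f x • e) p).toReal) := by
  have hx₁ : x₁ ∈ Metric.ball x₁ δ := Metric.mem_ball_self hδ
  have hGL : LipschitzOnWith (1 + κ) (fun x : S => (x : E) + f x • e) (Metric.ball x₁ δ) := by
    simpa using lipschitzOnWith_graph (b := (0 : E)) he hfL
  have hnhds : Metric.ball x₁ δ ∈ 𝓝 x₁ := Metric.ball_mem_nhds _ hδ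
  have hfc : ContinuousAt f x₁ := hfL.continuousOn.continuousAt hnhds
  have hGc : ContinuousAt (fun x : S => (x : E) + f x • e) x₁ :=
    hGL.continuousOn.continuousAt hnhds
  obtain ⟨d₀, hd₀⟩ : ∃ d₀, d₀ = ‖(x₁ : E) + f x₁ • e - p‖ / 4 := ⟨_, rfl⟩
  have hd₀pos : 0 < d₀ := by
    have := norm_pos_iff.2 (sub_ne_zero.2 hne)
    rw [hd₀]; positivity
  obtain ⟨τ, hτdef⟩ : ∃ τ, τ = min τ₁ (d₀ / 2) := ⟨_, rfl⟩
  have hτ0 : 0 < τ := by rw [hτdef]; positivity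
  have hτle : τ ≤ τ₁ := hτdef ▸ min_le_left _ _
  have hτd : τ ≤ d₀ / 2 := hτdef ▸ min_le_right _ _
  have hint : (x₁ : E) + (f x₁ + τ) • e ∈ interior C := by
    have := line_mem_interior hconv (hC.isClosed.frontier_subset (hf x₁ hx₁)) hτ
      (div_pos hτ0 hτ₁) ((div_le_one hτ₁).2 hτle)
    rwa [add_sub_cancel_left, div_mul_cancel₀ _ hτ₁.ne'] at this
  obtain ⟨η, hη, hηC⟩ := Metric.mem_nhds_iff.1 (mem_interior_iff_mem_nhds.1 hint)
  have hev : ∀ᶠ x in 𝓝 x₁, |f x - f x₁| < τ ∧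
      ‖((x : E) + f x • e) - ((x₁ : E) + f x₁ • e)‖ < d₀ := by
    filter_upwards [Metric.tendsto_nhds.1 hfc τ hτ0, Metric.tendsto_nhds.1 hGc d₀ hd₀pos]
      with x h1 h2
    exact ⟨h1, by rwa [dist_eq_norm] at h2⟩
  obtain ⟨ρ₀, hρ₀, hρball⟩ := Metric.eventually_nhds_iff_ball.1 hev
  obtain ⟨ρ, hρdef⟩ : ∃ ρ, ρ = min (min ρ₀ δ) (η / 4) := ⟨_, rfl⟩
  have hρ : 0 < ρ := by rw [hρdef]; positivity
  have hρδ : ρ ≤ δ := hρdef ▸ (min_le_left _ _).trans (min_le_right _ _)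
  have hρη : ρ ≤ η / 4 := hρdef ▸ min_le_right _ _
  have hsub : Metric.ball x₁ ρ ⊆ Metric.ball x₁ δ := Metric.ball_subset_ball hρδ
  have hsub₀ : Metric.ball x₁ ρ ⊆ Metric.ball x₁ ρ₀ :=
    Metric.ball_subset_ball (hρdef ▸ (min_le_left _ _).trans (min_le_left _ _))
  have hfar : ∀ x ∈ Metric.ball x₁ ρ, 3 * d₀ ≤ ‖(x : E) + f x • e - p‖ := fun x hx => by
    have h1 := (hρball x (hsub₀ hx)).2
    have h2 := norm_sub_le_norm_sub_add_norm_sub ((x₁ : E) + f x₁ • e) ((x : E) + f x • e) p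
    rw [norm_sub_rev _ ((x : E) + f x • e)] at h2
    linarith
  refine ⟨ρ, hρ, hρδ, fun x hx h => ?_, ?_⟩
  · have := hfar x hx
    rw [h, sub_self, norm_zero] at this
    linarith
  by_cases htop : ∃ x ∈ Metric.ball x₁ ρ, pathEDist (frontier C) ((x : E) + f x • e) p = ⊤
  · obtain ⟨y, hy, hytop⟩ := htop
    have hall : ∀ x ∈ Metric.ball x₁ ρ, pathEDist (frontier C) ((x : E) + f x • e) p = ⊤ := by
      intro x hx
      by_contra hfin
      have h1 := pathEDist_chart_le (by positivity) hfconv.1 hGL hf (hsub hy) (hsub hx)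
      have h2 := (pathEDist_triangle (frontier C) ((y : E) + f y • e) ((x : E) + f x • e) p).trans
        (add_le_add_left h1 _)
      rw [hytop, top_le_iff, ENNReal.add_eq_top] at h2
      exact h2.elim (ENNReal.mul_ne_top ENNReal.coe_ne_top (edist_ne_top _ _)) hfin
    have h0 : ConvexOn ℝ (Metric.ball x₁ ρ) fun _ : S => (0 : ℝ) :=
      convexOn_const 0 (convex_ball _ _)
    refine ⟨_, _, h0, h0, continuousOn_const, continuousOn_const, fun x hx => ?_⟩
    simp [hall x hx]
  push Not at htop
  have htr := pathEDist_frontier_translate C ((x₁ : E) + (f x₁ + τ) • e)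
  obtain ⟨q, hq⟩ : ∃ q, q = (x₁ : E) + (f x₁ + τ) • e := ⟨_, rfl⟩
  rw [← hq] at htr hint hηC
  have hfr : frontier ((q + ·) ⁻¹' C) = (q + ·) ⁻¹' frontier C :=
    ((Homeomorph.addLeft q).preimage_frontier C).symm
  have hin : interior ((q + ·) ⁻¹' C) = (q + ·) ⁻¹' interior C :=
    ((Homeomorph.addLeft q).preimage_interior C).symm
  have hb : ∀ x : S, -q + (x : E) + f x • e = -q + ((x : E) + f x • e) := fun x => add_assoc _ _ _
  have key := isDCOn_frontier_distance (C := (q + ·) ⁻¹' C)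
    ((Homeomorph.addLeft q).isClosedEmbedding.isCompact_preimage hC)
    (hconv.translate_preimage_right q) (by rw [hin]; simpa using hint) (b := -q) (p := -q + p) he
    hρ hd₀pos (t₀ := f x₁ + τ) (hfconv.subset hsub (convex_ball _ _))
    (fun x hx => by rw [hfr, hb]; simpa using hf x (hsub hx))
    (fun x hx => by
      have := abs_lt.1 (hρball x (hsub₀ hx)).1
      constructor <;> linarith)
    (fun y hy => hηC (by
      rw [mem_ball_iff_norm] at hy ⊢
      rw [add_assoc, ← hq, neg_add_cancel, sub_zero] at hy
      rw [add_sub_cancel_left]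
      linarith))
    (by rw [hfr]; simpa using hp)
    (fun x hx => by rw [hb, add_sub_add_left_eq_sub]; exact hfar x hx)
    (fun x hx => by rw [hb, htr]; exact htop x hx)
  simpa only [hb, htr] using key

end LocalChart

section Orientation

open Filter Topology

variable {E : Type*} [NormedAddCommGroup E] [InnerProductSpace ℝ E]

lemma add_smul_injective_of_orthogonal {e : E} (he : ‖e‖ = 1)
    {x y : ↥((Submodule.span ℝ {e})ᗮ)} {s t : ℝ} (h : (x : E) + s • e = (y : E) + t • e) :
    x = y ∧ s = t := by
  have hin : ∀ z : ↥((Submodule.span ℝ {e})ᗮ), inner ℝ e (z : E) = 0 := fun z =>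
    (Submodule.mem_orthogonal _ _).1 z.2 e (Submodule.mem_span_singleton_self e)
  have h1 := congrArg (inner ℝ e) h
  simp only [inner_add_right, hin, real_inner_smul_right, real_inner_self_eq_norm_sq, he,
    zero_add, one_pow, mul_one] at h1
  subst h1
  exact ⟨Subtype.ext (add_right_cancel h), rfl⟩

/-- At a chart point, the interior of the convex body lies on one vertical side of the graph. -/
lemma exists_vertical_side {C : Set E} (hC : IsConvexBody C) {e : E}
    {V : Set ↥((Submodule.span ℝ {e})ᗮ)} {f : ↥((Submodule.span ℝ {e})ᗮ) → ℝ}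
    (hchart : IsStandardChart (frontier C) e V f) {x₁ : ↥((Submodule.span ℝ {e})ᗮ)}
    (hx₁ : x₁ ∈ V) :
    ∃ δ τ₀ σ : ℝ, 0 < δ ∧ 0 < τ₀ ∧ (σ = 1 ∨ σ = -1) ∧ Metric.ball x₁ δ ⊆ V ∧
      ∀ x ∈ Metric.ball x₁ δ, ∀ τ ∈ Ioo 0 τ₀, (x : E) + (f x + σ * τ) • e ∈ interior C := by
  obtain ⟨he, hVo, -, -, ⟨κ, hfL⟩, O, hO, hgraph⟩ := hchart
  obtain ⟨hCc, hconv, q, hq⟩ := hC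
  have hfc : ContinuousOn f V := hfL.continuousOn
  have hGmem : ∀ x ∈ V, (x : E) + f x • e ∈ frontier C ∩ O := fun x hx =>
    hgraph ▸ mem_image_of_mem _ hx
  have hev : ∀ᶠ z : ↥((Submodule.span ℝ {e})ᗮ) × ℝ in 𝓝 (x₁, 0),
      z.1 ∈ V ∧ (z.1 : E) + (f z.1 + z.2) • e ∈ O := by
    have hf1 : ContinuousAt (fun z : ↥((Submodule.span ℝ {e})ᗮ) × ℝ => f z.1) (x₁, 0) :=
      ContinuousAt.comp (f := Prod.fst) (hfc.continuousAt (hVo.mem_nhds hx₁)) continuousAt_fst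
    have h2 : ContinuousAt (fun z : ↥((Submodule.span ℝ {e})ᗮ) × ℝ =>
        (z.1 : E) + (f z.1 + z.2) • e) (x₁, 0) :=
      (continuous_subtype_val.comp continuous_fst).continuousAt.add
        ((hf1.add continuousAt_snd).smul continuousAt_const)
    refine (continuousAt_fst.eventually_mem (hVo.mem_nhds hx₁)).and
      (h2.eventually_mem (hO.mem_nhds ?_))
    simpa using (hGmem x₁ hx₁).2
  obtain ⟨δ, hδ, hball⟩ := Metric.eventually_nhds_iff_ball.1 hev
  simp only [← ball_prod_same, Prod.forall, mem_prod, Metric.mem_ball (x := (0 : ℝ)),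
    Real.dist_0_eq_abs] at hball
  have hBV : Metric.ball x₁ δ ⊆ V := fun x hx => (hball x 0 ⟨hx, by simpa using hδ⟩).1
  have hoff : ∀ x ∈ Metric.ball x₁ δ, ∀ τ : ℝ, |τ| < δ → τ ≠ 0 →
      (x : E) + (f x + τ) • e ∉ frontier C := by
    intro x hx τ hτ hτ0 hX
    have hmem : (x : E) + (f x + τ) • e ∈ frontier C ∩ O := ⟨hX, (hball x τ ⟨hx, hτ⟩).2⟩
    rw [← hgraph] at hmem
    obtain ⟨y, hy, hyx⟩ := hmem
    obtain ⟨rfl, h⟩ := add_smul_injective_of_orthogonal he hyx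
    exact hτ0 (by linarith)
  obtain ⟨x₂, hx₂, τ₂, hτ₂, hint⟩ : ∃ x ∈ Metric.ball x₁ δ, ∃ τ : ℝ, |τ| < δ ∧
      (x : E) + (f x + τ) • e ∈ interior C := by
    obtain ⟨y, hy, w, hw, hyw⟩ := Submodule.exists_add_mem_mem_orthogonal
      (K := Submodule.span ℝ {e}) (q - ((x₁ : E) + f x₁ • e))
    obtain ⟨μ, rfl⟩ := Submodule.mem_span_singleton.1 hy
    lift w to ↥((Submodule.span ℝ {e})ᗮ) using hw
    have hpath : ContinuousAt (fun s : ℝ => x₁ + s • w) 0 := by fun_prop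
    have hVx : V ∈ 𝓝 (x₁ + (0 : ℝ) • w) := by simpa using hVo.mem_nhds hx₁
    have hf1 : ContinuousAt (fun s : ℝ => f (x₁ + s • w)) 0 :=
      ContinuousAt.comp (f := fun s : ℝ => x₁ + s • w) (hfc.continuousAt hVx) hpath
    have h2 : ContinuousAt (fun s : ℝ => |f x₁ + s * μ - f (x₁ + s • w)|) 0 :=
      ((by fun_prop : ContinuousAt (fun s : ℝ => f x₁ + s * μ) 0).sub hf1).abs
    have e1 : ∀ᶠ s : ℝ in 𝓝[>] 0, x₁ + s • w ∈ Metric.ball x₁ δ :=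
      (hpath.eventually_mem (by simpa using Metric.ball_mem_nhds x₁ hδ)).filter_mono
        nhdsWithin_le_nhds
    have e2 : ∀ᶠ s : ℝ in 𝓝[>] 0, |f x₁ + s * μ - f (x₁ + s • w)| < δ :=
      (h2.eventually_lt continuousAt_const (by simpa using hδ)).filter_mono nhdsWithin_le_nhds
    obtain ⟨s, h3, h4, hs⟩ := (e1.and (e2.and (Ioo_mem_nhdsGT one_pos))).exists
    refine ⟨x₁ + s • w, h3, _, h4, ?_⟩
    have h5 := hconv.combo_self_interior_mem_interior
      (hCc.isClosed.frontier_subset (hGmem x₁ hx₁).1) hq (a := 1 - s) (b := s)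
      (by linarith [hs.2]) hs.1 (by ring)
    rw [show q = (x₁ : E) + f x₁ • e + (μ • e + w) by rw [← hyw]; abel] at h5
    convert h5 using 1
    push_cast
    module
  have hτ₂0 : τ₂ ≠ 0 := fun h => by
    rw [h, add_zero] at hint
    exact (hGmem x₂ (hBV hx₂)).1.2 hint
  have hside : ∀ σ : ℝ, (σ = 1 ∨ σ = -1) → 0 < σ * τ₂ →
      ∀ x ∈ Metric.ball x₁ δ, ∀ τ ∈ Ioo 0 δ, (x : E) + (f x + σ * τ) • e ∈ interior C := by
    intro σ hσ hpos x hx τ hτ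
    have habs : |σ| = 1 := by rcases hσ with rfl | rfl <;> simp
    have hσσ : σ * σ = 1 := by rcases hσ with rfl | rfl <;> norm_num
    have hpre : IsPreconnected ((fun z : ↥((Submodule.span ℝ {e})ᗮ) × ℝ =>
        (z.1 : E) + (f z.1 + σ * z.2) • e) '' (Metric.ball x₁ δ ×ˢ Ioo 0 δ)) := by
      refine (((convex_ball x₁ δ).isPreconnected).prod isPreconnected_Ioo).image _ ?_
      have hf1 : ContinuousOn (fun z : ↥((Submodule.span ℝ {e})ᗮ) × ℝ => f z.1)
          (Metric.ball x₁ δ ×ˢ Ioo 0 δ) :=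
        hfc.comp continuousOn_fst fun z hz => hBV hz.1
      exact (continuous_subtype_val.comp continuous_fst).continuousOn.add
        ((hf1.add (continuousOn_const.mul continuousOn_snd)).smul continuousOn_const)
    refine hpre.subset_interior ⟨(x₂ : E) + (f x₂ + τ₂) • e, ⟨(x₂, σ * τ₂), ⟨hx₂, hpos, ?_⟩, ?_⟩,
      interior_subset hint⟩ ?_ ⟨(x, τ), ⟨hx, hτ⟩, rfl⟩
    · rw [← abs_of_pos hpos, abs_mul, habs, one_mul]
      exact hτ₂
    · simp only [← mul_assoc, hσσ, one_mul]
    · rintro _ ⟨⟨y, t⟩, ⟨hy, ht⟩, rfl⟩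
      refine hoff y hy _ ?_ (mul_ne_zero (fun h => by simp [h] at hσσ) ht.1.ne')
      rw [abs_mul, habs, one_mul, abs_of_pos ht.1]
      exact ht.2
  rcases hτ₂0.lt_or_gt with h | h
  · exact ⟨δ, δ, -1, hδ, hδ, Or.inr rfl, hBV, hside (-1) (Or.inr rfl) (by linarith)⟩
  · exact ⟨δ, δ, 1, hδ, hδ, Or.inl rfl, hBV, hside 1 (Or.inl rfl) (by linarith)⟩

/-- A convex chart function whose graph lies above the interior is affine, hence its negative is
convex. -/
lemma ConvexOn.neg_of_interior_below {C : Set E} (hCc : IsClosed C) (hconv : Convex ℝ C)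
    {S : Submodule ℝ E} {e : E} {B : Set S} {f : S → ℝ} (hf : ConvexOn ℝ B f)
    (hfr : ∀ x ∈ B, (x : E) + f x • e ∈ frontier C) {τ : ℝ} (hτ : 0 < τ)
    (hint : ∀ x ∈ B, (x : E) + (f x - τ) • e ∈ interior C) : ConvexOn ℝ B (-f) := by
  refine ⟨hf.1, fun x hx y hy a c ha hc hac => ?_⟩
  have hz := hf.1 hx hy ha hc hac
  simp only [Pi.neg_apply, smul_eq_mul, mul_neg]
  suffices a * f x + c * f y ≤ f (a • x + c • y) by linarith
  by_contra! hlt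
  obtain ⟨z, hzdef⟩ : ∃ z, z = a • x + c • y := ⟨_, rfl⟩
  rw [← hzdef] at hz hlt
  have hup : (z : E) + (a * f x + c * f y) • e ∈ C := by
    have := hconv (hCc.frontier_subset (hfr x hx)) (hCc.frontier_subset (hfr y hy)) ha hc hac
    convert this using 1
    rw [hzdef]
    push_cast
    module
  have hpos : 0 < (a * f x + c * f y) - (f z - τ) := by linarith
  have := line_mem_interior hconv hup (hint z hz)
    (θ := ((a * f x + c * f y) - f z) / ((a * f x + c * f y) - (f z - τ)))
    (div_pos (by linarith) hpos) ((div_le_one hpos).2 (by linarith))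
  have e1 : (a * f x + c * f y) + ((a * f x + c * f y) - f z) /
      ((a * f x + c * f y) - (f z - τ)) * (f z - τ - (a * f x + c * f y)) = f z := by
    rw [← neg_sub (a * f x + c * f y) (f z - τ), mul_neg, div_mul_cancel₀ _ hpos.ne']
    ring
  rw [e1] at this
  exact (hfr z hz).2 this

end Orientation

/-- Let `X ⊂ ℝ^{n+1}` be a convex surface, `x₀ ∈ X`, and let `(e,V)`
give a standard chart on `X` with associated convex function `f`. Then the function
`x ↦ dist_X(x + f(x)e, x₀)` is locally DC on the open set `{x ∈ V : x + f(x)e ≠ x₀}`. -/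
theorem dist_from_point_locallyDC (n : ℕ)
    (X : Set (EuclideanSpace ℝ (Fin (n + 1)))) (hX : IsConvexSurface X)
    (x₀ : EuclideanSpace ℝ (Fin (n + 1))) (hx₀ : x₀ ∈ X)
    (e : EuclideanSpace ℝ (Fin (n + 1)))
    (V : Set ↥((Submodule.span ℝ {e})ᗮ)) (f : ↥((Submodule.span ℝ {e})ᗮ) → ℝ)
    (hchart : IsStandardChart X e V f) :
    LocallyDCOn
      {x : ↥((Submodule.span ℝ {e})ᗮ) | x ∈ V ∧
        (x : EuclideanSpace ℝ (Fin (n + 1))) + f x • e ≠ x₀}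
      (fun x : ↥((Submodule.span ℝ {e})ᗮ) =>
        intrinsicDist X ((x : EuclideanSpace ℝ (Fin (n + 1))) + f x • e) x₀) := by
  obtain ⟨C, hC, rfl⟩ := hX
  rintro x₁ ⟨hx₁, hne⟩
  obtain ⟨δ, τ₀, σ, hδ, hτ₀, hσ, hBV, hside⟩ := exists_vertical_side hC hchart hx₁
  obtain ⟨he, -, -, hfconv, ⟨κ, hfL⟩, O, -, hgraph⟩ := hchart
  have hx₁B : x₁ ∈ Metric.ball x₁ δ := Metric.mem_ball_self hδ
  have hτ : τ₀ / 2 ∈ Ioo 0 τ₀ := ⟨by linarith, by linarith⟩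
  have hfr : ∀ x ∈ Metric.ball x₁ δ,
      (x : EuclideanSpace ℝ (Fin (n + 1))) + f x • e ∈ frontier C := fun x hx =>
    (hgraph ▸ mem_image_of_mem _ (hBV hx) : _ ∈ frontier C ∩ O).1
  have hfB := hfconv.subset hBV (convex_ball _ _)
  have hfLB := hfL.mono hBV
  obtain ⟨ρ, hρ, hρδ, hneρ, hDC⟩ : ∃ ρ, 0 < ρ ∧ ρ ≤ δ ∧
      (∀ x ∈ Metric.ball x₁ ρ, (x : EuclideanSpace ℝ (Fin (n + 1))) + f x • e ≠ x₀) ∧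
      IsDCOn (Metric.ball x₁ ρ) (fun x => (pathEDist (frontier C)
        ((x : EuclideanSpace ℝ (Fin (n + 1))) + f x • e) x₀).toReal) := by
    rcases hσ with rfl | rfl
    · refine exists_ball_isDCOn hC.1 hC.2.1 he hδ hfB hfLB hfr hτ.1 ?_ hx₀ hne
      simpa using hside x₁ hx₁B _ hτ
    · have hneg := hfB.neg_of_interior_below hC.1.isClosed hC.2.1 hfr hτ.1 fun x hx => by
        simpa [sub_eq_add_neg] using hside x hx _ hτ
      have key := exists_ball_isDCOn (f := -f) (e := -e) (p := x₀) hC.1 hC.2.1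
        (by rwa [norm_neg]) hδ hneg hfLB.neg (by simpa using hfr) hτ.1 ?_ hx₀ (by simpa using hne)
      · simpa using key
      · have := hside x₁ hx₁B _ hτ
        convert this using 2
        simp only [Pi.neg_apply]
        module
  exact ⟨Metric.ball x₁ ρ, Metric.isOpen_ball, convex_ball _ _, Metric.mem_ball_self hρ,
    fun x hx => ⟨hBV (Metric.ball_subset_ball hρδ hx), hneρ x hx⟩, hDC⟩
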